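/- Assume f ≡ 1 and g ≡ 1 on a smooth bounded domain Ω ⊂ ℝ^N with N ≤ 7. Then the extremal solution (u*, v*) of the system S_{λ*,μ*}, defined as the pointwise limit of the minimal solutions (u_{λ_n}, v_{μ_n}) along a sequence (λ_n,μ_n) below the critical curve converging to a point (λ*,μ*) on the critical curve, is smooth; in particular sup_Ω u* < 1 and sup_Ω v* < 1. -/

import Mathlib

open MeasureTheory Metric Set Filter Topology

noncomputable section

/-- Euclidean space `ℝ^N`. -/
abbrev Euc (N : ℕ) := EuclideanSpace ℝ (Fin N)

/-- Second derivative of `u` at `x` in the `i`-th coordinate direction. -/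
noncomputable def secondDerivCoord {N : ℕ} (u : Euc N → ℝ) (i : Fin N) (x : Euc N) : ℝ :=
  deriv (fun t : ℝ => fderiv ℝ u (x + t • (EuclideanSpace.single i (1:ℝ)))
    (EuclideanSpace.single i (1:ℝ))) 0

/-- The Laplacian `Δu = ∑ ∂²u/∂xᵢ²`. -/
noncomputable def lap {N : ℕ} (u : Euc N → ℝ) (x : Euc N) : ℝ :=
  ∑ i : Fin N, secondDerivCoord u i x

/-- A (smooth) bounded domain: open, bounded and nonempty. -/
def IsBddDomain {N : ℕ} (Ω : Set (Euc N)) : Prop :=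
  IsOpen Ω ∧ Bornology.IsBounded Ω ∧ Ω.Nonempty

/-- Hypothesis (H): `f ∈ C^α(Ω̄)` for some `α ∈ (0,1]`, `0 ≤ f ≤ 1`, and `f > 0`
on a subset of `Ω` of positive measure. -/
def HypH {N : ℕ} (Ω : Set (Euc N)) (f : Euc N → ℝ) : Prop :=
  (∃ α : NNReal, 0 < α ∧ α ≤ 1 ∧ ∃ C : NNReal, HolderOnWith C α f (closure Ω)) ∧
  (∀ x ∈ closure Ω, 0 ≤ f x ∧ f x ≤ 1) ∧
  0 < volume {x ∈ Ω | 0 < f x}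

/-- A classical solution `(u,v)` of the system `S_{λ,μ}` on `Ω`:
`u, v ∈ C²(Ω) ∩ C(Ω̄)`, `0 ≤ u, v < 1` in `Ω`, `u = v = 0` on `∂Ω`,
`-Δu = λ f(x)/(1-v)²` and `-Δv = μ g(x)/(1-u)²` in `Ω`. -/
structure IsClassicalSolution {N : ℕ} (Ω : Set (Euc N)) (f g : Euc N → ℝ)
    (lam mu : ℝ) (u v : Euc N → ℝ) : Prop where
  smooth_u : ContDiffOn ℝ 2 u Ω
  smooth_v : ContDiffOn ℝ 2 v Ω
  cont_u : ContinuousOn u (closure Ω)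
  cont_v : ContinuousOn v (closure Ω)
  range_u : ∀ x ∈ Ω, 0 ≤ u x ∧ u x < 1
  range_v : ∀ x ∈ Ω, 0 ≤ v x ∧ v x < 1
  bdry_u : ∀ x ∈ frontier Ω, u x = 0
  bdry_v : ∀ x ∈ frontier Ω, v x = 0
  eq_u : ∀ x ∈ Ω, -lap u x = lam * f x / (1 - v x) ^ 2
  eq_v : ∀ x ∈ Ω, -lap v x = mu * g x / (1 - u x) ^ 2

/-- A minimal solution: a classical solution lying below every classical solution. -/
def IsMinimalSolution {N : ℕ} (Ω : Set (Euc N)) (f g : Euc N → ℝ)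
    (lam mu : ℝ) (u v : Euc N → ℝ) : Prop :=
  IsClassicalSolution Ω f g lam mu u v ∧
  ∀ U V : Euc N → ℝ, IsClassicalSolution Ω f g lam mu U V →
    ∀ x ∈ Ω, u x ≤ U x ∧ v x ≤ V x

/-- The existence region `Λ`: parameter pairs in the positive quadrant for which
the system has a classical solution. -/
def LambdaSet {N : ℕ} (Ω : Set (Euc N)) (f g : Euc N → ℝ) : Set (ℝ × ℝ) :=
  {p | 0 < p.1 ∧ 0 < p.2 ∧ ∃ u v, IsClassicalSolution Ω f g p.1 p.2 u v}


abbrev ee {N : ℕ} (i : Fin N) : Euc N := EuclideanSpace.single i (1:ℝ)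

def Dd {N : ℕ} (i : Fin N) (f : Euc N → ℝ) (x : Euc N) : ℝ := fderiv ℝ f x (ee i)

lemma Dd_congr {N : ℕ} {i : Fin N} {f g : Euc N → ℝ} {x : Euc N} (h : f =ᶠ[𝓝 x] g) :
    Dd i f x = Dd i g x := by
  unfold Dd; rw [h.fderiv_eq]

lemma Dd_congr_nhds {N : ℕ} {i : Fin N} {f g : Euc N → ℝ} {x : Euc N} (h : f =ᶠ[𝓝 x] g) :
    Dd i f =ᶠ[𝓝 x] Dd i g := by
  filter_upwards [h.eventuallyEq_nhds] with y hy using Dd_congr hy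

lemma contDiffAt_Dd {N : ℕ} {i : Fin N} {f : Euc N → ℝ} {x : Euc N}
    (h : ContDiffAt ℝ 2 f x) : ContDiffAt ℝ 1 (Dd i f) x :=
  (h.fderiv_right (m := 1) (by norm_num)).clm_apply contDiffAt_const

lemma contAt_Dd {N : ℕ} {i : Fin N} {f : Euc N → ℝ} {x : Euc N}
    (h : ContDiffAt ℝ 1 f x) : ContinuousAt (Dd i f) x :=
  ((h.fderiv_right (m := 0) (by norm_num)).clm_apply contDiffAt_const).continuousAt

lemma secondDerivCoord_eq {N : ℕ} {i : Fin N} {f : Euc N → ℝ} {x : Euc N}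
    (h : ContDiffAt ℝ 2 f x) : secondDerivCoord f i x = Dd i (Dd i f) x := by
  have h1 : HasFDerivAt (Dd i f) (fderiv ℝ (Dd i f) x) x :=
    ((contDiffAt_Dd h).differentiableAt (by norm_num)).hasFDerivAt
  have h2 : HasDerivAt (fun t : ℝ => x + t • ee i) (ee i) 0 := by
    have := ((hasDerivAt_id (0:ℝ)).smul_const (ee i)).const_add x
    simpa using this
  have h3 : HasFDerivAt (Dd i f) (fderiv ℝ (Dd i f) x) (x + (0:ℝ) • ee i) := by simpa using h1
  exact (h3.comp_hasDerivAt (0:ℝ) h2).deriv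

lemma lap_eq {N : ℕ} {f : Euc N → ℝ} {x : Euc N}
    (h : ContDiffAt ℝ 2 f x) : lap f x = ∑ i, Dd i (Dd i f) x := by
  unfold lap; exact Finset.sum_congr rfl fun i _ => secondDerivCoord_eq h

lemma lap_congr {N : ℕ} {f g : Euc N → ℝ} {x : Euc N} (hg : ContDiffAt ℝ 2 g x)
    (h : f =ᶠ[𝓝 x] g) : lap f x = lap g x := by
  rw [lap_eq hg, lap_eq (hg.congr_of_eventuallyEq h)]
  exact Finset.sum_congr rfl fun i _ => Dd_congr (Dd_congr_nhds h)

lemma contAt_lap {N : ℕ} {f : Euc N → ℝ} {x : Euc N} (h : ContDiffAt ℝ 2 f x) :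
    ContinuousAt (lap f) x := by
  have h1 : ∀ᶠ y in 𝓝 x, lap f y = ∑ i, Dd i (Dd i f) y := by
    filter_upwards [h.eventually (by simp)] with y hy using lap_eq hy
  refine ContinuousAt.congr ?_ (h1.mono fun y hy => hy.symm)
  exact tendsto_finsetSum _ fun i _ => contAt_Dd (contDiffAt_Dd h)

lemma Dd_add {N : ℕ} {i : Fin N} {f g : Euc N → ℝ} {x : Euc N}
    (hf : DifferentiableAt ℝ f x) (hg : DifferentiableAt ℝ g x) :
    Dd i (fun y => f y + g y) x = Dd i f x + Dd i g x := by
  unfold Dd; rw [fderiv_fun_add hf hg]; rfl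

lemma Dd_mul {N : ℕ} {i : Fin N} {f g : Euc N → ℝ} {x : Euc N}
    (hf : DifferentiableAt ℝ f x) (hg : DifferentiableAt ℝ g x) :
    Dd i (fun y => f y * g y) x = f x * Dd i g x + g x * Dd i f x := by
  unfold Dd; rw [fderiv_fun_mul hf hg]; rfl

lemma Dd_const_mul {N : ℕ} {i : Fin N} {f : Euc N → ℝ} {x : Euc N} (c : ℝ)
    (hf : DifferentiableAt ℝ f x) :
    Dd i (fun y => c * f y) x = c * Dd i f x := by
  unfold Dd; rw [fderiv_const_mul hf]; rfl

lemma Dd_comp {N : ℕ} {i : Fin N} {f : Euc N → ℝ} {x : Euc N} {F : ℝ → ℝ} {F' : ℝ}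
    (hF : HasDerivAt F F' (f x)) (hf : DifferentiableAt ℝ f x) :
    Dd i (fun y => F (f y)) x = F' * Dd i f x := by
  unfold Dd
  have := (hF.comp_hasFDerivAt x hf.hasFDerivAt).fderiv
  change fderiv ℝ (F ∘ f) x (ee i) = _
  rw [this]; rfl

lemma lap_add {N : ℕ} {f g : Euc N → ℝ} {x : Euc N}
    (hf : ContDiffAt ℝ 2 f x) (hg : ContDiffAt ℝ 2 g x) :
    lap (fun y => f y + g y) x = lap f x + lap g x := by
  rw [lap_eq hf, lap_eq hg, lap_eq (hf.add hg), ← Finset.sum_add_distrib]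
  refine Finset.sum_congr rfl fun i _ => ?_
  have : Dd i (fun y => f y + g y) =ᶠ[𝓝 x] fun y => Dd i f y + Dd i g y := by
    filter_upwards [hf.eventually (by simp), hg.eventually (by simp)] with y h1 h2
    exact Dd_add (h1.differentiableAt (by norm_num)) (h2.differentiableAt (by norm_num))
  rw [Dd_congr this, Dd_add ((contDiffAt_Dd hf).differentiableAt (by norm_num))
    ((contDiffAt_Dd hg).differentiableAt (by norm_num))]

lemma lap_const_mul {N : ℕ} {f : Euc N → ℝ} {x : Euc N} (c : ℝ)
    (hf : ContDiffAt ℝ 2 f x) :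
    lap (fun y => c * f y) x = c * lap f x := by
  rw [lap_eq hf, lap_eq (contDiffAt_const.mul hf), Finset.mul_sum]
  refine Finset.sum_congr rfl fun i _ => ?_
  have : Dd i (fun y => c * f y) =ᶠ[𝓝 x] fun y => c * Dd i f y := by
    filter_upwards [hf.eventually (by simp)] with y h1
    exact Dd_const_mul c (h1.differentiableAt (by norm_num))
  rw [Dd_congr this, Dd_const_mul c ((contDiffAt_Dd hf).differentiableAt (by norm_num))]

lemma lap_sub {N : ℕ} {f g : Euc N → ℝ} {x : Euc N}
    (hf : ContDiffAt ℝ 2 f x) (hg : ContDiffAt ℝ 2 g x) :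
    lap (fun y => f y - g y) x = lap f x - lap g x := by
  have := lap_add hf ((contDiffAt_const (c := (-1:ℝ))).mul hg)
  rw [lap_const_mul _ hg] at this
  have e : (fun y => f y - g y) = fun y => f y + (-1) * g y := by ext y; ring
  rw [e, this]; ring

lemma lap_comp {N : ℕ} {f : Euc N → ℝ} {x : Euc N} {F F' : ℝ → ℝ} {F'' : ℝ}
    (hf : ContDiffAt ℝ 2 f x) (hc : ContDiffAt ℝ 2 (fun y => F (f y)) x)
    (hF : ∀ᶠ s in 𝓝 (f x), HasDerivAt F (F' s) s)
    (hF' : HasDerivAt F' F'' (f x)) :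
    lap (fun y => F (f y)) x = F' (f x) * lap f x + F'' * ∑ i, (Dd i f x)^2 := by
  have hd := hf.differentiableAt (by norm_num)
  rw [lap_eq hf, lap_eq hc, Finset.mul_sum, Finset.mul_sum, ← Finset.sum_add_distrib]
  refine Finset.sum_congr rfl fun i _ => ?_
  have : Dd i (fun y => F (f y)) =ᶠ[𝓝 x] fun y => F' (f y) * Dd i f y := by
    filter_upwards [hf.eventually (by simp), hf.continuousAt.eventually hF] with y h1 h2
    exact Dd_comp h2 (h1.differentiableAt (by norm_num))
  have hdc : DifferentiableAt ℝ (fun y => F' (f y)) x :=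
    (hF'.comp_hasFDerivAt x hd.hasFDerivAt).differentiableAt
  rw [Dd_congr this, Dd_mul hdc
    ((contDiffAt_Dd hf).differentiableAt (by norm_num)), Dd_comp hF' hd]
  ring

lemma ext_ball {N : ℕ} {n : ℕ∞} {V : Set (Euc N)} (hV : IsOpen V) {f : Euc N → ℝ}
    (hf : ContDiffOn ℝ n f V) {x : Euc N} {r : ℝ} (hr : 0 < r) (hx : closedBall x r ⊆ V) :
    ∃ g : Euc N → ℝ, ContDiff ℝ n g ∧ HasCompactSupport g ∧ 
      ∀ y ∈ closedBall x r, g =ᶠ[𝓝 y] f := by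
  obtain ⟨δ, hδ, hsub⟩ := (isCompact_closedBall x r).exists_cthickening_subset_open hV hx
  rw [cthickening_closedBall hδ.le hr.le] at hsub
  let β : ContDiffBump x := ⟨r + δ/2, r + δ, by positivity, by linarith⟩
  refine ⟨fun y => β y * f y, ?_, β.hasCompactSupport.mul_right, ?_⟩
  · rw [contDiff_iff_contDiffAt]
    intro y
    by_cases hy : y ∈ closedBall x (r+δ)
    · exact β.contDiff.contDiffAt.mul (hf.contDiffAt (hV.mem_nhds (hsub (by rwa [add_comm]))))
    · have : (fun y => β y * f y) =ᶠ[𝓝 y] fun _ => 0 := by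
        filter_upwards [isClosed_closedBall.isOpen_compl.mem_nhds hy] with z hz
        have : β z = 0 := by
          apply β.zero_of_le_dist
          simp only [mem_compl_iff, mem_closedBall, not_le] at hz
          exact hz.le
        simp [this]
      exact contDiffAt_const.congr_of_eventuallyEq this
  · intro y hy
    have : ball x (r + δ/2) ∈ 𝓝 y := isOpen_ball.mem_nhds (by
      simp only [mem_closedBall, mem_ball] at *; linarith)
    filter_upwards [this] with z hz
    rw [β.one_of_mem_closedBall (ball_subset_closedBall hz), one_mul]

/-- compactly supported C1 functions in a set -/
structure C1c {N : ℕ} (Ω : Set (Euc N)) (p : Euc N → ℝ) : Prop where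
  cd : ContDiff ℝ 1 p
  cs : HasCompactSupport p
  sub : tsupport p ⊆ Ω

lemma tsupport_Dd {N : ℕ} {i : Fin N} {f : Euc N → ℝ} : tsupport (Dd i f) ⊆ tsupport f := by
  refine (tsupport_fderiv_subset ℝ (f := f)).trans' ?_
  apply closure_mono
  intro x hx h
  apply hx; simp [Dd, h]

lemma Dd_zero_of_notMem {N : ℕ} {i : Fin N} {f : Euc N → ℝ} {x : Euc N} (h : x ∉ tsupport f) :
    Dd i f x = 0 := image_eq_zero_of_notMem_tsupport fun h' => h (tsupport_Dd h')

lemma cont_of_tsupport {N : ℕ} {Ω : Set (Euc N)} (hΩ : IsOpen Ω) {p : Euc N → ℝ}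
    (h1 : ContinuousOn p Ω) (h2 : tsupport p ⊆ Ω) : Continuous p := by
  rw [continuous_iff_continuousAt]
  intro x
  by_cases hx : x ∈ tsupport p
  · exact h1.continuousAt (hΩ.mem_nhds (h2 hx))
  · exact (continuousAt_const (y := (0:ℝ))).congr 
      ((notMem_tsupport_iff_eventuallyEq.1 hx).mono fun y hy => hy.symm)

lemma contMul {N : ℕ} {Ω : Set (Euc N)} (hΩ : IsOpen Ω) {p q : Euc N → ℝ}
    (hp : Continuous p) (hp2 : tsupport p ⊆ Ω) (hq : ContinuousOn q Ω) :
    Continuous (fun x => p x * q x) :=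
  cont_of_tsupport hΩ (hp.continuousOn.mul hq) ((tsupport_mul_subset_left).trans hp2)

lemma intMul {N : ℕ} {Ω : Set (Euc N)} (hΩ : IsOpen Ω) {p q : Euc N → ℝ}
    (hp : Continuous p) (hc : HasCompactSupport p) (hp2 : tsupport p ⊆ Ω) (hq : ContinuousOn q Ω) :
    Integrable (fun x => p x * q x) :=
  (contMul hΩ hp hp2 hq).integrable_of_hasCompactSupport hc.mul_right

lemma C1c.contDd {N : ℕ} {Ω : Set (Euc N)} {p : Euc N → ℝ} (hp : C1c Ω p) (i : Fin N) :
    Continuous (Dd i p) := continuous_iff_continuousAt.2 fun _ => contAt_Dd hp.cd.contDiffAt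

lemma C1c.csDd {N : ℕ} {Ω : Set (Euc N)} {p : Euc N → ℝ} (hp : C1c Ω p) (i : Fin N) :
    HasCompactSupport (Dd i p) := hp.cs.of_isClosed_subset (isClosed_tsupport _) tsupport_Dd

lemma contOn_Dd {N : ℕ} {Ω : Set (Euc N)} (hΩ : IsOpen Ω) {f : Euc N → ℝ}
    (hf : ContDiffOn ℝ 1 f Ω) (i : Fin N) : ContinuousOn (Dd i f) Ω := fun x hx =>
  (contAt_Dd (hf.contDiffAt (hΩ.mem_nhds hx))).continuousWithinAt

lemma contOn_lap {N : ℕ} {Ω : Set (Euc N)} (hΩ : IsOpen Ω) {f : Euc N → ℝ}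
    (hf : ContDiffOn ℝ 2 f Ω) : ContinuousOn (lap f) Ω := fun x hx =>
  (contAt_lap (hf.contDiffAt (hΩ.mem_nhds hx))).continuousWithinAt

lemma ibp1 {N : ℕ} {Ω : Set (Euc N)} (hΩ : IsOpen Ω) {p f : Euc N → ℝ} (hp : C1c Ω p)
    (hf : ContDiffOn ℝ 1 f Ω) (i : Fin N) :
    ∫ x, p x * Dd i f x = - ∫ x, Dd i p x * f x := by
  apply integral_mul_fderiv_eq_neg_fderiv_mul_of_integrable
  · exact intMul hΩ (hp.contDd i) (hp.csDd i) (tsupport_Dd.trans hp.sub) hf.continuousOn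
  · exact intMul hΩ hp.cd.continuous hp.cs hp.sub (contOn_Dd hΩ hf i)
  · exact intMul hΩ hp.cd.continuous hp.cs hp.sub hf.continuousOn
  · intro x _; exact hp.cd.contDiffAt.differentiableAt (by norm_num)
  · intro x hx; exact (hf.contDiffAt (hΩ.mem_nhds (hp.sub hx))).differentiableAt (by norm_num)

lemma ibp {N : ℕ} {Ω : Set (Euc N)} (hΩ : IsOpen Ω) {p f : Euc N → ℝ} (hp : C1c Ω p)
    (hf : ContDiffOn ℝ 2 f Ω) :
    ∫ x, p x * lap f x = - ∫ x, ∑ i, Dd i p x * Dd i f x := by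
  have hD : ∀ i, ContDiffOn ℝ 1 (Dd i f) Ω := fun i x hx =>
    (contDiffAt_Dd (hf.contDiffAt (hΩ.mem_nhds hx))).contDiffWithinAt
  have h1 : ∀ x, p x * lap f x = ∑ i, p x * Dd i (Dd i f) x := by
    intro x
    by_cases hx : x ∈ tsupport p
    · rw [lap_eq (hf.contDiffAt (hΩ.mem_nhds (hp.sub hx))), Finset.mul_sum]
    · simp [image_eq_zero_of_notMem_tsupport hx]
  simp_rw [h1]
  rw [integral_finsetSum, integral_finsetSum, ← Finset.sum_neg_distrib]
  · exact Finset.sum_congr rfl fun i _ => ibp1 hΩ hp (hD i) i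
  · intro i _
    exact intMul hΩ (hp.contDd i) (hp.csDd i) (tsupport_Dd.trans hp.sub) (hD i).continuousOn
  · intro i _
    exact intMul hΩ hp.cd.continuous hp.cs hp.sub (contOn_Dd hΩ (hD i) i)

lemma C1c.mk_of {N : ℕ} {Ω C : Set (Euc N)} (hΩ : IsOpen Ω) (hC : IsCompact C) (hCΩ : C ⊆ Ω)
    {p : Euc N → ℝ} (hp : ContDiffOn ℝ 1 p Ω) (h0 : ∀ x ∉ C, p x = 0) : C1c Ω p := by
  have hs : tsupport p ⊆ C := by
    apply closure_minimal _ hC.isClosed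
    intro x hx; by_contra h; exact hx (h0 x h)
  refine ⟨?_, HasCompactSupport.intro hC h0, hs.trans hCΩ⟩
  rw [contDiff_iff_contDiffAt]
  intro x
  by_cases hx : x ∈ C
  · exact hp.contDiffAt (hΩ.mem_nhds (hCΩ hx))
  · refine (contDiffAt_const (c := (0:ℝ))).congr_of_eventuallyEq ?_
    filter_upwards [hC.isClosed.isOpen_compl.mem_nhds hx] with z hz using h0 z hz


structure IsKer {N : ℕ} (K k : Euc N → ℝ) : Prop where
  cK : ContDiff ℝ 2 K
  ck : ContDiff ℝ 2 k
  K0 : ∀ z, 0 ≤ K z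
  k0 : ∀ z, 0 ≤ k z
  Ks : ∀ z, z ∉ ball (0 : Euc N) 1 → K z = 0
  ks : ∀ z, z ∉ ball (0 : Euc N) 1 → k z = 0
  ke : ∀ z, k (-z) = k z
  Ke : ∀ z, K (-z) = K z
  ki : ∫ z, k z = 1
  Ki : 0 < ∫ z, K z
  dK : ∀ i z, Dd i K z = - (k z * z i)

lemma exists_ker {N : ℕ} : ∃ K k : Euc N → ℝ, IsKer K k := by
  let P : Euc N → ℝ := fun z => expNegInvGlue (1 - ‖z‖^2)
  let p : Euc N → ℝ := fun z => 2 * deriv expNegInvGlue (1 - ‖z‖^2)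
  have hglue : ContDiff ℝ 3 expNegInvGlue := expNegInvGlue.contDiff (n := 3)
  have hdglue : ContDiff ℝ 2 (deriv expNegInvGlue) := by
    have := (contDiff_succ_iff_deriv (n := 2) (f := expNegInvGlue)).1 (by
      have e : (2:WithTop ℕ∞) + 1 = 3 := by norm_num
      rw [e]; exact hglue)
    exact this.2.2
  have hn : ContDiff ℝ 2 (fun z : Euc N => 1 - ‖z‖^2) := contDiff_const.sub (contDiff_norm_sq ℝ)
  have hP : ContDiff ℝ 2 P := (hglue.of_le (by norm_num)).comp hn
  have hp : ContDiff ℝ 2 p := contDiff_const.mul (hdglue.comp hn)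
  have hd0 : ∀ t, 0 ≤ deriv expNegInvGlue t := fun t => expNegInvGlue.monotone.deriv_nonneg
  have hdz : ∀ t ≤ 0, deriv expNegInvGlue t = 0 := by
    intro t ht
    apply IsLocalMin.deriv_eq_zero
    exact Filter.Eventually.of_forall fun s => by
      rw [expNegInvGlue.zero_of_nonpos ht]; exact expNegInvGlue.nonneg s
  have hd1 : 0 < deriv expNegInvGlue 1 := by
    have h1 : HasDerivAt (fun x : ℝ => Real.exp (-x⁻¹)) (Real.exp (-(1:ℝ)⁻¹) * -(-((1:ℝ)^2)⁻¹)) 1 :=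
      ((hasDerivAt_inv (one_ne_zero (α := ℝ))).neg).exp
    have h2 : expNegInvGlue =ᶠ[𝓝 (1:ℝ)] fun x : ℝ => Real.exp (-x⁻¹) := by
      filter_upwards [lt_mem_nhds (show (0:ℝ) < 1 by norm_num)] with x hx
      simp [expNegInvGlue, hx.not_ge]
    rw [h2.deriv_eq, h1.deriv]
    have := Real.exp_pos (-(1:ℝ)⁻¹)
    norm_num
    simpa using this
  have hball : ∀ z : Euc N, z ∉ ball (0 : Euc N) 1 → 1 - ‖z‖^2 ≤ 0 := by
    intro z hz
    simp only [mem_ball, dist_zero_right, not_lt] at hz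
    nlinarith
  have hPs : ∀ z, z ∉ ball (0 : Euc N) 1 → P z = 0 := fun z hz =>
    expNegInvGlue.zero_of_nonpos (hball z hz)
  have hps : ∀ z, z ∉ ball (0 : Euc N) 1 → p z = 0 := fun z hz => by
    simp [p, hdz _ (hball z hz)]
  have hcs : ∀ q : Euc N → ℝ, (∀ z, z ∉ ball (0 : Euc N) 1 → q z = 0) → HasCompactSupport q := by
    intro q hq
    exact HasCompactSupport.intro (isCompact_closedBall (0 : Euc N) 1) fun z hz =>
      hq z fun h => hz (ball_subset_closedBall h)
  have hP0 : 0 < ∫ z, P z := hP.continuous.integral_pos_of_hasCompactSupport_nonneg_nonzero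
    (hcs P hPs) (fun z => expNegInvGlue.nonneg _) (x := 0) (by
      simp only [P, norm_zero]; exact (expNegInvGlue.pos_of_pos (by norm_num)).ne')
  have hp0 : 0 < ∫ z, p z := hp.continuous.integral_pos_of_hasCompactSupport_nonneg_nonzero
    (hcs p hps) (fun z => mul_nonneg (by norm_num) (hd0 _)) (x := 0) (by
      simp only [p, norm_zero]; norm_num; exact hd1.ne')
  have hdP : ∀ i z, Dd i P z = - (p z * z i) := by
    intro i z
    have h1 : HasDerivAt (fun t => expNegInvGlue (1 - t)) (-deriv expNegInvGlue (1 - ‖z‖^2)) (‖z‖^2) := by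
      have h := ((hglue.differentiable (by norm_num)) (1 - ‖z‖^2)).hasDerivAt
      have := HasDerivAt.comp (‖z‖^2) h ((hasDerivAt_id (‖z‖^2)).const_sub 1)
      rw [mul_neg_one] at this
      exact this
    have h2 := (hasStrictFDerivAt_norm_sq z).hasFDerivAt
    have h3 := Dd_comp (i := i) (f := fun z : Euc N => ‖z‖^2) h1 h2.differentiableAt
    change Dd i (fun y : Euc N => expNegInvGlue (1 - ‖y‖^2)) z = _
    rw [h3]
    unfold Dd
    rw [h2.fderiv]
    simp [p, EuclideanSpace.inner_single_right]
    ring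
  set c : ℝ := (∫ z, p z)⁻¹ with hc
  have hc0 : 0 < c := inv_pos.2 hp0
  refine ⟨fun z => c * P z, fun z => c * p z, ⟨contDiff_const.mul hP, contDiff_const.mul hp, ?_, ?_,
    ?_, ?_, ?_, ?_, ?_, ?_, ?_⟩⟩
  · intro z; exact mul_nonneg hc0.le (expNegInvGlue.nonneg _)
  · intro z; exact mul_nonneg hc0.le (mul_nonneg (by norm_num) (hd0 _))
  · intro z hz; simp [hPs z hz]
  · intro z hz; simp [hps z hz]
  · intro z; simp [p]
  · intro z; simp [P]
  · rw [integral_const_mul]; exact inv_mul_cancel₀ hp0.ne'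
  · rw [integral_const_mul]; positivity
  · intro i z
    rw [Dd_const_mul c (hP.contDiffAt.differentiableAt (by norm_num)), hdP]; ring

namespace IsKer
variable {N : ℕ} {K k : Euc N → ℝ}

lemma csK (h : IsKer K k) : HasCompactSupport K :=
  HasCompactSupport.intro (isCompact_closedBall (0 : Euc N) 1) fun z hz =>
      h.Ks z fun h => hz (ball_subset_closedBall h)
lemma csk (h : IsKer K k) : HasCompactSupport k :=
  HasCompactSupport.intro (isCompact_closedBall (0 : Euc N) 1) fun z hz =>
      h.ks z fun h => hz (ball_subset_closedBall h)
lemma contK (h : IsKer K k) : Continuous K := h.cK.continuous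
lemma contk (h : IsKer K k) : Continuous k := h.ck.continuous
lemma intK (h : IsKer K k) : Integrable K := h.contK.integrable_of_hasCompactSupport h.csK
lemma intk (h : IsKer K k) : Integrable k := h.contk.integrable_of_hasCompactSupport h.csk
lemma c1c (h : IsKer K k) : C1c univ K := ⟨h.cK.of_le (by norm_num), h.csK, subset_univ _⟩
lemma bddK (h : IsKer K k) : ∃ C, 0 ≤ C ∧ ∀ z, K z ≤ C := by
  obtain ⟨C, hC⟩ := h.csK.exists_bound_of_continuous h.contK
  exact ⟨C, (norm_nonneg _).trans (hC 0), fun z => (le_abs_self _).trans (hC z)⟩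
lemma bddk (h : IsKer K k) : ∃ C, 0 ≤ C ∧ ∀ z, k z ≤ C := by
  obtain ⟨C, hC⟩ := h.csk.exists_bound_of_continuous h.contk
  exact ⟨C, (norm_nonneg _).trans (hC 0), fun z => (le_abs_self _).trans (hC z)⟩

end IsKer

/-- product of a compactly supported kernel and a bounded measurable function -/
lemma int_bdd_mul {N : ℕ} {q f : Euc N → ℝ} (hq : Integrable q) (hf : AEStronglyMeasurable f volume)
    {C : ℝ} (hC : ∀ x, |f x| ≤ C) : Integrable (fun z => q z * f z) :=
  hq.mul_bdd hf (Eventually.of_forall hC)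

lemma Dd_shift {N : ℕ} {f : Euc N → ℝ} {x z : Euc N} {s : ℝ} {i : Fin N}
    (hf : DifferentiableAt ℝ f (x + s • z)) :
    Dd i (fun z => f (x + s • z)) z = s * Dd i f (x + s • z) := by
  unfold Dd
  have h1 : HasFDerivAt (fun z : Euc N => x + s • z) (s • ContinuousLinearMap.id ℝ (Euc N)) z :=
    ((hasFDerivAt_id z).const_smul s).const_add x
  have := (hf.hasFDerivAt.comp z h1).fderiv
  change fderiv ℝ (f ∘ fun z => x + s • z) z (ee i) = _
  rw [this]; simp

lemma clm_sum {N : ℕ} (L : Euc N →L[ℝ] ℝ) (z : Euc N) : L z = ∑ i, L (ee i) * z i := by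
  conv_lhs => rw [← (EuclideanSpace.basisFun (Fin N) ℝ).sum_repr z]
  simp [map_sum, mul_comm]

lemma mean_id {N : ℕ} {K k : Euc N → ℝ} (h : IsKer K k) {f : Euc N → ℝ} (hf : ContDiff ℝ 2 f)
    (x : Euc N) {r : ℝ} :
    f x = (∫ z, k z * f (x + r • z)) + ∫ s in (0:ℝ)..r, s * ∫ z, K z * (- lap f (x + s • z)) := by
  have hfc := hf.continuous
  have hlapc : Continuous (lap f) := continuous_iff_continuousAt.2 fun y => contAt_lap hf.contDiffAt
  have hfd : Continuous (fderiv ℝ f) := hf.continuous_fderiv (by norm_num)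
  have hD : ∀ i, ContDiff ℝ 1 (Dd i f) := fun i =>
    contDiff_iff_contDiffAt.2 fun y => contDiffAt_Dd hf.contDiffAt
  have key : ∀ s : ℝ, HasDerivAt (fun s : ℝ => ∫ z, k z * f (x + s • z))
      (s * ∫ z, K z * lap f (x + s • z)) s := by
    intro s
    obtain ⟨C, hC⟩ := ((isCompact_closedBall s 1).prod (isCompact_closedBall (0 : Euc N) 1)).exists_bound_of_continuousOn
      (f := fun q : ℝ × Euc N => fderiv ℝ f (x + q.1 • q.2) q.2)
      (Continuous.continuousOn (by fun_prop))
    have hd := hasDerivAt_integral_of_dominated_loc_of_deriv_le (μ := (volume : Measure (Euc N))) (x₀ := s)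
      (F := fun s z => k z * f (x + s • z)) (F' := fun s z => k z * fderiv ℝ f (x + s • z) z)
      (bound := fun z => k z * C) (s := ball s 1) (ball_mem_nhds s one_pos) ?_ ?_ ?_ ?_ ?_ ?_
    · suffices hv : s * (∫ z, K z * lap f (x + s • z)) = ∫ z, k z * fderiv ℝ f (x + s • z) z by
        rw [hv]; exact hd.2
      have e1 : ∀ z, k z * fderiv ℝ f (x + s • z) z = - ∑ i, Dd i K z * Dd i f (x + s • z) := by
        intro z
        rw [clm_sum, Finset.mul_sum, ← Finset.sum_neg_distrib]
        refine Finset.sum_congr rfl fun i _ => ?_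
        rw [h.dK]; unfold Dd; ring
      have e1' : (fun z => k z * fderiv ℝ f (x + s • z) z) = fun z => - ∑ i, Dd i K z * Dd i f (x + s • z) := funext e1
      rw [e1']
      have e2 : ∀ z, K z * lap f (x + s • z) = ∑ i, K z * Dd i (Dd i f) (x + s • z) := by
        intro z; rw [lap_eq hf.contDiffAt, Finset.mul_sum]
      simp_rw [e2]
      rw [integral_neg, integral_finsetSum, integral_finsetSum, Finset.mul_sum, ← Finset.sum_neg_distrib]
      · refine Finset.sum_congr rfl fun i _ => ?_
        have := ibp1 isOpen_univ h.c1c (f := fun z => Dd i f (x + s • z)) 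
          ((hD i).comp (show ContDiff ℝ 1 (fun z : Euc N => x + s • z) by fun_prop)).contDiffOn i
        rw [← this, ← integral_const_mul]
        congr 1; ext z
        rw [Dd_shift ((hD i).contDiffAt.differentiableAt (by norm_num))]; ring
      · intro i _
        refine Continuous.integrable_of_hasCompactSupport ?_ (HasCompactSupport.mul_right (h.c1c.csDd i))
        exact (h.c1c.contDd i).mul ((hD i).continuous.comp (by fun_prop))
      · intro i _
        refine Continuous.integrable_of_hasCompactSupport ?_ (HasCompactSupport.mul_right h.csK)
        have hc : Continuous (Dd i (Dd i f)) :=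
          continuous_iff_continuousAt.2 fun y => contAt_Dd (hD i).contDiffAt
        exact h.contK.mul (hc.comp (by fun_prop))
    · refine Eventually.of_forall fun t => ?_
      exact (h.contk.mul (hfc.comp (by fun_prop))).aestronglyMeasurable
    · exact (h.contk.mul (hfc.comp (by fun_prop))).integrable_of_hasCompactSupport h.csk.mul_right
    · have : Continuous fun z => k z * fderiv ℝ f (x + s • z) z := h.contk.mul (by fun_prop)
      exact this.aestronglyMeasurable
    · refine Eventually.of_forall fun z t ht => ?_
      by_cases hz : z ∈ ball (0 : Euc N) 1
      · rw [norm_mul, Real.norm_of_nonneg (h.k0 z)]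
        exact mul_le_mul_of_nonneg_left (hC (t, z) ⟨ball_subset_closedBall ht, ball_subset_closedBall hz⟩) (h.k0 z)
      · simp [h.ks z hz]
    · exact h.intk.mul_const C
    · refine Eventually.of_forall fun z t _ => ?_
      refine HasDerivAt.const_mul (k z) ?_
      have h1 : HasDerivAt (fun t : ℝ => x + t • z) z t := by
        have := ((hasDerivAt_id t).smul_const z).const_add x
        simpa using this
      exact ((hf.contDiffAt.differentiableAt (by norm_num)).hasFDerivAt).comp_hasDerivAt t h1
  have hcont : Continuous fun s : ℝ => s * ∫ z, K z * lap f (x + s • z) := by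
    refine continuous_id.mul ?_
    have h1 := continuous_parametric_integral_of_continuous (μ := (volume : Measure (Euc N)))
      (f := fun (s : ℝ) (z : Euc N) => K z * lap f (x + s • z)) (s := closedBall (0 : Euc N) 1)
      (by
        have := h.contK
        simp only [Function.uncurry_def]
        fun_prop) (isCompact_closedBall 0 1)
    convert h1 using 2 with s
    symm
    apply setIntegral_eq_integral_of_forall_compl_eq_zero
    intro z hz
    rw [h.Ks z fun h => hz (ball_subset_closedBall h), zero_mul]
  have hF := intervalIntegral.integral_eq_sub_of_hasDerivAt (a := 0) (b := r) (fun s _ => key s)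
    (hcont.intervalIntegrable _ _)
  have e0 : ∫ z, k z * f (x + (0:ℝ) • z) = f x := by
    simp only [zero_smul, add_zero]
    rw [integral_mul_const, h.ki, one_mul]
  have e1 : ∀ s, s * ∫ z, K z * (- lap f (x + s • z)) = -(s * ∫ z, K z * lap f (x + s • z)) := by
    intro s
    simp only [mul_neg, integral_neg]
  simp_rw [e1]
  rw [intervalIntegral.integral_neg, hF, e0]
  ring


def BM {N : ℕ} (h : Euc N → ℝ) : Prop := Measurable h ∧ ∃ C, ∀ x, |h x| ≤ C

def Mop {N : ℕ} (k : Euc N → ℝ) (r : ℝ) (w : Euc N → ℝ) (x : Euc N) : ℝ := ∫ z, k z * w (x + r • z)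
def Rop {N : ℕ} (K : Euc N → ℝ) (r : ℝ) (h : Euc N → ℝ) (x : Euc N) : ℝ :=
  ∫ s in (0:ℝ)..r, s * Mop K s h x

lemma BM.nn {N : ℕ} {h : Euc N → ℝ} (hh : BM h) : ∃ C, 0 ≤ C ∧ ∀ x, |h x| ≤ C := by
  obtain ⟨C, hC⟩ := hh.2
  exact ⟨C, (abs_nonneg _).trans (hC 0), hC⟩

lemma mem_ball_aff {N : ℕ} {x z : Euc N} {s r : ℝ} (hs : 0 < s) (hsr : s ≤ r) (hz : z ∈ ball (0 : Euc N) 1) :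
    x + s • z ∈ ball x r := by
  simp only [mem_ball, dist_zero_right, dist_self_add_left, norm_smul, Real.norm_eq_abs] at *
  rw [abs_of_pos hs]
  nlinarith

lemma Mop_congr {N : ℕ} {κ f g : Euc N → ℝ} (hκ : ∀ z, z ∉ ball (0 : Euc N) 1 → κ z = 0) {x : Euc N} {r : ℝ}
    (hr : 0 < r) (h : ∀ y ∈ ball x r, f y = g y) : Mop κ r f x = Mop κ r g x := by
  unfold Mop
  congr 1; ext z
  by_cases hz : z ∈ ball (0 : Euc N) 1
  · rw [h _ (mem_ball_aff hr le_rfl hz)]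
  · simp [hκ z hz]

lemma Rop_congr {N : ℕ} {κ f g : Euc N → ℝ} (hκ : ∀ z, z ∉ ball (0 : Euc N) 1 → κ z = 0) {x : Euc N} {r : ℝ}
    (hr : 0 < r) (h : ∀ y ∈ ball x r, f y = g y) : Rop κ r f x = Rop κ r g x := by
  unfold Rop
  apply intervalIntegral.integral_congr_ae
  refine Eventually.of_forall fun s hs => ?_
  rw [uIoc_of_le hr.le] at hs
  rw [Mop_congr hκ hs.1 fun y hy => h y (ball_subset_ball hs.2 hy)]

section reg
variable {N : ℕ} {κ h : Euc N → ℝ}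

lemma Mop_int (hκc : Continuous κ) (hκs : HasCompactSupport κ) (hh : BM h) (x : Euc N) (s : ℝ) :
    Integrable (fun z => κ z * h (x + s • z)) := by
  obtain ⟨C, hC⟩ := hh.2
  exact int_bdd_mul (f := fun z => h (x + s • z)) (hκc.integrable_of_hasCompactSupport hκs)
    (hh.1.comp (by fun_prop)).aestronglyMeasurable (fun z => hC _)

lemma Mop_bd (hκc : Continuous κ) (hκs : HasCompactSupport κ) {C : ℝ} (hC : ∀ x, |h x| ≤ C)
    (x : Euc N) (s : ℝ) : |Mop κ s h x| ≤ (∫ z, |κ z|) * C := by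
  rw [← integral_mul_const, ← Real.norm_eq_abs]
  unfold Mop
  have hi : Integrable κ := hκc.integrable_of_hasCompactSupport hκs
  refine norm_integral_le_of_norm_le (hi.abs.mul_const C) ?_
  refine Eventually.of_forall fun z => ?_
  rw [norm_mul]
  exact mul_le_mul_of_nonneg_left (hC _) (abs_nonneg _)

lemma Mop_meas (hκc : Continuous κ) (hh : BM h) (x : Euc N) :
    StronglyMeasurable (fun s => Mop κ s h x) := by
  refine StronglyMeasurable.integral_prod_right (f := fun (s : ℝ) (z : Euc N) => κ z * h (x + s • z)) ?_
  refine Measurable.stronglyMeasurable ?_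
  have h1 := hκc.measurable
  have h2 := hh.1
  simp only [Function.uncurry_def]
  exact (h1.comp measurable_snd).mul (h2.comp (by fun_prop))

lemma Rop_ii (hκc : Continuous κ) (hκs : HasCompactSupport κ) (hh : BM h) (x : Euc N) (a b : ℝ) :
    IntervalIntegrable (fun s => s * Mop κ s h x) volume a b := by
  obtain ⟨C, hC⟩ := hh.2
  rw [intervalIntegrable_iff]
  have h1 : IntegrableOn (fun s : ℝ => s) (uIoc a b) := 
    intervalIntegrable_iff.1 (continuous_id.intervalIntegrable a b)
  refine Integrable.mul_bdd (c := (∫ z, |κ z|) * C) h1 (Mop_meas hκc hh x).aestronglyMeasurable ?_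
  exact Eventually.of_forall fun s => Mop_bd hκc hκs hC x s

lemma Mop_hasFDeriv (hκc : ContDiff ℝ 1 κ) (hκs : HasCompactSupport κ) (hh : BM h) {s : ℝ} (hs : 0 < s) (x : Euc N) :
    HasFDerivAt (Mop κ s h) (-(s⁻¹ • ∫ z, h (x + s • z) • fderiv ℝ κ z)) x := by
  obtain ⟨C, hC0, hC⟩ := hh.nn
  obtain ⟨D, hD⟩ := (hκs.fderiv (𝕜 := ℝ)).exists_bound_of_continuous (hκc.continuous_fderiv (by norm_num))
  have hD0 : 0 ≤ D := (norm_nonneg _).trans (hD 0)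
  obtain ⟨R, hR⟩ := hκs.isCompact.isBounded.subset_closedBall (0 : Euc N)
  have hfz : ∀ z, z ∉ closedBall (0 : Euc N) R → fderiv ℝ κ z = 0 := fun z hz => 
    image_eq_zero_of_notMem_tsupport fun h' => hz (hR (tsupport_fderiv_subset ℝ h'))
  have htr : Mop κ s h = fun x' => ∫ z, κ (z - s⁻¹ • (x' - x)) * h (x + s • z) := by
    ext x'
    unfold Mop
    rw [← integral_sub_right_eq_self _ (s⁻¹ • (x' - x))]
    congr 1; ext z
    congr 2
    rw [smul_sub, smul_smul, mul_inv_cancel₀ hs.ne']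
    module
  rw [htr]
  have hd := hasFDerivAt_integral_of_dominated_of_fderiv_le (𝕜 := ℝ) (μ := (volume : Measure (Euc N))) (x₀ := x)
    (F := fun x' z => κ (z - s⁻¹ • (x' - x)) * h (x + s • z))
    (F' := fun x' z => h (x + s • z) • (-(s⁻¹ • fderiv ℝ κ (z - s⁻¹ • (x' - x)))))
    (bound := (closedBall (0 : Euc N) (R+1)).indicator fun z => C * (s⁻¹ * D)) (s := ball x s) (ball_mem_nhds x hs) ?_ ?_ ?_ ?_ ?_ ?_
  · have e : (-(s⁻¹ • ∫ z, h (x + s • z) • fderiv ℝ κ z)) =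
        ∫ z, h (x + s • z) • (-(s⁻¹ • fderiv ℝ κ (z - s⁻¹ • (x - x)))) := by
      rw [← integral_smul, ← integral_neg]
      congr 1; ext1 z
      simp only [sub_self, smul_zero, sub_zero, smul_neg]
      rw [smul_comm]
    rw [e]; exact hd
  · refine Eventually.of_forall fun x' => ?_
    have h1 := hκc.continuous.measurable
    have h2 := hh.1
    exact ((h1.comp (by fun_prop)).mul (h2.comp (by fun_prop))).aestronglyMeasurable
  · simpa using Mop_int hκc.continuous hκs hh x s
  · have h1 : Continuous fun z => -(s⁻¹ • fderiv ℝ κ (z - s⁻¹ • (x - x))) := by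
      have := hκc.continuous_fderiv (by norm_num)
      fun_prop
    have h2 := hh.1
    exact AEStronglyMeasurable.smul ((h2.comp (by fun_prop)).aestronglyMeasurable) h1.aestronglyMeasurable
  · refine Eventually.of_forall fun z x' hx' => ?_
    have hn : ‖s⁻¹ • (x' - x)‖ ≤ 1 := by
      rw [norm_smul, Real.norm_eq_abs, abs_of_pos (inv_pos.2 hs), inv_mul_le_iff₀ hs, mul_one]
      rw [mem_ball, dist_eq_norm] at hx'; exact hx'.le
    by_cases hz : z ∈ closedBall (0 : Euc N) (R+1)
    · rw [indicator_of_mem hz, norm_smul, norm_neg, norm_smul, Real.norm_eq_abs, Real.norm_eq_abs, abs_of_pos (inv_pos.2 hs)]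
      have := hD (z - s⁻¹ • (x' - x))
      have := hC (x + s • z)
      have := inv_pos.2 hs
      gcongr
    · rw [indicator_of_notMem hz, hfz, smul_zero, neg_zero, smul_zero, norm_zero]
      intro h'
      apply hz
      simp only [mem_closedBall, dist_zero_right] at *
      calc ‖z‖ = ‖(z - s⁻¹ • (x' - x)) + s⁻¹ • (x' - x)‖ := by congr 1; abel
        _ ≤ _ := norm_add_le _ _
        _ ≤ _ := by linarith
  · rw [integrable_indicator_iff measurableSet_closedBall]
    exact integrableOn_const (measure_closedBall_lt_top).ne
  · refine Eventually.of_forall fun z x' _ => ?_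
    have h1 : HasFDerivAt (fun x' : Euc N => z - s⁻¹ • (x' - x)) (-(s⁻¹ • ContinuousLinearMap.id ℝ (Euc N))) x' :=
      ((((hasFDerivAt_id x').sub_const x).const_smul s⁻¹).const_sub z)
    have h2 := ((hκc.contDiffAt (x := z - s⁻¹ • (x' - x))).differentiableAt (by norm_num)).hasFDerivAt
    have h3 := (h2.comp x' h1).mul_const (h (x + s • z))
    have e : h (x + s • z) • (-(s⁻¹ • fderiv ℝ κ (z - s⁻¹ • (x' - x)))) = h (x + s • z) • (fderiv ℝ κ (z - s⁻¹ • (x' - x)) ∘SL (-(s⁻¹ • ContinuousLinearMap.id ℝ (Euc N)))) := by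
      ext v
      simp
    rw [e]; exact h3

lemma Mop_fderiv_apply (hκc : ContDiff ℝ 1 κ) (hκs : HasCompactSupport κ) (hh : BM h) {s : ℝ} (hs : 0 < s) (x v : Euc N) :
    fderiv ℝ (Mop κ s h) x v = -(s⁻¹ * Mop (fun z => fderiv ℝ κ z v) s h x) := by
  obtain ⟨C, hC0, hC⟩ := hh.nn
  rw [(Mop_hasFDeriv hκc hκs hh hs x).fderiv]
  simp only [_root_.neg_apply, _root_.smul_apply, smul_eq_mul]
  rw [ContinuousLinearMap.integral_apply]
  · unfold Mop
    congr 3; ext z; simp [mul_comm]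
  · refine Integrable.bdd_smul (φ := fun z => h (x + s • z)) (C := C) ?_ (hh.1.comp (by fun_prop)).aestronglyMeasurable (Eventually.of_forall fun z => hC _)
    exact (hκc.continuous_fderiv (by norm_num)).integrable_of_hasCompactSupport (hκs.fderiv (𝕜 := ℝ))

lemma cs_fderiv_apply (hκs : HasCompactSupport κ) (v : Euc N) : HasCompactSupport (fun z => fderiv ℝ κ z v) :=
  hκs.fderiv_apply (𝕜 := ℝ) v

lemma Mop_cont (hκc : Continuous κ) (hκs : HasCompactSupport κ) (hh : BM h) {s : ℝ} (hs : 0 < s) :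
    Continuous (Mop κ s h) := by
  obtain ⟨C, hC0, hC⟩ := hh.nn
  obtain ⟨D, hD⟩ := hκs.exists_bound_of_continuous hκc
  have hD0 : 0 ≤ D := (norm_nonneg _).trans (hD 0)
  obtain ⟨R, hR⟩ := hκs.isCompact.isBounded.subset_closedBall (0 : Euc N)
  have hfz : ∀ z, z ∉ closedBall (0 : Euc N) R → κ z = 0 := fun z hz => 
    image_eq_zero_of_notMem_tsupport fun h' => hz (hR h')
  rw [continuous_iff_continuousAt]
  intro x
  have htr : Mop κ s h = fun x' => ∫ z, κ (z - s⁻¹ • (x' - x)) * h (x + s • z) := by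
    ext x'
    unfold Mop
    rw [← integral_sub_right_eq_self _ (s⁻¹ • (x' - x))]
    congr 1; ext z
    congr 2
    rw [smul_sub, smul_smul, mul_inv_cancel₀ hs.ne']
    module
  rw [htr]
  refine continuousAt_of_dominated (bound := (closedBall (0 : Euc N) (R+1)).indicator fun z => D * C) ?_ ?_ ?_ ?_
  · refine Eventually.of_forall fun x' => ?_
    have h1 := hκc.measurable
    have h2 := hh.1
    exact ((h1.comp (by fun_prop)).mul (h2.comp (by fun_prop))).aestronglyMeasurable
  · filter_upwards [ball_mem_nhds x hs] with x' hx'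
    refine Eventually.of_forall fun z => ?_
    have hn : ‖s⁻¹ • (x' - x)‖ ≤ 1 := by
      rw [norm_smul, Real.norm_eq_abs, abs_of_pos (inv_pos.2 hs), inv_mul_le_iff₀ hs, mul_one]
      rw [mem_ball, dist_eq_norm] at hx'; exact hx'.le
    by_cases hz : z ∈ closedBall (0 : Euc N) (R+1)
    · rw [indicator_of_mem hz, norm_mul]
      exact mul_le_mul (hD _) (hC _) (abs_nonneg _) hD0
    · rw [indicator_of_notMem hz, hfz, zero_mul, norm_zero]
      intro h'
      apply hz
      simp only [mem_closedBall, dist_zero_right] at *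
      calc ‖z‖ = ‖(z - s⁻¹ • (x' - x)) + s⁻¹ • (x' - x)‖ := by congr 1; abel
        _ ≤ _ := norm_add_le _ _
        _ ≤ _ := by linarith
  · rw [integrable_indicator_iff measurableSet_closedBall]
    exact integrableOn_const (measure_closedBall_lt_top).ne
  · refine Eventually.of_forall fun z => ?_
    exact (Continuous.mul (hκc.comp (by fun_prop)) continuous_const).continuousAt

lemma c1_of {f : Euc N → ℝ} (hd : Differentiable ℝ f) (hc : ∀ v, Continuous fun x => fderiv ℝ f x v) :
    ContDiff ℝ 1 f := by
  have := (contDiff_succ_iff_fderiv_apply (𝕜 := ℝ) (n := 0) (f := f) (D := Euc N)).2 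
    ⟨hd, by simp, fun v => contDiff_zero.2 (hc v)⟩
  simpa using this

lemma c2_of {f : Euc N → ℝ} (hd : Differentiable ℝ f) (hc : ∀ v, ContDiff ℝ 1 fun x => fderiv ℝ f x v) :
    ContDiff ℝ 2 f := by
  have := (contDiff_succ_iff_fderiv_apply (𝕜 := ℝ) (n := 1) (f := f) (D := Euc N)).2 
    ⟨hd, by simp, hc⟩
  have e : (2:WithTop ℕ∞) = 1 + 1 := by norm_num
  rw [e]; exact this

lemma Mop_C1 (hκc : ContDiff ℝ 1 κ) (hκs : HasCompactSupport κ) (hh : BM h) {s : ℝ} (hs : 0 < s) :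
    ContDiff ℝ 1 (Mop κ s h) := by
  refine c1_of (fun x => (Mop_hasFDeriv hκc hκs hh hs x).differentiableAt) fun v => ?_
  simp_rw [Mop_fderiv_apply hκc hκs hh hs]
  exact (continuous_const.mul (Mop_cont ((hκc.continuous_fderiv (by norm_num)).clm_apply continuous_const) (cs_fderiv_apply hκs v) hh hs)).neg

lemma Mop_C2 (hκc : ContDiff ℝ 2 κ) (hκs : HasCompactSupport κ) (hh : BM h) {s : ℝ} (hs : 0 < s) :
    ContDiff ℝ 2 (Mop κ s h) := by
  have h1 : ContDiff ℝ 1 κ := hκc.of_le (by norm_num)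
  refine c2_of (fun x => (Mop_hasFDeriv h1 hκs hh hs x).differentiableAt) fun v => ?_
  simp_rw [Mop_fderiv_apply h1 hκs hh hs]
  exact (contDiff_const.mul (Mop_C1 ((hκc.fderiv_right (m := 1) (by norm_num)).clm_apply contDiff_const) (cs_fderiv_apply hκs v) hh hs)).neg

lemma Rop_hasFDeriv (hκc : ContDiff ℝ 1 κ) (hκs : HasCompactSupport κ) (hh : BM h) {r : ℝ} (hr : 0 < r) (x : Euc N) :
    HasFDerivAt (Rop κ r h) (∫ s in (0:ℝ)..r, -(∫ z, h (x + s • z) • fderiv ℝ κ z)) x := by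
  obtain ⟨C, hC0, hC⟩ := hh.nn
  have hfc := hκc.continuous_fderiv (by norm_num)
  have hfi : Integrable (fderiv ℝ κ) := hfc.integrable_of_hasCompactSupport (hκs.fderiv (𝕜 := ℝ))
  refine intervalIntegral.hasFDerivAt_integral_of_dominated_of_fderiv_le (𝕜 := ℝ) (μ := volume)
    (F := fun x s => s * Mop κ s h x) (F' := fun x s => -(∫ z, h (x + s • z) • fderiv ℝ κ z))
    (bound := fun _ => C * ∫ z, ‖fderiv ℝ κ z‖) (s := univ) univ_mem ?_ ?_ ?_ ?_ ?_ ?_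
  · refine Eventually.of_forall fun x' => ?_
    exact (stronglyMeasurable_id.mul (Mop_meas hκc.continuous hh x')).aestronglyMeasurable
  · exact Rop_ii hκc.continuous hκs hh x 0 r
  · refine StronglyMeasurable.aestronglyMeasurable (StronglyMeasurable.neg ?_)
    refine StronglyMeasurable.integral_prod_right (f := fun (s : ℝ) (z : Euc N) => h (x + s • z) • fderiv ℝ κ z) ?_
    have h2 := hh.1
    simp only [Function.uncurry_def]
    exact StronglyMeasurable.smul (h2.comp (by fun_prop)).stronglyMeasurable
      (hfc.comp continuous_snd).stronglyMeasurable
  · refine Eventually.of_forall fun s hs x' _ => ?_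
    rw [norm_neg, ← integral_const_mul]
    refine norm_integral_le_of_norm_le (hfi.norm.const_mul C) ?_
    refine Eventually.of_forall fun z => ?_
    rw [norm_smul]
    exact mul_le_mul_of_nonneg_right (hC _) (norm_nonneg _)
  · exact intervalIntegrable_const
  · refine Eventually.of_forall fun s hs x' _ => ?_
    rw [uIoc_of_le hr.le] at hs
    have h1 := (Mop_hasFDeriv hκc hκs hh hs.1 x').const_mul s
    have e : s • (-(s⁻¹ • ∫ z, h (x' + s • z) • fderiv ℝ κ z)) = -(∫ z, h (x' + s • z) • fderiv ℝ κ z) := by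
      rw [smul_neg, smul_smul, mul_inv_cancel₀ hs.1.ne', one_smul]
    rw [← e]; exact h1

lemma Rop_fderiv_apply (hκc : ContDiff ℝ 1 κ) (hκs : HasCompactSupport κ) (hh : BM h) {r : ℝ} (hr : 0 < r) (x v : Euc N) :
    fderiv ℝ (Rop κ r h) x v = ∫ s in (0:ℝ)..r, -(Mop (fun z => fderiv ℝ κ z v) s h x) := by
  obtain ⟨C, hC0, hC⟩ := hh.nn
  have hfc := hκc.continuous_fderiv (by norm_num)
  have hfi : Integrable (fderiv ℝ κ) := hfc.integrable_of_hasCompactSupport (hκs.fderiv (𝕜 := ℝ))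
  rw [(Rop_hasFDeriv hκc hκs hh hr x).fderiv]
  rw [ContinuousLinearMap.intervalIntegral_apply]
  · congr 1; ext s
    rw [_root_.neg_apply, ContinuousLinearMap.integral_apply]
    · unfold Mop
      congr 2; ext z; simp [mul_comm]
    · refine Integrable.bdd_smul (φ := fun z => h (x + s • z)) (C := C) hfi (hh.1.comp (by fun_prop)).aestronglyMeasurable (Eventually.of_forall fun z => hC _)
  · rw [intervalIntegrable_iff]
    refine Integrable.mono' (g := fun _ => C * ∫ z, ‖fderiv ℝ κ z‖) (integrableOn_const (by simp)) ?_ ?_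
    · refine StronglyMeasurable.aestronglyMeasurable (StronglyMeasurable.neg ?_)
      refine StronglyMeasurable.integral_prod_right (f := fun (s : ℝ) (z : Euc N) => h (x + s • z) • fderiv ℝ κ z) ?_
      have h2 := hh.1
      simp only [Function.uncurry_def]
      exact StronglyMeasurable.smul (h2.comp (by fun_prop)).stronglyMeasurable
        (hfc.comp continuous_snd).stronglyMeasurable
    · refine Eventually.of_forall fun s => ?_
      rw [norm_neg, ← integral_const_mul]
      refine norm_integral_le_of_norm_le (hfi.norm.const_mul C) ?_
      refine Eventually.of_forall fun z => ?_
      rw [norm_smul]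
      exact mul_le_mul_of_nonneg_right (hC _) (norm_nonneg _)

lemma Rop_C1 (hκc : ContDiff ℝ 1 κ) (hκs : HasCompactSupport κ) (hh : BM h) {r : ℝ} (hr : 0 < r) :
    ContDiff ℝ 1 (Rop κ r h) := by
  obtain ⟨C, hC0, hC⟩ := hh.nn
  refine c1_of (fun x => (Rop_hasFDeriv hκc hκs hh hr x).differentiableAt) fun v => ?_
  simp_rw [Rop_fderiv_apply hκc hκs hh hr]
  have hvc : Continuous fun z => fderiv ℝ κ z v := (hκc.continuous_fderiv (by norm_num)).clm_apply continuous_const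
  refine intervalIntegral.continuous_of_dominated_interval (bound := fun _ => (∫ z, |fderiv ℝ κ z v|) * C) ?_ ?_ ?_ ?_
  · intro x
    exact (Mop_meas hvc hh x).neg.aestronglyMeasurable
  · intro x
    refine Eventually.of_forall fun s _ => ?_
    rw [norm_neg]
    exact Mop_bd hvc (cs_fderiv_apply hκs v) hC x s
  · exact intervalIntegrable_const
  · refine Eventually.of_forall fun s hs => ?_
    rw [uIoc_of_le hr.le] at hs
    exact (Mop_cont hvc (cs_fderiv_apply hκs v) hh hs.1).neg

lemma BM.of_cc {f : Euc N → ℝ} (hf : Continuous f) (hs : HasCompactSupport f) : BM f :=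
  ⟨hf.measurable, hs.exists_bound_of_continuous hf⟩

lemma Rop_fd (hκc : ContDiff ℝ 1 κ) (hκs : HasCompactSupport κ) (hh : ContDiff ℝ 1 h) (hhs : HasCompactSupport h) {r : ℝ} (hr : 0 < r) (v : Euc N) :
    (fun x => fderiv ℝ (Rop κ r h) x v) = Rop κ r (fun z => fderiv ℝ h z v) := by
  have hb := BM.of_cc hh.continuous hhs
  have hvc : Continuous fun z => fderiv ℝ h z v := (hh.continuous_fderiv (by norm_num)).clm_apply continuous_const
  have hkc : Continuous fun z => fderiv ℝ κ z v := (hκc.continuous_fderiv (by norm_num)).clm_apply continuous_const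
  ext x
  rw [Rop_fderiv_apply hκc hκs hb hr]
  unfold Rop
  congr 1; ext s
  have hd : ∀ z, fderiv ℝ (fun z => h (x + s • z)) z v = s * fderiv ℝ h (x + s • z) v := by
    intro z
    have h1 : HasFDerivAt (fun z : Euc N => x + s • z) (s • ContinuousLinearMap.id ℝ (Euc N)) z :=
      ((hasFDerivAt_id z).const_smul s).const_add x
    have := ((hh.contDiffAt.differentiableAt (by norm_num)).hasFDerivAt.comp z h1).fderiv
    change fderiv ℝ (h ∘ fun z => x + s • z) z v = _
    rw [this]; simp
  unfold Mop
  have hdi : Differentiable ℝ (fun z => h (x + s • z)) :=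
    (hh.differentiable (by norm_num)).comp (by fun_prop)
  have := integral_mul_fderiv_eq_neg_fderiv_mul_of_integrable (μ := (volume : Measure (Euc N)))
    (f := κ) (g := fun z => h (x + s • z)) (v := v) ?_ ?_ ?_ ?_ ?_
  · rw [← this, ← integral_const_mul]
    congr 1; ext z; rw [hd]; ring
  · exact Mop_int hkc (cs_fderiv_apply hκs v) hb x s
  · simp_rw [hd]
    have := (Mop_int hκc.continuous hκs (BM.of_cc hvc (cs_fderiv_apply hhs v)) x s).const_mul s
    refine this.congr (Eventually.of_forall fun z => ?_)
    ring_nf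
  · exact Mop_int hκc.continuous hκs hb x s
  · intro z _; exact hκc.contDiffAt.differentiableAt (by norm_num)
  · intro z _; exact hdi z

lemma Rop_C2 (hκc : ContDiff ℝ 1 κ) (hκs : HasCompactSupport κ) (hh : ContDiff ℝ 1 h) (hhs : HasCompactSupport h) {r : ℝ} (hr : 0 < r) :
    ContDiff ℝ 2 (Rop κ r h) := by
  have hb := BM.of_cc hh.continuous hhs
  refine c2_of (fun x => (Rop_hasFDeriv hκc hκs hb hr x).differentiableAt) fun v => ?_
  have hvc : Continuous fun z => fderiv ℝ h z v := (hh.continuous_fderiv (by norm_num)).clm_apply continuous_const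
  rw [Rop_fd hκc hκs hh hhs hr v]
  exact Rop_C1 hκc hκs (BM.of_cc hvc (cs_fderiv_apply hhs v)) hr

end reg


section
variable {N : ℕ} {K k : Euc N → ℝ}

lemma mean_loc (h : IsKer K k) {V : Set (Euc N)} (hV : IsOpen V) {f : Euc N → ℝ} (hf : ContDiffOn ℝ 2 f V)
    {x : Euc N} {r : ℝ} (hr : 0 < r) (hx : closedBall x r ⊆ V) :
    f x = Mop k r f x + Rop K r (fun y => - lap f y) x := by
  obtain ⟨g, hg, -, hgf⟩ := ext_ball (n := 2) hV hf hr hx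
  have h1 := mean_id h hg x (r := r)
  have e1 : Mop k r f x = Mop k r g x := Mop_congr h.ks hr fun y hy => 
    ((hgf y (ball_subset_closedBall hy)).eq_of_nhds).symm
  have e2 : Rop K r (fun y => - lap f y) x = Rop K r (fun y => - lap g y) x := Rop_congr h.Ks hr fun y hy => by
    have hy' := ball_subset_closedBall hy
    rw [lap_congr (hf.contDiffAt (hV.mem_nhds (hx hy'))) (hgf y hy')]
  rw [e1, e2, ← (hgf x (mem_closedBall_self hr.le)).eq_of_nhds]
  exact h1

lemma BM_ind {B : Set (Euc N)} (hB : MeasurableSet B) {f : Euc N → ℝ} (hf : ContinuousOn f B) {C : ℝ} (hC0 : 0 ≤ C)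
    (hC : ∀ x ∈ B, |f x| ≤ C) : BM (B.indicator f) := by
  classical
  refine ⟨?_, C, fun x => ?_⟩
  · rw [← piecewise_eq_indicator]
    exact hf.measurable_piecewise continuousOn_const hB
  · by_cases hx : x ∈ B
    · rw [indicator_of_mem hx]; exact hC x hx
    · rw [indicator_of_notMem hx, abs_zero]; exact hC0

lemma Mop_add_const {κ f : Euc N → ℝ} (hκc : Continuous κ) (hκs : HasCompactSupport κ) (hf : BM f) (c : ℝ) (x : Euc N) (s : ℝ) :
    Mop κ s (fun y => f y + c) x = Mop κ s f x + c * ∫ z, κ z := by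
  unfold Mop
  simp_rw [mul_add]
  rw [integral_add (Mop_int hκc hκs hf x s) ((hκc.integrable_of_hasCompactSupport hκs).mul_const c), integral_mul_const]
  ring

lemma Rop_lt (h : IsKer K k) {a b : Euc N → ℝ} {x : Euc N} {r : ℝ} (hr : 0 < r)
    (ha : ContinuousOn a (closedBall x r)) (hb : ContinuousOn b (closedBall x r)) {c : ℝ} (hc : 0 < c)
    (hab : ∀ y ∈ closedBall x r, b y + c ≤ a y) : Rop K r b x < Rop K r a x := by
  obtain ⟨A, hA⟩ := (isCompact_closedBall x r).exists_bound_of_continuousOn ha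
  obtain ⟨B, hB⟩ := (isCompact_closedBall x r).exists_bound_of_continuousOn hb
  have hx : x ∈ closedBall x r := mem_closedBall_self hr.le
  have hma := BM_ind (B := closedBall x r) measurableSet_closedBall ha ((norm_nonneg _).trans (hA x hx)) hA
  have hmb := BM_ind (B := closedBall x r) measurableSet_closedBall hb ((norm_nonneg _).trans (hB x hx)) hB
  set a' := (closedBall x r).indicator a
  set b' := (closedBall x r).indicator b
  have ea : Rop K r a x = Rop K r a' x := Rop_congr h.Ks hr fun y hy => 
    (indicator_of_mem (ball_subset_closedBall hy) a).symm
  have eb : Rop K r b x = Rop K r b' x := Rop_congr h.Ks hr fun y hy => 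
    (indicator_of_mem (ball_subset_closedBall hy) b).symm
  rw [ea, eb]
  have hIK := h.Ki
  have h1 : IntervalIntegrable (fun s : ℝ => s * (c * ∫ z, K z)) volume 0 r :=
    Continuous.intervalIntegrable (by fun_prop) _ _
  have h2 : ∫ s in (0:ℝ)..r, (s * Mop K s b' x + s * (c * ∫ z, K z)) ≤ Rop K r a' x := by
    refine intervalIntegral.integral_mono_on hr.le ((Rop_ii h.contK h.csK hmb x 0 r).add h1)
      (Rop_ii h.contK h.csK hma x 0 r) fun s hs => ?_
    rcases hs.1.eq_or_lt with h0 | h0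
    · simp [← h0]
    rw [← mul_add]
    refine mul_le_mul_of_nonneg_left ?_ h0.le
    rw [← Mop_add_const h.contK h.csK hmb]
    unfold Mop
    refine integral_mono (Mop_int h.contK h.csK (h := fun y => b' y + c) ⟨hmb.1.add_const c, ?_⟩ x s) (Mop_int h.contK h.csK hma x s) fun z => ?_
    · obtain ⟨B', hB'⟩ := hmb.2
      exact ⟨B' + |c|, fun y => (abs_add_le _ _).trans (by gcongr; exact hB' y)⟩
    · by_cases hz : z ∈ ball (0 : Euc N) 1
      · have hm := ball_subset_closedBall (mem_ball_aff (x := x) h0 hs.2 hz)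
        refine mul_le_mul_of_nonneg_left ?_ (h.K0 z)
        simp only [a', b', indicator_of_mem hm]
        exact hab _ hm
      · simp [h.Ks z hz]
  rw [intervalIntegral.integral_add (Rop_ii h.contK h.csK hmb x 0 r) h1] at h2
  rw [intervalIntegral.integral_mul_const, integral_id] at h2
  have : 0 < (r^2 - 0^2)/2 * (c * ∫ z, K z) := by
    have : 0 < r^2 - 0^2 := by
      have := pow_pos hr 2
      linarith
    positivity
  change Rop K r b' x + _ ≤ _ at h2
  linarith

/-- strict maximum principle -/
lemma SMP {Ω : Set (Euc N)} (hΩ : IsOpen Ω) (hbd : Bornology.IsBounded Ω) {p : Euc N → ℝ} (hp : ContDiffOn ℝ 2 p Ω)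
    (hpc : ContinuousOn p (closure Ω)) (hlap : ∀ x ∈ Ω, 0 < - lap p x) (hb : ∀ x ∈ frontier Ω, 0 ≤ p x) :
    ∀ x ∈ Ω, 0 < p x := by
  obtain ⟨K, k, h⟩ := exists_ker (N := N)
  have key : ∀ x ∈ Ω, (∀ y ∈ Ω, p x ≤ p y) → False := by
    intro x hx hmin
    obtain ⟨r, hr, hsub⟩ := nhds_basis_closedBall.mem_iff.1 (hΩ.mem_nhds hx)
    have h1 := mean_loc h hΩ hp hr hsub
    have hcl : ContinuousOn (fun y => - lap p y) (closedBall x r) := ((contOn_lap hΩ hp).mono hsub).neg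
    obtain ⟨y0, hy0, hm⟩ := (isCompact_closedBall x r).exists_isMinOn ⟨x, mem_closedBall_self hr.le⟩ hcl
    have h2 := Rop_lt h (a := fun y => - lap p y) (b := fun _ => 0) hr hcl continuousOn_const (hlap y0 (hsub hy0)) (fun y hy => by
      rw [zero_add]; exact hm hy)
    have h3 : Rop K r (fun _ => 0) x = 0 := by simp [Rop, Mop]
    have h4 : p x ≤ Mop k r p x := by
      have : p x = Mop k r (fun _ => p x) x := by
        simp only [Mop]; rw [integral_mul_const, h.ki, one_mul]
      rw [this]
      obtain ⟨C, hC⟩ := (isCompact_closedBall x r).exists_bound_of_continuousOn ((hp.continuousOn).mono hsub)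
      have hm := BM_ind (B := closedBall x r) measurableSet_closedBall ((hp.continuousOn).mono hsub) ((norm_nonneg _).trans (hC x (mem_closedBall_self hr.le))) hC
      rw [Mop_congr (g := (closedBall x r).indicator p) (f := p) h.ks hr fun y hy => (indicator_of_mem (ball_subset_closedBall hy) p).symm]
      refine integral_mono (h.intk.mul_const _) (Mop_int h.contk h.csk hm x r) fun z => ?_
      by_cases hz : z ∈ ball (0 : Euc N) 1
      · have hm := ball_subset_closedBall (mem_ball_aff (x := x) hr le_rfl hz)
        refine mul_le_mul_of_nonneg_left ?_ (h.k0 z)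
        simp only [indicator_of_mem hm]
        exact hmin _ (hsub hm)
      · simp [h.ks z hz]
    linarith
  have hcomp : IsCompact (closure Ω) := hbd.isCompact_closure
  intro x hx
  obtain ⟨x0, hx0, hm⟩ := hcomp.exists_isMinOn ⟨x, subset_closure hx⟩ hpc
  have hx0' : x0 ∉ Ω := fun hx0' => key x0 hx0' fun y hy => hm (subset_closure hy)
  have : 0 ≤ p x0 := hb x0 (by rw [frontier, hΩ.interior_eq]; exact ⟨hx0, hx0'⟩)
  have h1 : 0 ≤ p x := this.trans (hm (subset_closure hx))
  refine lt_of_le_of_ne h1 fun h0 => key x hx fun y hy => ?_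
  rw [← h0]
  exact this.trans (hm (subset_closure hy))

lemma Mop_lim {κ : Euc N → ℝ} (hκc : Continuous κ) (hκs : HasCompactSupport κ) {w : ℕ → Euc N → ℝ} {W : Euc N → ℝ} (hw : ∀ j, BM (w j)) {C : ℝ}
    (hC : ∀ j x, |w j x| ≤ C) (hl : ∀ᵐ y, Tendsto (fun j => w j y) atTop (𝓝 (W y))) {r : ℝ} (hr : 0 < r) (x : Euc N) :
    Tendsto (fun j => Mop κ r (w j) x) atTop (𝓝 (Mop κ r W x)) := by
  have hl' : ∀ᵐ z : Euc N, Tendsto (fun j => w j (x + r • z)) atTop (𝓝 (W (x + r • z))) := by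
    rw [ae_iff] at hl ⊢
    have h1 : volume ((fun y => x + y) ⁻¹' {a | ¬ Tendsto (fun j => w j a) atTop (𝓝 (W a))}) = 0 := by
      rw [measure_preimage_add]; exact hl
    have h2 := Measure.addHaar_preimage_smul (volume : Measure (Euc N)) hr.ne' ((fun y => x + y) ⁻¹' {a | ¬ Tendsto (fun j => w j a) atTop (𝓝 (W a))})
    rw [h1, mul_zero] at h2
    exact h2
  refine tendsto_integral_of_dominated_convergence (fun z => |κ z| * C) ?_ ?_ ?_ ?_
  · intro j; exact (Mop_int hκc hκs (hw j) x r).aestronglyMeasurable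
  · exact (hκc.integrable_of_hasCompactSupport hκs).abs.mul_const C
  · intro j
    refine Eventually.of_forall fun z => ?_
    rw [norm_mul]
    exact mul_le_mul_of_nonneg_left (hC _ _) (abs_nonneg _)
  · filter_upwards [hl'] with z hz using hz.const_mul _

lemma Rop_lim {κ : Euc N → ℝ} (hκc : Continuous κ) (hκs : HasCompactSupport κ) {w : ℕ → Euc N → ℝ} {W : Euc N → ℝ} (hw : ∀ j, BM (w j)) {C : ℝ}
    (hC : ∀ j x, |w j x| ≤ C) (hl : ∀ y, Tendsto (fun j => w j y) atTop (𝓝 (W y))) {r : ℝ} (hr : 0 < r) (x : Euc N) :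
    Tendsto (fun j => Rop κ r (w j) x) atTop (𝓝 (Rop κ r W x)) := by
  refine intervalIntegral.tendsto_integral_filter_of_dominated_convergence (fun s => |s| * ((∫ z, |κ z|) * C)) ?_ ?_ ?_ ?_
  · refine Eventually.of_forall fun j => ?_
    exact (stronglyMeasurable_id.mul (Mop_meas hκc (hw j) x)).aestronglyMeasurable
  · refine Eventually.of_forall fun j => Eventually.of_forall fun s hs => ?_
    rw [norm_mul]
    exact mul_le_mul_of_nonneg_left (Mop_bd hκc hκs (hC j) x s) (abs_nonneg _)
  · exact Continuous.intervalIntegrable (by fun_prop) _ _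
  · refine Eventually.of_forall fun s hs => ?_
    rw [uIoc_of_le hr.le] at hs
    exact (Mop_lim hκc hκs hw hC (Eventually.of_forall hl) hs.1 x).const_mul s

/-- compactness lemma -/
lemma lemC {V : Set (Euc N)} (hV : IsOpen V) {w h : ℕ → Euc N → ℝ} {W H : Euc N → ℝ} {C : ℝ}
    (hw : ∀ j, ContDiffOn ℝ 2 (w j) V) (heq : ∀ j, ∀ x ∈ V, - lap (w j) x = h j x)
    (hwb : ∀ j, ∀ x ∈ V, |w j x| ≤ C) (hhb : ∀ j, ∀ x ∈ V, |h j x| ≤ C)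
    (hl : ∀ᵐ y, y ∈ V → Tendsto (fun j => w j y) atTop (𝓝 (W y)))
    (hh : ∀ x ∈ V, Tendsto (fun j => h j x) atTop (𝓝 (H x))) :
    ∃ w' : Euc N → ℝ, (∀ x ∈ V, Tendsto (fun j => w j x) atTop (𝓝 (w' x))) ∧ ContDiffOn ℝ 1 w' V ∧
      (ContDiffOn ℝ 1 H V → ContDiffOn ℝ 2 w' V ∧ ∀ x ∈ V, - lap w' x = H x) := by
  obtain ⟨K, k, hk⟩ := exists_ker (N := N)
  have hhc : ∀ j, ContinuousOn (h j) V := fun j => ((contOn_lap hV (hw j)).neg).congr fun x hx => (heq j x hx).symm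
  have hC0 : ∀ x ∈ V, 0 ≤ C := fun x hx => (abs_nonneg _).trans (hwb 0 x hx)
  have step : ∀ (W : Euc N → ℝ), (∀ᵐ y, y ∈ V → Tendsto (fun j => w j y) atTop (𝓝 (W y))) →
      ∀ x0 ρ x r, 0 < r → closedBall x r ⊆ ball x0 ρ → ball x0 ρ ⊆ V →
      Tendsto (fun j => w j x) atTop (𝓝 (Mop k r ((ball x0 ρ).indicator W) x + Rop K r ((ball x0 ρ).indicator H) x)) := by
    intro W hl x0 ρ x r hr hxB hBV
    have hx : x ∈ V := hBV (hxB (mem_closedBall_self hr.le))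
    have e : ∀ j, w j x = Mop k r ((ball x0 ρ).indicator (w j)) x + Rop K r ((ball x0 ρ).indicator (h j)) x := by
      intro j
      rw [mean_loc hk hV (hw j) hr (hxB.trans hBV)]
      congr 1
      · refine Mop_congr hk.ks hr fun y hy => ?_
        rw [indicator_of_mem (hxB (ball_subset_closedBall hy))]
      · refine Rop_congr hk.Ks hr fun y hy => ?_
        rw [indicator_of_mem (hxB (ball_subset_closedBall hy)), heq j y (hBV (hxB (ball_subset_closedBall hy)))]
    simp_rw [e]
    refine Tendsto.add ?_ ?_
    · refine Mop_lim hk.contk hk.csk (C := C) (fun j => BM_ind measurableSet_ball ((hw j).continuousOn.mono hBV) (hC0 x hx) fun y hy => hwb j y (hBV hy)) ?_ ?_ hr x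
      · intro j y
        by_cases hy : y ∈ ball x0 ρ
        · rw [indicator_of_mem hy]; exact hwb j y (hBV hy)
        · rw [indicator_of_notMem hy, abs_zero]; exact hC0 x hx
      · filter_upwards [hl] with y hyl
        by_cases hy : y ∈ ball x0 ρ
        · simp only [indicator_of_mem hy]; exact hyl (hBV hy)
        · simp only [indicator_of_notMem hy]; exact tendsto_const_nhds
    · refine Rop_lim hk.contK hk.csK (C := C) (fun j => BM_ind measurableSet_ball ((hhc j).mono hBV) (hC0 x hx) fun y hy => hhb j y (hBV hy)) ?_ ?_ hr x
      · intro j y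
        by_cases hy : y ∈ ball x0 ρ
        · rw [indicator_of_mem hy]; exact hhb j y (hBV hy)
        · rw [indicator_of_notMem hy, abs_zero]; exact hC0 x hx
      · intro y
        by_cases hy : y ∈ ball x0 ρ
        · simp only [indicator_of_mem hy]; exact hh y (hBV hy)
        · simp only [indicator_of_notMem hy]; exact tendsto_const_nhds
  have ex : ∀ x, ∃ l, x ∈ V → Tendsto (fun j => w j x) atTop (𝓝 l) := by
    intro x
    by_cases hx : x ∈ V
    · obtain ⟨r, hr, hsub⟩ := Metric.isOpen_iff.1 hV x hx
      exact ⟨_, fun _ => step W hl x r x (r/2) (by positivity) (closedBall_subset_ball (by linarith)) hsub⟩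
    · exact ⟨0, fun h => absurd h hx⟩
  choose w' hw' using ex
  have hw'b : ∀ x ∈ V, |w' x| ≤ C := fun x hx => le_of_tendsto (hw' x hx).abs (Eventually.of_forall fun j => hwb j x hx)
  have hHb : ∀ x ∈ V, |H x| ≤ C := fun x hx => le_of_tendsto (hh x hx).abs (Eventually.of_forall fun j => hhb j x hx)
  have lim_BM : ∀ (f : ℕ → Euc N → ℝ) (F : Euc N → ℝ) (B : Set (Euc N)), MeasurableSet B → (∀ j, ContinuousOn (f j) B) →
      (∀ x ∈ B, |F x| ≤ C) → 0 ≤ C → (∀ j, ∀ x ∈ B, |f j x| ≤ C) → (∀ x ∈ B, Tendsto (fun j => f j x) atTop (𝓝 (F x))) → BM (B.indicator F) := by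
    intro f F B hB hc hFb hC0 hfb hlim
    refine ⟨measurable_of_tendsto_metrizable (f := fun j => B.indicator (f j)) (fun j => (BM_ind hB (hc j) hC0 (hfb j)).1) ?_, C, fun x => ?_⟩
    · rw [tendsto_pi_nhds]
      intro y
      by_cases hy : y ∈ B
      · simp only [indicator_of_mem hy]; exact hlim y hy
      · simp only [indicator_of_notMem hy]; exact tendsto_const_nhds
    · by_cases hy : x ∈ B
      · rw [indicator_of_mem hy]; exact hFb x hy
      · rw [indicator_of_notMem hy, abs_zero]; exact hC0
  have rep : ∀ x0 ρ x r, 0 < r → closedBall x r ⊆ ball x0 ρ → ball x0 ρ ⊆ V → 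
      w' x = Mop k r ((ball x0 ρ).indicator w') x + Rop K r ((ball x0 ρ).indicator H) x := by
    intro x0 ρ x r hr hxB hBV
    exact tendsto_nhds_unique (hw' x (hBV (hxB (mem_closedBall_self hr.le)))) (step w' (Eventually.of_forall hw') x0 ρ x r hr hxB hBV)
  have loc : ∀ x0 ∈ V, ∃ ρ > 0, ball x0 (3*ρ) ⊆ V ∧ ∀ x ∈ ball x0 ρ, 
      w' x = Mop k ρ ((ball x0 (3*ρ)).indicator w') x + Rop K ρ ((ball x0 (3*ρ)).indicator H) x := by
    intro x0 hx0
    obtain ⟨r, hr, hsub⟩ := Metric.isOpen_iff.1 hV x0 hx0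
    refine ⟨r/3, by positivity, by convert hsub using 2; ring, fun x hx => ?_⟩
    refine rep x0 _ x (r/3) (by positivity) ?_ (by convert hsub using 2; ring)
    intro y hy
    have := dist_triangle y x x0
    simp only [mem_ball, mem_closedBall] at *
    linarith
  have hBMw : ∀ x0 ρ, 0 < ρ → ball x0 ρ ⊆ V → BM ((ball x0 ρ).indicator w') := fun x0 ρ hρ hB =>
    lim_BM w w' _ measurableSet_ball (fun j => (hw j).continuousOn.mono hB) (fun x hx => hw'b x (hB hx)) (hC0 x0 (hB (mem_ball_self hρ))) 
      (fun j x hx => hwb j x (hB hx)) (fun x hx => hw' x (hB hx))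
  have hBMH : ∀ x0 ρ, 0 < ρ → ball x0 ρ ⊆ V → BM ((ball x0 ρ).indicator H) := fun x0 ρ hρ hB =>
    lim_BM h H _ measurableSet_ball (fun j => (hhc j).mono hB) (fun x hx => hHb x (hB hx)) (hC0 x0 (hB (mem_ball_self hρ))) 
      (fun j x hx => hhb j x (hB hx)) (fun x hx => hh x (hB hx))
  refine ⟨w', hw', ?_, fun hH => ?_⟩
  · intro x0 hx0
    obtain ⟨ρ, hρ, hB, hrep⟩ := loc x0 hx0
    have h1 := (Mop_C2 hk.ck hk.csk (hBMw x0 (3*ρ) (by positivity) hB) hρ).of_le (show (1:WithTop ℕ∞) ≤ 2 by norm_num)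
    have h2 := Rop_C1 hk.c1c.cd hk.csK (hBMH x0 (3*ρ) (by positivity) hB) hρ
    refine ((h1.add h2).contDiffAt.congr_of_eventuallyEq ?_).contDiffWithinAt
    filter_upwards [ball_mem_nhds x0 hρ] with x hx using hrep x hx
  · have hc2 : ContDiffOn ℝ 2 w' V := by
      intro x0 hx0
      obtain ⟨ρ, hρ, hB, hrep⟩ := loc x0 hx0
      have h1 := (Mop_C2 hk.ck hk.csk (hBMw x0 (3*ρ) (by positivity) hB) hρ)
      obtain ⟨g, hg, hgs, hgH⟩ := ext_ball (n := 1) hV hH (x := x0) (r := 2*ρ) (by positivity) ((closedBall_subset_ball (by linarith)).trans hB)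
      have h2 := Rop_C2 hk.c1c.cd hk.csK hg hgs hρ
      refine ((h1.add h2).contDiffAt.congr_of_eventuallyEq ?_).contDiffWithinAt
      filter_upwards [ball_mem_nhds x0 hρ] with x hx
      rw [hrep x hx]
      congr 1
      refine Rop_congr hk.Ks hρ fun y hy => ?_
      have hy' : y ∈ ball x0 (2*ρ) := by
        have := dist_triangle y x x0
        simp only [mem_ball] at *
        linarith
      rw [indicator_of_mem (ball_subset_ball (by linarith) hy')]
      exact (hgH y (ball_subset_closedBall hy')).eq_of_nhds.symm
    refine ⟨hc2, fun x hx => ?_⟩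
    have hR : ∀ r, 0 < r → closedBall x r ⊆ V → Rop K r (fun y => - lap w' y) x = Rop K r H x := by
      intro r hr hsub
      obtain ⟨δ, hδ, hsub'⟩ := (isCompact_closedBall x r).exists_cthickening_subset_open hV hsub
      rw [cthickening_closedBall hδ.le hr.le] at hsub'
      have h1 := mean_loc hk hV hc2 hr hsub
      have h2 := rep x (r+δ) x r hr (closedBall_subset_ball (by linarith)) (ball_subset_closedBall.trans (by rwa [add_comm]))
      rw [Mop_congr (g := w') hk.ks hr, Rop_congr (g := H) hk.Ks hr] at h2
      · linarith
      · intro y hy; rw [indicator_of_mem (ball_subset_ball (by linarith) hy)]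
      · intro y hy; rw [indicator_of_mem (ball_subset_ball (by linarith) hy)]
    have hcl : ContinuousOn (fun y => - lap w' y) V := (contOn_lap hV hc2).neg
    have hcH : ContinuousOn H V := hH.continuousOn
    have cmp : ∀ a b : Euc N → ℝ, ContinuousOn a V → ContinuousOn b V → b x < a x → 
        (∀ r, 0 < r → closedBall x r ⊆ V → Rop K r a x = Rop K r b x) → False := by
      intro a b ha hb hab hR
      have hcd : ContinuousAt (fun y => a y - b y) x := ((ha.sub hb).continuousAt (hV.mem_nhds hx))
      have hev : ∀ᶠ y in 𝓝 x, (a x - b x)/2 < a y - b y := hcd.eventually (lt_mem_nhds (show (a x - b x)/2 < a x - b x by linarith))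
      obtain ⟨r, hr, hs⟩ := nhds_basis_closedBall.mem_iff.1 (inter_mem (hV.mem_nhds hx) hev)
      have := Rop_lt hk (c := (a x - b x)/2) hr (ha.mono fun y hy => (hs hy).1) (hb.mono fun y hy => (hs hy).1) (by linarith) (fun y hy => by
        have : (a x - b x)/2 < a y - b y := (hs hy).2
        linarith)
      exact this.ne (hR r hr fun y hy => (hs hy).1).symm
    rcases lt_trichotomy (- lap w' x) (H x) with h1 | h1 | h1
    · exact (cmp _ _ hcH hcl h1 fun r hr hs => (hR r hr hs).symm).elim
    · exact h1
    · exact (cmp _ _ hcl hcH h1 hR).elim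

end


section
variable {N : ℕ} {K k : Euc N → ℝ}

lemma reg_of_rep (hk : IsKer K k) {V : Set (Euc N)} (hV : IsOpen V) {w' H : Euc N → ℝ}
    (hBw : BM (V.indicator w')) (hBH : BM (V.indicator H))
    (rep : ∀ x r, 0 < r → closedBall x r ⊆ V → w' x = Mop k r w' x + Rop K r H x) :
    ContDiffOn ℝ 1 w' V ∧ (ContDiffOn ℝ 1 H V → ContDiffOn ℝ 2 w' V ∧ ∀ x ∈ V, - lap w' x = H x) := by
  have loc : ∀ x0 ∈ V, ∃ ρ > 0, closedBall x0 (2*ρ) ⊆ V ∧ ∀ x ∈ ball x0 ρ, closedBall x ρ ⊆ closedBall x0 (2*ρ) := by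
    intro x0 hx0
    obtain ⟨r, hr, hsub⟩ := nhds_basis_closedBall.mem_iff.1 (hV.mem_nhds hx0)
    refine ⟨r/2, by positivity, by convert hsub using 2; ring, fun x hx => ?_⟩
    intro y hy
    have := dist_triangle y x x0
    simp only [mem_ball, mem_closedBall] at *
    linarith
  constructor
  · intro x0 hx0
    obtain ⟨ρ, hρ, hB, hrep⟩ := loc x0 hx0
    have h1 := (Mop_C2 hk.ck hk.csk hBw hρ).of_le (show (1:WithTop ℕ∞) ≤ 2 by norm_num)
    have h2 := Rop_C1 hk.c1c.cd hk.csK hBH hρ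
    refine ((h1.add h2).contDiffAt.congr_of_eventuallyEq ?_).contDiffWithinAt
    filter_upwards [ball_mem_nhds x0 hρ] with x hx
    have hs := (hrep x hx).trans hB
    rw [rep x ρ hρ hs]
    congr 1
    · exact Mop_congr hk.ks hρ fun y hy => (indicator_of_mem (hs (ball_subset_closedBall hy)) _).symm
    · exact Rop_congr hk.Ks hρ fun y hy => (indicator_of_mem (hs (ball_subset_closedBall hy)) _).symm
  intro hH
  have hc2 : ContDiffOn ℝ 2 w' V := by
    intro x0 hx0
    obtain ⟨ρ, hρ, hB, hrep⟩ := loc x0 hx0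
    have h1 := (Mop_C2 hk.ck hk.csk hBw hρ)
    obtain ⟨g, hg, hgs, hgH⟩ := ext_ball (n := 1) hV hH (x := x0) (r := 2*ρ) (by positivity) hB
    have h2 := Rop_C2 hk.c1c.cd hk.csK hg hgs hρ
    refine ((h1.add h2).contDiffAt.congr_of_eventuallyEq ?_).contDiffWithinAt
    filter_upwards [ball_mem_nhds x0 hρ] with x hx
    have hs := (hrep x hx).trans hB
    rw [rep x ρ hρ hs]
    congr 1
    · exact Mop_congr hk.ks hρ fun y hy => (indicator_of_mem (hs (ball_subset_closedBall hy)) _).symm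
    · exact Rop_congr hk.Ks hρ fun y hy => (hgH y (hrep x hx (ball_subset_closedBall hy))).eq_of_nhds.symm
  refine ⟨hc2, fun x hx => ?_⟩
  have hR : ∀ r, 0 < r → closedBall x r ⊆ V → Rop K r (fun y => - lap w' y) x = Rop K r H x := by
    intro r hr hsub
    have h1 := mean_loc hk hV hc2 hr hsub
    have h2 := rep x r hr hsub
    linarith
  have hcl : ContinuousOn (fun y => - lap w' y) V := (contOn_lap hV hc2).neg
  have hcH : ContinuousOn H V := hH.continuousOn
  have cmp : ∀ a b : Euc N → ℝ, ContinuousOn a V → ContinuousOn b V → b x < a x → 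
      (∀ r, 0 < r → closedBall x r ⊆ V → Rop K r a x = Rop K r b x) → False := by
    intro a b ha hb hab hR
    have hcd : ContinuousAt (fun y => a y - b y) x := ((ha.sub hb).continuousAt (hV.mem_nhds hx))
    have hev : ∀ᶠ y in 𝓝 x, (a x - b x)/2 < a y - b y := hcd.eventually (lt_mem_nhds (show (a x - b x)/2 < a x - b x by linarith))
    obtain ⟨r, hr, hs⟩ := nhds_basis_closedBall.mem_iff.1 (inter_mem (hV.mem_nhds hx) hev)
    have := Rop_lt hk (c := (a x - b x)/2) hr (ha.mono fun y hy => (hs hy).1) (hb.mono fun y hy => (hs hy).1) (by linarith) (fun y hy => by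
      have : (a x - b x)/2 < a y - b y := (hs hy).2
      linarith)
    exact this.ne (hR r hr fun y hy => (hs hy).1).symm
  rcases lt_trichotomy (- lap w' x) (H x) with h1 | h1 | h1
  · exact (cmp _ _ hcH hcl h1 fun r hr hs => (hR r hr hs).symm).elim
  · exact h1
  · exact (cmp _ _ hcl hcH h1 hR).elim

lemma Mop_mono {κ a b : Euc N → ℝ} (hκc : Continuous κ) (hκs : HasCompactSupport κ) (hκ0 : ∀ z, 0 ≤ κ z)
    (hκ : ∀ z, z ∉ ball (0 : Euc N) 1 → κ z = 0)
    (ha : BM a) (hb : BM b) {x : Euc N} {r : ℝ} (hr : 0 < r) (hab : ∀ y ∈ ball x r, a y ≤ b y) :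
    Mop κ r a x ≤ Mop κ r b x := by
  refine integral_mono (Mop_int hκc hκs ha x r) (Mop_int hκc hκs hb x r) fun z => ?_
  by_cases hz : z ∈ ball (0 : Euc N) 1
  · exact mul_le_mul_of_nonneg_left (hab _ (mem_ball_aff hr le_rfl hz)) (hκ0 z)
  · simp [hκ z hz]

lemma Rop_mono {κ a b : Euc N → ℝ} (hκc : Continuous κ) (hκs : HasCompactSupport κ) (hκ0 : ∀ z, 0 ≤ κ z)
    (hκ : ∀ z, z ∉ ball (0 : Euc N) 1 → κ z = 0)
    (ha : BM a) (hb : BM b) {x : Euc N} {r : ℝ} (hr : 0 < r) (hab : ∀ y ∈ ball x r, a y ≤ b y) :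
    Rop κ r a x ≤ Rop κ r b x := by
  refine intervalIntegral.integral_mono_on hr.le (Rop_ii hκc hκs ha x 0 r) (Rop_ii hκc hκs hb x 0 r) fun s hs => ?_
  rcases hs.1.eq_or_lt with h0 | h0
  · simp [← h0]
  exact mul_le_mul_of_nonneg_left (Mop_mono hκc hκs hκ0 hκ ha hb h0 fun y hy => hab y (ball_subset_ball hs.2 hy)) h0.le

lemma prod_cs {κ φ : Euc N → ℝ} (hκc : Continuous κ) (hκs : HasCompactSupport κ) (hφc : Continuous φ) (hφs : HasCompactSupport φ) (s : ℝ) :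
    Integrable (fun p : Euc N × Euc N => κ p.2 * φ (p.1 + s • p.2)) (volume.prod volume) := by
  obtain ⟨R, hR⟩ := hκs.isCompact.isBounded.subset_closedBall (0 : Euc N)
  obtain ⟨S, hS⟩ := hφs.isCompact.isBounded.subset_closedBall (0 : Euc N)
  refine Continuous.integrable_of_hasCompactSupport (by fun_prop) ?_
  refine HasCompactSupport.intro ((isCompact_closedBall (0 : Euc N) (S + |s| * R)).prod (isCompact_closedBall (0 : Euc N) R)) ?_
  rintro ⟨x, z⟩ hxz
  by_cases hz : z ∈ tsupport κ
  · by_cases hx : x + s • z ∈ tsupport φ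
    · exfalso; apply hxz
      have h1 := hR hz
      have h2 := hS hx
      refine ⟨?_, h1⟩
      simp only [mem_closedBall, dist_zero_right] at *
      calc ‖x‖ = ‖(x + s • z) - s • z‖ := by congr 1; abel
        _ ≤ ‖x + s • z‖ + ‖s • z‖ := norm_sub_le _ _
        _ ≤ _ := by rw [norm_smul, Real.norm_eq_abs]; gcongr
    · simp [image_eq_zero_of_notMem_tsupport hx]
  · simp [image_eq_zero_of_notMem_tsupport hz]

lemma Mop_symm {κ φ w : Euc N → ℝ} (hκc : Continuous κ) (hκs : HasCompactSupport κ) (hκe : ∀ z, κ (-z) = κ z)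
    (hφc : Continuous φ) (hφs : HasCompactSupport φ) (hw : BM w) (s : ℝ) :
    ∫ x, φ x * Mop κ s w x = ∫ x, Mop κ s φ x * w x := by
  obtain ⟨C, hC⟩ := hw.2
  have hwm := hw.1
  have hκi : Integrable κ := hκc.integrable_of_hasCompactSupport hκs
  have hφi : Integrable φ := hφc.integrable_of_hasCompactSupport hφs
  unfold Mop
  simp_rw [← integral_const_mul, ← integral_mul_const]
  rw [integral_integral_swap]
  on_goal 1 => rw [eq_comm, integral_integral_swap, eq_comm]
  · rw [← integral_neg_eq_self]
    congr 1; ext z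
    rw [← integral_sub_right_eq_self _ (s • (-z))]
    congr 1; ext x
    rw [hκe]
    simp only [smul_neg, sub_neg_eq_add, add_neg_cancel_right]
    ring
  · refine Integrable.mul_bdd (c := C) (prod_cs hκc hκs hφc hφs s) (hwm.comp measurable_fst).aestronglyMeasurable ?_
    exact Eventually.of_forall fun p => hC _
  · have h1 : Integrable (fun p : Euc N × Euc N => φ p.1 * κ p.2) (volume.prod volume) := hφi.mul_prod hκi
    have h2 := Integrable.mul_bdd (c := C) (f := fun p : Euc N × Euc N => φ p.1 * κ p.2) (g := fun p : Euc N × Euc N => w (p.1 + s • p.2)) h1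
      (hwm.comp (by fun_prop)).aestronglyMeasurable (Eventually.of_forall fun p => hC _)
    refine h2.congr (Eventually.of_forall fun p => ?_)
    simp only [Function.uncurry_def]; ring

lemma Mop_meas2 {κ h : Euc N → ℝ} (hκc : Continuous κ) (hh : BM h) :
    StronglyMeasurable (fun p : Euc N × ℝ => Mop κ p.2 h p.1) := by
  refine StronglyMeasurable.integral_prod_right (f := fun (p : Euc N × ℝ) (z : Euc N) => κ z * h (p.1 + p.2 • z)) ?_
  refine Measurable.stronglyMeasurable ?_
  have h1 := hκc.measurable
  have h2 := hh.1
  simp only [Function.uncurry_def]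
  exact (h1.comp measurable_snd).mul (h2.comp (by fun_prop))

lemma Rop_symm {κ φ w : Euc N → ℝ} (hκc : Continuous κ) (hκs : HasCompactSupport κ) (hκe : ∀ z, κ (-z) = κ z)
    (hφc : Continuous φ) (hφs : HasCompactSupport φ) (hw : BM w) {r : ℝ} (hr : 0 < r)  :
    ∫ x, φ x * Rop κ r w x = ∫ x, Rop κ r φ x * w x := by
  obtain ⟨C, hC⟩ := hw.2
  have hwm := hw.1
  have hφB := BM.of_cc hφc hφs
  obtain ⟨D, hD⟩ := hφB.2
  have hκi : Integrable κ := hκc.integrable_of_hasCompactSupport hκs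
  have hφi : Integrable φ := hφc.integrable_of_hasCompactSupport hφs
  have hsi : Integrable (fun s : ℝ => s) (volume.restrict (Ioc 0 r)) := by
    have := continuous_id.intervalIntegrable (μ := volume) (0:ℝ) r
    rw [intervalIntegrable_iff, uIoc_of_le hr.le] at this; exact this
  unfold Rop
  simp_rw [intervalIntegral.integral_of_le hr.le, ← integral_const_mul, ← integral_mul_const]
  rw [integral_integral_swap]
  on_goal 1 => rw [eq_comm, integral_integral_swap, eq_comm]
  · congr 1; ext s
    have := Mop_symm hκc hκs hκe hφc hφs hw s
    calc ∫ x, φ x * (s * Mop κ s w x) = ∫ x, s * (φ x * Mop κ s w x) := by congr 1; ext x; ring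
      _ = ∫ x, s * (Mop κ s φ x * w x) := by rw [integral_const_mul, integral_const_mul, this]
      _ = _ := by congr 1; ext x; ring
  · obtain ⟨R, hR⟩ := hκs.isCompact.isBounded.subset_closedBall (0 : Euc N)
    obtain ⟨S, hS⟩ := hφs.isCompact.isBounded.subset_closedBall (0 : Euc N)
    have h1 : Integrable (fun p : Euc N × ℝ => ((closedBall (0 : Euc N) (S + r * |R|)).indicator (fun _ => (1:ℝ)) p.1) * p.2) (volume.prod (volume.restrict (Ioc 0 r))) := by
      refine Integrable.mul_prod ?_ hsi
      rw [integrable_indicator_iff measurableSet_closedBall]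
      exact integrableOn_const (measure_closedBall_lt_top).ne
    have h2 := Integrable.mul_bdd (c := ((∫ z, |κ z|) * D) * C) (g := fun p : Euc N × ℝ => Mop κ p.2 φ p.1 * w p.1) h1
      (((Mop_meas2 hκc hφB).mul (hwm.comp measurable_fst).stronglyMeasurable).aestronglyMeasurable) (Eventually.of_forall fun p => by
        rw [norm_mul]
        exact mul_le_mul (Mop_bd hκc hκs hD _ _) (hC _) (abs_nonneg _) ((abs_nonneg _).trans (Mop_bd hκc hκs hD p.1 p.2)))
    refine h2.congr ?_
    have hae : ∀ᵐ p : Euc N × ℝ ∂(volume.prod (volume.restrict (Ioc 0 r))), p.2 ∈ Ioc 0 r := by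
      have : ∀ᵐ s ∂(volume.restrict (Ioc 0 r)), s ∈ Ioc 0 r := ae_restrict_mem measurableSet_Ioc
      exact Measure.quasiMeasurePreserving_snd.ae this
    filter_upwards [hae] with p hp
    simp only [Function.uncurry_def]
    by_cases hx : p.1 ∈ closedBall (0 : Euc N) (S + r * |R|)
    · rw [indicator_of_mem hx]; ring
    · rw [indicator_of_notMem hx]
      have : Mop κ p.2 φ p.1 = 0 := by
        unfold Mop
        rw [integral_eq_zero_of_ae]
        refine Eventually.of_forall fun z => ?_
        by_cases hz : z ∈ tsupport κ
        · by_cases hx' : p.1 + p.2 • z ∈ tsupport φ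
          · exfalso; apply hx
            have h1 := hR hz
            have h2 := hS hx'
            simp only [mem_closedBall, dist_zero_right] at *
            calc ‖p.1‖ = ‖(p.1 + p.2 • z) - p.2 • z‖ := by congr 1; abel
              _ ≤ ‖p.1 + p.2 • z‖ + ‖p.2 • z‖ := norm_sub_le _ _
              _ ≤ _ := by
                rw [norm_smul, Real.norm_eq_abs, abs_of_pos hp.1]
                have := hp.2
                have := h1.trans (le_abs_self R)
                have := hp.1
                gcongr
          · simp [image_eq_zero_of_notMem_tsupport hx']
        · simp [image_eq_zero_of_notMem_tsupport hz]
      rw [this]; ring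
  · have h1 : Integrable (fun p : Euc N × ℝ => φ p.1 * p.2) (volume.prod (volume.restrict (Ioc 0 r))) := hφi.mul_prod hsi
    have h2 := Integrable.mul_bdd (c := (∫ z, |κ z|) * C) (g := fun p : Euc N × ℝ => Mop κ p.2 w p.1) h1
      (Mop_meas2 hκc hw).aestronglyMeasurable (Eventually.of_forall fun p => Mop_bd hκc hκs hC _ _)
    refine h2.congr (Eventually.of_forall fun p => ?_)
    simp only [Function.uncurry_def]; ring

end


section
variable {N : ℕ} {K k : Euc N → ℝ}

def Oin (Ω : Set (Euc N)) (ε : ℝ) : Set (Euc N) := (cthickening ε Ωᶜ)ᶜ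

lemma Oin_open (Ω : Set (Euc N)) (ε : ℝ) : IsOpen (Oin Ω ε) := isClosed_cthickening.isOpen_compl

lemma mem_Oin {Ω : Set (Euc N)} (hΩ : IsOpen Ω) {ε : ℝ} (hε : 0 ≤ ε) {x : Euc N} : x ∈ Oin Ω ε ↔ closedBall x ε ⊆ Ω := by
  unfold Oin
  rw [hΩ.isClosed_compl.cthickening_eq_biUnion_closedBall hε]
  simp only [mem_compl_iff, mem_iUnion, mem_closedBall, not_exists]
  constructor
  · intro h y hy
    by_contra hyΩ
    exact h y hyΩ (by rw [dist_comm]; exact hy)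
  · intro h y hy hxy
    exact hy (h (by rw [mem_closedBall, dist_comm]; exact hxy))

lemma eps_sol (hk : IsKer K k) {Ω : Set (Euc N)} (hΩ : IsOpen Ω) {b h : Euc N → ℝ} (hb : ContDiffOn ℝ 2 b Ω)
    (hb0 : ∀ x ∈ Ω, 0 ≤ b x) (hB : BM (Ω.indicator b)) (hH : BM (Ω.indicator h)) (hh0 : ∀ x ∈ Ω, 0 ≤ h x)
    (hhb : ∀ x ∈ Ω, h x ≤ - lap b x) {ε : ℝ} (hε : 0 < ε) :
    ∃ w : Euc N → ℝ, Measurable w ∧ (∀ x, 0 ≤ w x ∧ w x ≤ Ω.indicator b x) ∧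
      ∀ x, closedBall x ε ⊆ Ω → w x = Mop k ε w x + Rop K ε (Ω.indicator h) x := by
  set H := Ω.indicator h with hHd
  set B := Ω.indicator b with hBd
  have hB0 : ∀ x, 0 ≤ B x := fun x => indicator_nonneg hb0 x
  have hH0 : ∀ x, 0 ≤ H x := fun x => indicator_nonneg hh0 x
  have hBB := hB
  obtain ⟨C, hC⟩ := hB.2
  let step : (Euc N → ℝ) → Euc N → ℝ := fun w => (Oin Ω ε).indicator (fun x => Mop k ε w x + Rop K ε H x)
  have mkBM : ∀ w : Euc N → ℝ, Measurable w → (∀ x, 0 ≤ w x ∧ w x ≤ B x) → BM w := fun w hw hwb =>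
    ⟨hw, C, fun x => by rw [abs_of_nonneg (hwb x).1]; exact (hwb x).2.trans ((le_abs_self _).trans (hC x))⟩
  have step_meas : ∀ w, BM w → Measurable (step w) := fun w hw =>
    Measurable.indicator (((Mop_cont hk.contk hk.csk hw hε).add (Rop_C1 hk.c1c.cd hk.csK hH hε).continuous).measurable) (Oin_open _ _).measurableSet
  have zBM : BM (fun _ : Euc N => (0:ℝ)) := ⟨measurable_const, 0, by simp⟩
  have z1 : ∀ (κ : Euc N → ℝ) r x, Mop κ r (fun _ => (0:ℝ)) x = 0 := fun κ r x => by simp [Mop]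
  have z2 : ∀ (κ : Euc N → ℝ) r x, Rop κ r (fun _ => (0:ℝ)) x = 0 := fun κ r x => by simp [Rop, z1]
  have step_mono : ∀ w w', BM w → BM w' → (∀ x, w x ≤ w' x) → ∀ x, step w x ≤ step w' x := by
    intro w w' hw hw' hww x
    refine indicator_le_indicator ?_
    have := Mop_mono hk.contk hk.csk hk.k0 hk.ks hw hw' (x := x) hε (fun y _ => hww y)
    linarith
  have step_nn : ∀ w, BM w → (∀ x, 0 ≤ w x) → ∀ x, 0 ≤ step w x := by
    intro w hw h0 x
    refine indicator_nonneg (fun x _ => ?_) x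
    have h1 := Mop_mono hk.contk hk.csk hk.k0 hk.ks zBM hw (x := x) hε (fun y _ => h0 y)
    have h2 := Rop_mono hk.contK hk.csK hk.K0 hk.Ks zBM hH (x := x) hε (fun y _ => hH0 y)
    rw [z1] at h1; rw [z2] at h2; linarith
  have step_le : ∀ w, BM w → (∀ x, w x ≤ B x) → ∀ x, step w x ≤ B x := by
    intro w hw hwb x
    by_cases hx : x ∈ Oin Ω ε
    · have hsub := (mem_Oin hΩ hε.le).1 hx
      have hxΩ : x ∈ Ω := hsub (mem_closedBall_self hε.le)
      simp only [step, indicator_of_mem hx]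
      rw [hBd, indicator_of_mem hxΩ, mean_loc hk hΩ hb hε hsub]
      have e1 : Mop k ε b x = Mop k ε B x := Mop_congr hk.ks hε fun y hy => (indicator_of_mem (hsub (ball_subset_closedBall hy)) _).symm
      rw [e1]
      have e2 : Rop K ε (fun y => - lap b y) x = Rop K ε ((closedBall x ε).indicator (fun y => - lap b y)) x :=
        Rop_congr hk.Ks hε fun y hy => (indicator_of_mem (f := fun y => - lap b y) (ball_subset_closedBall hy)).symm
      rw [e2]
      have hcl : ContinuousOn (fun y => - lap b y) (closedBall x ε) := ((contOn_lap hΩ hb).neg).mono hsub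
      obtain ⟨D, hD⟩ := (isCompact_closedBall x ε).exists_bound_of_continuousOn hcl
      have hBM : BM ((closedBall x ε).indicator (fun y => - lap b y)) :=
        BM_ind (C := |D|) measurableSet_closedBall hcl (abs_nonneg _) fun y hy => (hD y hy).trans (le_abs_self _)
      refine add_le_add (Mop_mono hk.contk hk.csk hk.k0 hk.ks hw hBB hε (fun y _ => hwb y))
        (Rop_mono hk.contK hk.csK hk.K0 hk.Ks hH hBM hε fun y hy => ?_)
      have hy' := ball_subset_closedBall hy
      rw [indicator_of_mem hy', hHd, indicator_of_mem (hsub hy')]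
      exact hhb y (hsub hy')
    · simp only [step, indicator_of_notMem hx]; exact hB0 x
  let w : ℕ → Euc N → ℝ := fun n => step^[n] (fun _ => 0)
  have wS : ∀ n, w (n+1) = step (w n) := fun n => Function.iterate_succ_apply' _ _ _
  have inv : ∀ n, Measurable (w n) ∧ ∀ x, 0 ≤ w n x ∧ w n x ≤ B x := by
    intro n
    induction n with
    | zero => exact ⟨measurable_const, fun x => ⟨le_rfl, hB0 x⟩⟩
    | succ n ih =>
      have := mkBM _ ih.1 ih.2
      rw [wS]
      exact ⟨step_meas _ this, fun x => ⟨step_nn _ this (fun x => (ih.2 x).1) x, step_le _ this (fun x => (ih.2 x).2) x⟩⟩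
  have wBM : ∀ n, BM (w n) := fun n => mkBM _ (inv n).1 (inv n).2
  have mono : ∀ n x, w n x ≤ w (n+1) x := by
    intro n
    induction n with
    | zero => exact fun x => ((inv 1).2 x).1
    | succ n ih =>
      intro x
      rw [wS n, wS (n+1)]
      exact step_mono _ _ (wBM n) (wBM (n+1)) ih x
  let W : Euc N → ℝ := fun x => ⨆ n, w n x
  have hlim : ∀ x, Tendsto (fun n => w n x) atTop (𝓝 (W x)) := fun x =>
    tendsto_atTop_ciSup (monotone_nat_of_le_succ fun n => mono n x) ⟨B x, by rintro _ ⟨n, rfl⟩; exact ((inv n).2 x).2⟩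
  refine ⟨W, measurable_of_tendsto_metrizable (fun n => (inv n).1) (tendsto_pi_nhds.2 hlim), fun x => ⟨ge_of_tendsto' (hlim x) fun n => ((inv n).2 x).1, le_of_tendsto' (hlim x) fun n => ((inv n).2 x).2⟩, ?_⟩
  intro x hx
  have hx' := (mem_Oin hΩ hε.le).2 hx
  have hM := Mop_lim hk.contk hk.csk wBM (C := C) (fun n y => by rw [abs_of_nonneg ((inv n).2 y).1]; exact ((inv n).2 y).2.trans ((le_abs_self _).trans (hC y))) (Eventually.of_forall hlim) hε x
  refine tendsto_nhds_unique ((hlim x).comp (tendsto_add_atTop_nat 1)) ((hM.add_const (Rop K ε H x)).congr fun n => ?_)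
  simp only [Function.comp, wS, step, indicator_of_mem hx']

end


section
variable {N : ℕ} {K k : Euc N → ℝ}

lemma weak_hilb {E : Type*} [NormedAddCommGroup E] [InnerProductSpace ℝ E] [CompleteSpace E] (f : ℕ → E) {C : ℝ}
    (hf : ∀ n, ‖f n‖ ≤ C) : ∃ W0 : E, ∀ q : E, Tendsto (fun n => inner ℝ (f n) q) (hyperfilter ℕ) (𝓝 (inner ℝ W0 q)) := by
  let g : ℕ → WeakDual ℝ E := fun n => StrongDual.toWeakDual (InnerProductSpace.toDual ℝ E (f n))
  have hcpt := WeakDual.isCompact_closedBall (𝕜 := ℝ) (E := E) 0 C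
  obtain ⟨l, -, hl⟩ := hcpt.ultrafilter_le_nhds ((hyperfilter ℕ).map g) (by
    rw [le_principal_iff]
    refine Ultrafilter.mem_map.2 (mem_of_superset (x := univ) univ_mem fun n _ => ?_)
    change InnerProductSpace.toDual ℝ E (f n) ∈ closedBall 0 _
    rw [mem_closedBall, dist_zero_right, LinearIsometryEquiv.norm_map]
    exact hf n)
  have hl' : Tendsto g (hyperfilter ℕ) (𝓝 l) := hl
  refine ⟨(InnerProductSpace.toDual ℝ E).symm (WeakDual.toStrongDual l), fun q => ?_⟩
  have h1 := ((WeakDual.eval_continuous (𝕜 := ℝ) (E := E) q).tendsto l).comp hl'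
  have h2 : inner ℝ ((InnerProductSpace.toDual ℝ E).symm (WeakDual.toStrongDual l)) q = l q := by
    rw [← InnerProductSpace.toDual_apply_apply (𝕜 := ℝ)]
    simp only [LinearIsometryEquiv.apply_symm_apply]; rfl
  rw [h2]
  exact h1

lemma weak_lim {w : ℕ → Euc N → ℝ} {B : Euc N → ℝ} (hB2 : MemLp B 2 volume) (hBm : Measurable B) (hw : ∀ n, Measurable (w n))
    (hwB : ∀ n x, 0 ≤ w n x ∧ w n x ≤ B x) :
    ∃ W : Euc N → ℝ, Measurable W ∧ (∀ x, 0 ≤ W x ∧ W x ≤ B x) ∧ ∃ U : Filter ℕ, U.NeBot ∧ U ≤ atTop ∧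
      ∀ q : Euc N → ℝ, MemLp q 2 volume → Tendsto (fun n => ∫ x, w n x * q x) U (𝓝 (∫ x, W x * q x)) := by
  have hw2 : ∀ n, MemLp (w n) 2 volume := fun n => hB2.mono (hw n).aestronglyMeasurable (Eventually.of_forall fun x => by
    rw [Real.norm_eq_abs, Real.norm_eq_abs, abs_of_nonneg (hwB n x).1]; exact (hwB n x).2.trans (le_abs_self _))
  obtain ⟨W0, hin⟩ := weak_hilb (fun n => (hw2 n).toLp) (C := ‖hB2.toLp‖) (fun n => by
    refine Lp.norm_le_norm_of_ae_le ?_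
    filter_upwards [(hw2 n).coeFn_toLp, hB2.coeFn_toLp] with x h1 h2
    rw [h1, h2, Real.norm_eq_abs, Real.norm_eq_abs, abs_of_nonneg (hwB n x).1]; exact (hwB n x).2.trans (le_abs_self _))
  have hint : ∀ q : Euc N → ℝ, MemLp q 2 volume → Tendsto (fun n => ∫ x, w n x * q x) (hyperfilter ℕ) (𝓝 (∫ x, W0 x * q x)) := by
    intro q hq
    have h1 := hin hq.toLp
    have e : ∀ f' : Lp ℝ 2 (volume : Measure (Euc N)), ∀ p : Euc N → ℝ, f' =ᵐ[volume] p → inner ℝ f' hq.toLp = ∫ x, p x * q x := by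
      intro f' p hp
      rw [L2.inner_def]
      refine integral_congr_ae ?_
      filter_upwards [hp, hq.coeFn_toLp] with x h1 h2
      rw [h1, h2]; simp [mul_comm]
    rw [e W0 W0 (ae_eq_refl _)] at h1
    refine h1.congr fun n => e _ _ (hw2 n).coeFn_toLp
  have hind : ∀ s : Set (Euc N), MeasurableSet s → volume s < ⊤ → MemLp (s.indicator fun _ => (1:ℝ)) 2 volume := fun s hs hv =>
    memLp_indicator_const 2 hs 1 (Or.inr hv.ne)
  have hmi : ∀ (s : Set (Euc N)) (p : Euc N → ℝ), MeasurableSet s → ∫ x, p x * s.indicator (fun _ => (1:ℝ)) x = ∫ x in s, p x := by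
    intro s p hs
    rw [← integral_indicator hs]
    congr 1; ext x
    by_cases hx : x ∈ s <;> simp [hx]
  have hio : ∀ p : Euc N → ℝ, MemLp p 2 volume → ∀ s, MeasurableSet s → volume s < ⊤ → IntegrableOn p s volume := by
    intro p hp s hs hv
    have := hp.restrict s
    have _i : IsFiniteMeasure (volume.restrict s) := ⟨by simpa using hv⟩
    exact this.integrable (by norm_num)
  have hW2 : MemLp (W0 : Euc N → ℝ) 2 volume := Lp.memLp W0
  have h0 : 0 ≤ᵐ[volume] (W0 : Euc N → ℝ) := by
    refine ae_nonneg_of_forall_setIntegral_nonneg_of_sigmaFinite (hio _ hW2) fun s hs hv => ?_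
    have := hint _ (hind s hs hv)
    rw [hmi s _ hs] at this
    refine ge_of_tendsto' this fun n => integral_nonneg fun x => mul_nonneg (hwB n x).1 (indicator_nonneg (fun _ _ => zero_le_one) x)
  have h1 : 0 ≤ᵐ[volume] fun x => B x - W0 x := by
    refine ae_nonneg_of_forall_setIntegral_nonneg_of_sigmaFinite (fun s hs hv => (hio _ hB2 s hs hv).sub (hio _ hW2 s hs hv)) fun s hs hv => ?_
    rw [integral_sub (hio _ hB2 s hs hv) (hio _ hW2 s hs hv), sub_nonneg]
    have := hint _ (hind s hs hv)
    rw [hmi s _ hs] at this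
    refine le_of_tendsto' this fun n => ?_
    rw [hmi s _ hs]
    exact setIntegral_mono (hio _ (hw2 n) s hs hv) (hio _ hB2 s hs hv) fun x => (hwB n x).2
  have hB0 : ∀ x, 0 ≤ B x := fun x => (hwB 0 x).1.trans (hwB 0 x).2
  refine ⟨fun x => max 0 (min (W0 x) (B x)), measurable_const.max ((Lp.stronglyMeasurable W0).measurable.min hBm),
    fun x => ⟨le_max_left _ _, max_le (hB0 x) (min_le_right _ _)⟩, (hyperfilter ℕ : Filter ℕ), inferInstance, ?_, fun q hq => ?_⟩
  · rw [← Nat.cofinite_eq_atTop]; exact hyperfilter_le_cofinite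
  · have e : ∫ x, max 0 (min (W0 x) (B x)) * q x = ∫ x, W0 x * q x := by
      refine integral_congr_ae ?_
      filter_upwards [h0, h1] with x h0 h1
      have h1' : W0 x ≤ B x := by simpa using h1
      have h0' : 0 ≤ W0 x := h0
      rw [min_eq_left h1', max_eq_right h0']
    rw [e]; exact hint q hq

end


section
variable {N : ℕ} {K k : Euc N → ℝ}

lemma Rop_const (κ : Euc N → ℝ) (r m : ℝ) (x : Euc N) : Rop κ r (fun _ => m) x = m * (∫ z, κ z) / 2 * r^2 := by
  unfold Rop Mop
  simp_rw [integral_mul_const]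
  rw [intervalIntegral.integral_mul_const, integral_id]
  ring

lemma BM_const (m : ℝ) : BM (fun _ : Euc N => m) := ⟨measurable_const, |m|, fun _ => le_rfl⟩

lemma Rop_bd (hk : IsKer K k) {q : Euc N → ℝ} (hq : BM q) {D : ℝ} (hD : ∀ x, |q x| ≤ D) {r : ℝ} (hr : 0 < r) (x : Euc N) :
    |Rop K r q x| ≤ D * (∫ z, K z) / 2 * r^2 := by
  rw [abs_le]
  constructor
  · have := Rop_mono hk.contK hk.csK hk.K0 hk.Ks (BM_const (-D)) hq (x := x) hr fun y _ => (abs_le.1 (hD y)).1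
    rw [Rop_const] at this
    linarith
  · have := Rop_mono hk.contK hk.csK hk.K0 hk.Ks hq (BM_const D) (x := x) hr fun y _ => (abs_le.1 (hD y)).2
    rw [Rop_const] at this
    linarith

lemma Rop_unif (hk : IsKer K k) {q : Euc N → ℝ} (hq : Continuous q) (hqs : HasCompactSupport q) {η : ℝ} (hη : 0 < η) :
    ∃ ε0 > 0, ∀ ε, 0 < ε → ε < ε0 → ∀ x, |Rop K ε q x - (∫ z, K z) / 2 * ε^2 * q x| ≤ η * ((∫ z, K z) / 2 * ε^2) := by
  have huc := hqs.uniformContinuous_of_continuous hq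
  obtain ⟨ε0, h0, h1⟩ := Metric.uniformContinuous_iff.1 huc η hη
  refine ⟨ε0, h0, fun ε hε hεε x => ?_⟩
  have hqB := BM.of_cc hq hqs
  have hy : ∀ y ∈ ball x ε, |q y - q x| < η := fun y hy => h1 ((mem_ball.1 hy).trans hεε)
  have a1 := Rop_mono hk.contK hk.csK hk.K0 hk.Ks hqB (BM_const (q x + η)) (x := x) hε fun y h => by
    have := (abs_lt.1 (hy y h)).2; linarith
  have a2 := Rop_mono hk.contK hk.csK hk.K0 hk.Ks (BM_const (q x - η)) hqB (x := x) hε fun y h => by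
    have := (abs_lt.1 (hy y h)).1; linarith
  rw [Rop_const] at a1 a2
  rw [abs_le]; constructor <;> linarith

lemma lap_cs {φ : Euc N → ℝ} (hφ : ContDiff ℝ 2 φ) (hφs : HasCompactSupport φ) : Continuous (lap φ) ∧ HasCompactSupport (lap φ) := by
  refine ⟨continuous_iff_continuousAt.2 fun y => contAt_lap hφ.contDiffAt, ?_⟩
  refine HasCompactSupport.intro hφs.isCompact fun x hx => ?_
  rw [lap_eq hφ.contDiffAt]
  refine Finset.sum_eq_zero fun i _ => ?_
  exact Dd_zero_of_notMem fun h => hx (tsupport_Dd h)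

lemma weak_eq (hk : IsKer K k) {Ω : Set (Euc N)} (hΩ : IsOpen Ω) {w : ℕ → Euc N → ℝ} {B H W : Euc N → ℝ} {ε : ℕ → ℝ}
    (hB : BM B) (hBi : Integrable B) (hH : BM H) (hHi : Integrable H)
    (hw : ∀ n, Measurable (w n)) (hwB : ∀ n x, 0 ≤ w n x ∧ w n x ≤ B x) (hε : ∀ n, 0 < ε n) (hε0 : Tendsto ε atTop (𝓝 0))
    (hrep : ∀ n x, closedBall x (ε n) ⊆ Ω → w n x = Mop k (ε n) (w n) x + Rop K (ε n) H x)
    {U : Filter ℕ} [U.NeBot] (hU : U ≤ atTop)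
    (hUl : ∀ q : Euc N → ℝ, MemLp q 2 volume → Tendsto (fun n => ∫ x, w n x * q x) U (𝓝 (∫ x, W x * q x)))
    {φ : Euc N → ℝ} (hφ : ContDiff ℝ 2 φ) (hφs : HasCompactSupport φ) (hφΩ : tsupport φ ⊆ Ω) :
    ∫ x, W x * (- lap φ x) = ∫ x, φ x * H x := by
  set c := (∫ z, K z)/2 with hc
  have hc0 : 0 < c := half_pos hk.Ki
  obtain ⟨C, hC⟩ := hB.2
  have hwC : ∀ n x, |w n x| ≤ C := fun n x => by rw [abs_of_nonneg (hwB n x).1]; exact (hwB n x).2.trans ((le_abs_self _).trans (hC x))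
  have hwBM : ∀ n, BM (w n) := fun n => ⟨hw n, C, hwC n⟩
  have hwi : ∀ n, Integrable (w n) := fun n => hBi.mono (hw n).aestronglyMeasurable (Eventually.of_forall fun x => by
    rw [Real.norm_eq_abs, Real.norm_eq_abs, abs_of_nonneg (hwB n x).1]; exact (hwB n x).2.trans (le_abs_self _))
  obtain ⟨hlc, hls⟩ := lap_cs hφ hφs
  let q : Euc N → ℝ := fun x => - lap φ x
  have hqc : Continuous q := hlc.neg
  have hqs : HasCompactSupport q := hls.neg
  have hφc := hφ.continuous
  have hφB := BM.of_cc hφc hφs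
  have hqB := BM.of_cc hqc hqs
  have hq2 : MemLp q 2 volume := hqc.memLp_of_hasCompactSupport hqs
  obtain ⟨δ, hδ, hδΩ⟩ := hφs.isCompact.exists_cthickening_subset_open hΩ hφΩ
  have hRi : ∀ (p : Euc N → ℝ), BM p → ∀ r, 0 < r → ∀ f, Integrable f → Integrable (fun x => Rop K r p x * f x) := by
    intro p hp r hr f hf
    obtain ⟨D, hD⟩ := hp.2
    exact hf.bdd_mul (c := D * (∫ z, K z) / 2 * r^2) (Rop_C1 hk.c1c.cd hk.csK hp hr).continuous.aestronglyMeasurable (Eventually.of_forall fun x => Rop_bd hk hp hD hr x)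
  have hMi : ∀ (p : Euc N → ℝ), BM p → ∀ r, 0 < r → ∀ f, Integrable f → Integrable (fun x => Mop k r p x * f x) := by
    intro p hp r hr f hf
    obtain ⟨D, hD⟩ := hp.2
    exact hf.bdd_mul (c := (∫ z, |k z|) * D) (Mop_cont hk.contk hk.csk hp hr).aestronglyMeasurable (Eventually.of_forall fun x => Mop_bd hk.contk hk.csk hD x r)
  have hfi : Integrable φ := hφc.integrable_of_hasCompactSupport hφs
  have ident : ∀ n, ε n < δ → ∫ x, Rop K (ε n) q x * w n x = ∫ x, Rop K (ε n) φ x * H x := by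
    intro n hn
    have e1 : ∫ x, φ x * w n x = ∫ x, (φ x * Mop k (ε n) (w n) x + φ x * Rop K (ε n) H x) := by
      congr 1; ext x
      by_cases hx : x ∈ tsupport φ
      · rw [← mul_add, ← hrep n x]
        refine (closedBall_subset_cthickening hx _).trans (Subset.trans (cthickening_mono hn.le _) hδΩ)
      · simp [image_eq_zero_of_notMem_tsupport hx]
    have i1 : Integrable (fun x => φ x * Mop k (ε n) (w n) x) := by
      simpa [mul_comm] using hMi _ (hwBM n) _ (hε n) _ hfi
    have i2 : Integrable (fun x => φ x * Rop K (ε n) H x) := by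
      simpa [mul_comm] using hRi _ hH _ (hε n) _ hfi
    rw [integral_add i1 i2, Mop_symm hk.contk hk.csk hk.ke hφc hφs (hwBM n), Rop_symm hk.contK hk.csK hk.Ke hφc hφs hH (hε n)] at e1
    have e2 : ∫ x, φ x * w n x = ∫ x, (Mop k (ε n) φ x * w n x + Rop K (ε n) q x * w n x) := by
      congr 1; ext x
      rw [← add_mul]; congr 1
      exact mean_id hk hφ x
    rw [integral_add (hMi _ hφB _ (hε n) _ (hwi n)) (hRi _ hqB _ (hε n) _ (hwi n))] at e2
    linarith
  have approx : ∀ (p : Euc N → ℝ), Continuous p → HasCompactSupport p → ∀ η > 0, ∃ ε0 > 0, ∀ r, 0 < r → r < ε0 → ∀ f F, Integrable f → Integrable F → (∀ x, |f x| ≤ F x) →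
      |(∫ x, Rop K r p x * f x) - c * r^2 * ∫ x, p x * f x| ≤ η * (c * r^2) * ∫ x, F x := by
    intro p hp hps η hη
    obtain ⟨ε0, h0, h1⟩ := Rop_unif hk hp hps hη
    refine ⟨ε0, h0, fun r hr hr0 f F hf hF hfF => ?_⟩
    have hpB := BM.of_cc hp hps
    obtain ⟨D, hD⟩ := hpB.2
    have i2 : Integrable (fun x => p x * f x) := hf.bdd_mul (c := D) hp.aestronglyMeasurable (Eventually.of_forall hD)
    rw [← integral_const_mul, ← integral_sub (hRi p hpB r hr f hf) (i2.const_mul _), ← integral_const_mul, ← Real.norm_eq_abs]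
    refine norm_integral_le_of_norm_le (hF.const_mul _) (Eventually.of_forall fun x => ?_)
    have := h1 r hr hr0 x
    calc ‖Rop K r p x * f x - c * r^2 * (p x * f x)‖ = |Rop K r p x - c * r^2 * p x| * |f x| := by
          rw [Real.norm_eq_abs, ← abs_mul]; congr 1; ring
      _ ≤ (η * (c * r^2)) * F x := mul_le_mul this (hfF x) (abs_nonneg _) (by positivity)
  have hlim : Tendsto (fun n => ∫ x, w n x * q x) atTop (𝓝 (∫ x, φ x * H x)) := by
    rw [Metric.tendsto_atTop]
    intro e he
    set S := (∫ x, B x) + ∫ x, |H x| with hS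
    have hB0 : ∀ x, 0 ≤ B x := fun x => (hwB 0 x).1.trans (hwB 0 x).2
    have hS0 : 0 ≤ S := add_nonneg (integral_nonneg hB0) (integral_nonneg fun x => abs_nonneg _)
    have hη : 0 < e / (S + 1) := by positivity
    obtain ⟨e1, he1, h1⟩ := approx q hqc hqs _ hη
    obtain ⟨e2, he2, h2⟩ := approx φ hφc hφs _ hη
    have hev : ∀ᶠ n in atTop, ε n < min δ (min e1 e2) := hε0.eventually (gt_mem_nhds (by positivity))
    obtain ⟨n0, hn0⟩ := eventually_atTop.1 hev
    refine ⟨n0, fun n hn => ?_⟩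
    have hlt := hn0 n hn
    have hlt1 := (lt_min_iff.1 hlt).1
    have hlt2 := (lt_min_iff.1 (lt_min_iff.1 hlt).2)
    have a1 := h1 (ε n) (hε n) hlt2.1 (w n) B (hwi n) hBi fun x => by rw [abs_of_nonneg (hwB n x).1]; exact (hwB n x).2
    have a2 := h2 (ε n) (hε n) hlt2.2 H (fun x => |H x|) hHi hHi.abs fun x => le_rfl
    rw [ident n hlt1] at a1
    rw [Real.dist_eq]
    have ec : ∫ x, w n x * q x = ∫ x, q x * w n x := by simp_rw [mul_comm]
    rw [ec]
    have hcε : 0 < c * ε n ^2 := by have := hε n; positivity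
    have a3 : c * ε n ^ 2 * |(∫ x, q x * w n x) - ∫ x, φ x * H x| ≤ (c * ε n ^ 2) * (e / (S+1) * S) := by
      calc c * ε n ^ 2 * |(∫ x, q x * w n x) - ∫ x, φ x * H x| = |c * ε n^2 * (∫ x, q x * w n x) - c * ε n ^2 * ∫ x, φ x * H x| := by
            rw [← mul_sub, abs_mul, abs_of_pos hcε]
        _ ≤ _ := by
          rw [abs_le] at a1 a2 ⊢
          rw [hS]
          constructor <;> nlinarith [a1.1, a1.2, a2.1, a2.2]
    have a4 := le_of_mul_le_mul_left a3 hcε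
    refine a4.trans_lt ?_
    rw [div_mul_eq_mul_div, div_lt_iff₀ (by positivity)]
    nlinarith
  exact tendsto_nhds_unique (hUl q hq2) (hlim.mono_left hU)

end

section
open scoped ContDiff

section
variable {N : ℕ} {K k : Euc N → ℝ}

lemma Rop_lap (hk : IsKer K k) {φ : Euc N → ℝ} (hφ : ContDiff ℝ 2 φ) (hφs : HasCompactSupport φ) {r : ℝ} (hr : 0 < r) (x : Euc N) :
    - lap (Rop K r φ) x = φ x - Mop k r φ x := by
  have hφ1 : ContDiff ℝ 1 φ := hφ.of_le (by norm_num)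
  have hC2 := Rop_C2 hk.c1c.cd hk.csK hφ1 hφs hr
  have hD1 : ∀ i, ContDiff ℝ 1 (Dd i φ) := fun i => contDiff_iff_contDiffAt.2 fun y => contDiffAt_Dd hφ.contDiffAt
  have hDs : ∀ i, HasCompactSupport (Dd i φ) := fun i => hφs.of_isClosed_subset (isClosed_tsupport _) tsupport_Dd
  have hDDc : ∀ i, Continuous (Dd i (Dd i φ)) := fun i => continuous_iff_continuousAt.2 fun y => contAt_Dd (hD1 i).contDiffAt
  have hDDs : ∀ i, HasCompactSupport (Dd i (Dd i φ)) := fun i => (hDs i).of_isClosed_subset (isClosed_tsupport _) tsupport_Dd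
  have e1 : ∀ i, Dd i (Rop K r φ) = Rop K r (Dd i φ) := fun i => Rop_fd hk.c1c.cd hk.csK hφ1 hφs hr (ee i)
  have e2 : ∀ i, Dd i (Rop K r (Dd i φ)) = Rop K r (Dd i (Dd i φ)) := fun i => Rop_fd hk.c1c.cd hk.csK (hD1 i) (hDs i) hr (ee i)
  have hBM : ∀ i, BM (Dd i (Dd i φ)) := fun i => BM.of_cc (hDDc i) (hDDs i)
  rw [lap_eq hC2.contDiffAt]
  simp_rw [e1, e2]
  have h3 : φ x = Mop k r φ x + Rop K r (fun y => - lap φ y) x := mean_id hk hφ x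
  have h4 : Rop K r (fun y => - lap φ y) x = - ∑ i, Rop K r (Dd i (Dd i φ)) x := by
    unfold Rop
    rw [← intervalIntegral.integral_finsetSum fun i _ => Rop_ii hk.contK hk.csK (hBM i) x 0 r, ← intervalIntegral.integral_neg]
    congr 1; ext s
    rw [← Finset.mul_sum, ← mul_neg]
    congr 1
    unfold Mop
    rw [← integral_finsetSum _ fun i _ => Mop_int hk.contK hk.csK (hBM i) x s, ← integral_neg]
    congr 1; ext z
    change K z * (- lap φ (x + s • z)) = _
    rw [lap_eq hφ.contDiffAt, ← Finset.mul_sum]; ring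
  linarith

lemma ae_rep (hk : IsKer K k) {Ω : Set (Euc N)} (hΩ : IsOpen Ω) {H W : Euc N → ℝ} 
    (hH : BM H) (hHi : Integrable H) (hW : BM W) (hWi : Integrable W)
    (hweak : ∀ φ : Euc N → ℝ, ContDiff ℝ 2 φ → HasCompactSupport φ → tsupport φ ⊆ Ω → ∫ x, W x * (- lap φ x) = ∫ x, φ x * H x)
    {r : ℝ} (hr : 0 < r) : ∀ᵐ x, x ∈ Oin Ω r → W x = Mop k r W x + Rop K r H x := by
  have hMc := Mop_cont hk.contk hk.csk hW hr
  have hRc := (Rop_C1 hk.c1c.cd hk.csK hH hr).continuous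
  have key := (Oin_open Ω r).ae_eq_zero_of_integral_contDiff_smul_eq_zero (μ := volume) (f := fun x => W x - (Mop k r W x + Rop K r H x))
    ((hWi.locallyIntegrable.sub (hMc.add hRc).locallyIntegrable).locallyIntegrableOn _) ?_
  · filter_upwards [key] with x hx h
    linarith [hx h]
  intro φ hφ hφs hφΩ
  have hφ2 : ContDiff ℝ 2 φ := contDiff_infty.1 hφ 2
  have hφc := hφ.continuous
  have hφi : Integrable φ volume := hφc.integrable_of_hasCompactSupport hφs
  have hφB := BM.of_cc hφc hφs
  have hcomp : IsCompact (cthickening r (tsupport φ)) := hφs.isCompact.cthickening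
  have hz : ∀ x ∉ cthickening r (tsupport φ), Rop K r φ x = 0 := by
    intro x hx
    have : Rop K r φ x = Rop K r (fun _ => 0) x := Rop_congr hk.Ks hr fun y hy => by
      apply image_eq_zero_of_notMem_tsupport
      intro h
      exact hx (closedBall_subset_cthickening h r (by rw [mem_closedBall, dist_comm]; exact (mem_ball.1 hy).le))
    rw [this, Rop_const]; ring
  have hsub : cthickening r (tsupport φ) ⊆ Ω := by
    rw [hφs.isCompact.cthickening_eq_biUnion_closedBall hr.le]
    exact iUnion₂_subset fun x hx => (mem_Oin hΩ hr.le).1 (hφΩ hx)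
  have hts : tsupport (Rop K r φ) ⊆ cthickening r (tsupport φ) :=
    closure_minimal (fun x hx => by by_contra h; exact hx (hz x h)) isClosed_cthickening
  have h1 := hweak (Rop K r φ) (Rop_C2 hk.c1c.cd hk.csK (hφ2.of_le (by norm_num)) hφs hr) (HasCompactSupport.intro hcomp hz) (hts.trans hsub)
  simp_rw [Rop_lap hk hφ2 hφs hr, mul_sub] at h1
  obtain ⟨C, hC⟩ := hW.2
  have i1 : Integrable (fun x => φ x * W x) := hφi.mul_bdd (c := C) hW.1.aestronglyMeasurable (Eventually.of_forall hC)
  have i2 : Integrable (fun x => φ x * Mop k r W x) := hφi.mul_bdd (c := (∫ z, |k z|) * C) hMc.aestronglyMeasurable (Eventually.of_forall fun x => Mop_bd hk.contk hk.csk hC x r)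
  obtain ⟨D, hD⟩ := hH.2
  have i3 : Integrable (fun x => φ x * Rop K r H x) := hφi.mul_bdd (c := D * (∫ z, K z) / 2 * r^2) hRc.aestronglyMeasurable (Eventually.of_forall fun x => Rop_bd hk hH hD hr x)
  obtain ⟨E, hE⟩ := hφB.2
  have i4 : Integrable (fun x => W x * Mop k r φ x) := hWi.mul_bdd (c := (∫ z, |k z|) * E) (Mop_cont hk.contk hk.csk hφB hr).aestronglyMeasurable (Eventually.of_forall fun x => Mop_bd hk.contk hk.csk hE x r)
  rw [integral_sub (by simpa [mul_comm] using i1) i4, ← Rop_symm hk.contK hk.csK hk.Ke hφc hφs hH hr] at h1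
  have h2 := Mop_symm hk.contk hk.csk hk.ke hφc hφs hW r
  simp only [smul_eq_mul, mul_sub, mul_add]
  have i5 : Integrable (fun x => φ x * Mop k r W x + φ x * Rop K r H x) := i2.add i3
  rw [integral_sub i1 i5, integral_add i2 i3, h2]
  simp_rw [mul_comm (W _)] at h1
  linarith

lemma le_of_ae_le_cont {Ω : Set (Euc N)} (hΩ : IsOpen Ω) {f g : Euc N → ℝ} (hf : ContinuousOn f Ω) (hg : ContinuousOn g Ω)
    (h : ∀ᵐ x, x ∈ Ω → f x ≤ g x) : ∀ x ∈ Ω, f x ≤ g x := by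
  have ho : IsOpen (Ω ∩ (fun x => f x - g x) ⁻¹' Ioi 0) := (hf.sub hg).isOpen_inter_preimage hΩ isOpen_Ioi
  have h0 : volume (Ω ∩ (fun x => f x - g x) ⁻¹' Ioi 0) = 0 := by
    refine measure_mono_null (fun x hx => ?_) (ae_iff.1 h)
    have := hx.2
    simp only [mem_preimage, mem_Ioi] at this
    simp only [mem_ofPred_eq, Classical.not_imp, not_le]
    exact ⟨hx.1, by linarith⟩
  have he := ho.measure_eq_zero_iff volume |>.1 h0
  intro x hx
  by_contra hlt
  push Not at hlt
  have : x ∈ Ω ∩ (fun x => f x - g x) ⁻¹' Ioi 0 := ⟨hx, by simpa using hlt⟩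
  rw [he] at this; exact this

lemma solve {Ω : Set (Euc N)} (hΩ : IsOpen Ω) (hbd : Bornology.IsBounded Ω) {b h : Euc N → ℝ} (hb : ContDiffOn ℝ 2 b Ω) {C : ℝ}
    (hb0 : ∀ x ∈ Ω, 0 ≤ b x ∧ b x ≤ C) (hh : ContDiffOn ℝ 1 h Ω) (hh0 : ∀ x ∈ Ω, 0 ≤ h x ∧ h x ≤ C)
    (hhb : ∀ x ∈ Ω, h x ≤ - lap b x) :
    ∃ w : Euc N → ℝ, ContDiffOn ℝ 2 w Ω ∧ (∀ x ∈ Ω, - lap w x = h x) ∧ (∀ x ∈ Ω, 0 ≤ w x ∧ w x ≤ b x) ∧ ∀ x ∉ Ω, w x = 0 := by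
  obtain ⟨K, k, hk⟩ := exists_ker (N := N)
  set B := Ω.indicator b
  set H := Ω.indicator h
  have hfin : volume Ω ≠ ⊤ := hbd.measure_lt_top.ne
  have habs : ∀ f : Euc N → ℝ, (∀ x ∈ Ω, 0 ≤ f x ∧ f x ≤ C) → ∀ x ∈ Ω, |f x| ≤ |C| := fun f hf x hx => by
    rw [abs_of_nonneg (hf x hx).1]; exact (hf x hx).2.trans (le_abs_self _)
  have hB : BM B := BM_ind hΩ.measurableSet hb.continuousOn (abs_nonneg C) (habs b hb0)
  have hH : BM H := BM_ind hΩ.measurableSet hh.continuousOn (abs_nonneg C) (habs h hh0)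
  have hind : ∀ f : Euc N → ℝ, BM (Ω.indicator f) → ∀ p : ENNReal, MemLp (Ω.indicator f) p volume := by
    intro f hf p
    obtain ⟨D, hD⟩ := hf.2
    have := memLp_indicator_const (μ := (volume : Measure (Euc N))) p hΩ.measurableSet D (Or.inr hfin)
    refine this.mono hf.1.aestronglyMeasurable (Eventually.of_forall fun x => ?_)
    by_cases hx : x ∈ Ω
    · have := hD x
      rw [indicator_of_mem hx] at this ⊢
      rw [indicator_of_mem hx]; exact this.trans (le_abs_self _)
    · simp [hx]
  have hBi : Integrable B := memLp_one_iff_integrable.1 (hind b hB 1)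
  have hHi : Integrable H := memLp_one_iff_integrable.1 (hind h hH 1)
  have hεp : ∀ n : ℕ, (0:ℝ) < 1 / ((n:ℝ) + 1) := fun n => by positivity
  choose w hwm hwB hrep using fun n : ℕ => eps_sol hk hΩ hb (fun x hx => (hb0 x hx).1) hB hH (fun x hx => (hh0 x hx).1) hhb (hεp n)
  obtain ⟨W, hWm, hWB, U, hUn, hU, hUl⟩ := weak_lim (hind b hB 2) hB.1 hwm hwB
  have hWBM : BM W := by
    obtain ⟨D, hD⟩ := hB.2
    exact ⟨hWm, D, fun x => by rw [abs_of_nonneg (hWB x).1]; exact (hWB x).2.trans ((le_abs_self _).trans (hD x))⟩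
  have hWi : Integrable W := hBi.mono hWm.aestronglyMeasurable (Eventually.of_forall fun x => by
    rw [Real.norm_eq_abs, Real.norm_eq_abs, abs_of_nonneg (hWB x).1]; exact (hWB x).2.trans (le_abs_self _))
  have hae : ∀ r, 0 < r → ∀ᵐ x, x ∈ Oin Ω r → W x = Mop k r W x + Rop K r H x := fun r hr =>
    ae_rep hk hΩ hH hHi hWBM hWi (fun φ h1 h2 h3 => weak_eq hk hΩ hB hBi hH hHi hwm hwB hεp tendsto_one_div_add_atTop_nhds_zero_nat hrep hU hUl h1 h2 h3) hr
  let F : ℝ → Euc N → ℝ := fun r x => Mop k r W x + Rop K r H x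
  have hFc : ∀ r, 0 < r → Continuous (F r) := fun r hr => (Mop_cont hk.contk hk.csk hWBM hr).add (Rop_C1 hk.c1c.cd hk.csK hH hr).continuous
  have hFle : ∀ r s, 0 < r → 0 < s → ∀ x, closedBall x r ⊆ Ω → closedBall x s ⊆ Ω → F r x ≤ F s x := by
    intro r s hr hs x hxr hxs
    refine le_of_ae_le_cont ((Oin_open Ω r).inter (Oin_open Ω s)) (hFc r hr).continuousOn (hFc s hs).continuousOn ?_ x ⟨(mem_Oin hΩ hr.le).2 hxr, (mem_Oin hΩ hs.le).2 hxs⟩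
    filter_upwards [hae r hr, hae s hs] with y h1 h2 hy
    exact ((h1 hy.1).symm.trans (h2 hy.2)).le
  have hex : ∀ x : Euc N, ∃ r : ℝ, 0 < r ∧ (x ∈ Ω → closedBall x r ⊆ Ω) := by
    intro x
    by_cases hx : x ∈ Ω
    · obtain ⟨r, hr, hsub⟩ := nhds_basis_closedBall.mem_iff.1 (hΩ.mem_nhds hx)
      exact ⟨r, hr, fun _ => hsub⟩
    · exact ⟨1, one_pos, fun h => (hx h).elim⟩
  choose ρ hρ hρΩ using hex
  let W' : Euc N → ℝ := Ω.indicator fun x => F (ρ x) x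
  have hW'F : ∀ x r, 0 < r → closedBall x r ⊆ Ω → W' x = F r x := by
    intro x r hr hx
    have hxΩ := hx (mem_closedBall_self hr.le)
    simp only [W', indicator_of_mem hxΩ]
    exact le_antisymm (hFle _ _ (hρ x) hr x (hρΩ x hxΩ) hx) (hFle _ _ hr (hρ x) x hx (hρΩ x hxΩ))
  have hW'c : ContinuousOn W' Ω := by
    intro x hx
    have hmem : Oin Ω (ρ x) ∈ 𝓝 x := (Oin_open _ _).mem_nhds ((mem_Oin hΩ (hρ x).le).2 (hρΩ x hx))
    refine ((hFc (ρ x) (hρ x)).continuousAt.congr ?_).continuousWithinAt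
    filter_upwards [hmem] with y hy
    exact (hW'F y _ (hρ x) ((mem_Oin hΩ (hρ x).le).1 hy)).symm
  have haeW : ∀ᵐ x, W' x = W x := by
    have hall : ∀ᵐ x, ∀ n : ℕ, x ∈ Oin Ω (1 / ((n:ℝ)+1)) → W x = F (1 / ((n:ℝ)+1)) x := ae_all_iff.2 fun n => hae _ (hεp n)
    filter_upwards [hall] with x hx
    by_cases hxΩ : x ∈ Ω
    · obtain ⟨n, hn⟩ := exists_nat_one_div_lt (hρ x)
      have hsub := (closedBall_subset_closedBall hn.le).trans (hρΩ x hxΩ)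
      rw [hx n ((mem_Oin hΩ (hεp n).le).2 hsub), hW'F x _ (hεp n) hsub]
    · have := hWB x
      simp only [indicator_of_notMem hxΩ] at this
      simp only [W', indicator_of_notMem hxΩ]
      linarith
  have hW'b : ∀ x ∈ Ω, 0 ≤ W' x ∧ W' x ≤ b x := by
    have h1 := le_of_ae_le_cont hΩ continuousOn_const hW'c (f := fun _ => 0) (by filter_upwards [haeW] with x hx _; rw [hx]; exact (hWB x).1)
    have h2 := le_of_ae_le_cont hΩ hW'c hb.continuousOn (by
      filter_upwards [haeW] with x hx hxΩ
      rw [hx]; have := (hWB x).2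
      simp only [indicator_of_mem hxΩ] at this; exact this)
    exact fun x hx => ⟨h1 x hx, h2 x hx⟩
  have hreg := reg_of_rep hk hΩ (w' := W') (H := h) (BM_ind hΩ.measurableSet hW'c (abs_nonneg C) fun x hx => by
      rw [abs_of_nonneg (hW'b x hx).1]; exact (hW'b x hx).2.trans ((hb0 x hx).2.trans (le_abs_self _))) hH (by
    intro x r hr hx
    rw [hW'F x r hr hx]
    simp only [F]
    congr 1
    · obtain ⟨D, hD⟩ := hWBM.2
      have := Mop_lim hk.contk hk.csk (w := fun _ => W) (W := W') (fun _ => hWBM) (fun _ => hD) (by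
        filter_upwards [haeW] with y hy; rw [hy]; exact tendsto_const_nhds) hr x
      exact tendsto_nhds_unique tendsto_const_nhds this
    · exact Rop_congr hk.Ks hr fun y hy => indicator_of_mem (hx (ball_subset_closedBall hy)) _)
  have := hreg.2 hh
  exact ⟨W', this.1, this.2, hW'b, fun x hx => indicator_of_notMem hx _⟩

end
end


section
variable {N : ℕ}

lemma lemC' {V : Set (Euc N)} (hV : IsOpen V) {w h : ℕ → Euc N → ℝ} {W H : Euc N → ℝ} {C : ℝ}
    (hw : ∀ j, ContDiffOn ℝ 2 (w j) V) (heq : ∀ j, ∀ x ∈ V, - lap (w j) x = h j x)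
    (hwb : ∀ j, ∀ x ∈ V, |w j x| ≤ C) (hhb : ∀ j, ∀ x ∈ V, |h j x| ≤ C)
    (hl : ∀ y ∈ V, Tendsto (fun j => w j y) atTop (𝓝 (W y)))
    (hh : ∀ x ∈ V, Tendsto (fun j => h j x) atTop (𝓝 (H x))) :
    ContDiffOn ℝ 1 W V ∧
      (ContDiffOn ℝ 1 H V → ContDiffOn ℝ 2 W V ∧ ∀ x ∈ V, - lap W x = H x) := by
  obtain ⟨w', h1, h2, h3⟩ := lemC hV hw heq hwb hhb (Eventually.of_forall hl) hh
  have e : ∀ x ∈ V, W x = w' x := fun x hx => tendsto_nhds_unique (hl x hx) (h1 x hx)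
  refine ⟨h2.congr e, fun hH => ?_⟩
  obtain ⟨h4, h5⟩ := h3 hH
  refine ⟨h4.congr e, fun x hx => ?_⟩
  rw [lap_congr (h4.contDiffAt (hV.mem_nhds hx)) (eventually_of_mem (hV.mem_nhds hx) e)]
  exact h5 x hx

lemma inv_sq_bd {δ t : ℝ} (hδ : 0 < δ) (ht : t ≤ 1 - δ) : 1 / (1 - t)^2 ≤ 1 / δ^2 :=
  one_div_le_one_div_of_le (by positivity) (by gcongr; linarith)

lemma contDiffOn_rhs {n : WithTop ℕ∞} {V : Set (Euc N)} {v : Euc N → ℝ} (lam : ℝ) (hv : ContDiffOn ℝ n v V) (h1 : ∀ x ∈ V, v x < 1) :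
    ContDiffOn ℝ n (fun x => lam / (1 - v x)^2) V :=
  contDiffOn_const.div ((contDiffOn_const.sub hv).pow 2) fun x hx => by
    have := h1 x hx
    have : 0 < 1 - v x := by linarith
    positivity

lemma half_sys {V : Set (Euc N)} (hV : IsOpen V) {lam : ℕ → ℝ} {w z : ℕ → Euc N → ℝ} {δ L l : ℝ} {u v : Euc N → ℝ}
    (hδ : 0 < δ) (hl : Tendsto lam atTop (𝓝 l)) (hL : ∀ j, |lam j| ≤ L)
    (hw : ∀ j, ContDiffOn ℝ 2 (w j) V) (hwb : ∀ j, ∀ x ∈ V, 0 ≤ w j x ∧ w j x ≤ 1 - δ) (hzb : ∀ j, ∀ x ∈ V, 0 ≤ z j x ∧ z j x ≤ 1 - δ)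
    (heq : ∀ j, ∀ x ∈ V, - lap (w j) x = lam j / (1 - z j x)^2)
    (hwu : ∀ x ∈ V, Tendsto (fun j => w j x) atTop (𝓝 (u x))) (hzv : ∀ x ∈ V, Tendsto (fun j => z j x) atTop (𝓝 (v x))) :
    ContDiffOn ℝ 1 u V ∧ (ContDiffOn ℝ 1 v V → ContDiffOn ℝ 2 u V ∧ ∀ x ∈ V, - lap u x = l / (1 - v x)^2) := by
  have hvb : ∀ x ∈ V, v x ≤ 1 - δ := fun x hx => le_of_tendsto' (hzv x hx) fun j => (hzb j x hx).2
  have hL0 : 0 ≤ L := (abs_nonneg _).trans (hL 0)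
  have h := lemC' hV (C := max 1 (L * (1 / δ^2))) (w := w) (h := fun j x => lam j / (1 - z j x)^2) (W := u) (H := fun x => l / (1 - v x)^2) hw heq
    (fun j x hx => by
      rw [abs_of_nonneg (hwb j x hx).1]; exact le_max_of_le_left (by linarith [(hwb j x hx).2]))
    (fun j x hx => by
      refine le_max_of_le_right ?_
      rw [div_eq_mul_one_div, abs_mul, abs_of_nonneg (show 0 ≤ 1 / (1 - z j x)^2 by positivity)]
      exact mul_le_mul (hL j) (inv_sq_bd hδ (hzb j x hx).2) (by positivity) hL0)
    hwu (fun x hx => hl.div ((tendsto_const_nhds.sub (hzv x hx)).pow 2) (by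
      have := hvb x hx
      have : 0 < 1 - v x := by linarith
      positivity))
  exact ⟨h.1, fun hv => h.2 (contDiffOn_rhs l hv fun x hx => by linarith [hvb x hx])⟩

lemma cont_closure {Ω : Set (Euc N)} (hΩ : IsOpen Ω) {w b : Euc N → ℝ} (hw : ContinuousOn w Ω) (hwb : ∀ x ∈ Ω, 0 ≤ w x ∧ w x ≤ b x)
    (hw0 : ∀ x ∈ frontier Ω, w x = 0) (hb : ContinuousOn b (closure Ω)) (hb0 : ∀ x ∈ frontier Ω, b x = 0) :
    ContinuousOn w (closure Ω) := by
  intro x hx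
  by_cases hxΩ : x ∈ Ω
  · exact (hw.continuousAt (hΩ.mem_nhds hxΩ)).continuousWithinAt
  have hxf : x ∈ frontier Ω := by rw [frontier, hΩ.interior_eq]; exact ⟨hx, hxΩ⟩
  have hbx := hb x hx
  rw [ContinuousWithinAt, hb0 x hxf] at hbx
  rw [ContinuousWithinAt, hw0 x hxf]
  have hall : ∀ y ∈ closure Ω, 0 ≤ w y ∧ w y ≤ b y := by
    intro y hy
    by_cases hyΩ : y ∈ Ω
    · exact hwb y hyΩ
    · have hyf : y ∈ frontier Ω := by rw [frontier, hΩ.interior_eq]; exact ⟨hy, hyΩ⟩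
      rw [hw0 y hyf, hb0 y hyf]; simp
  refine tendsto_of_tendsto_of_tendsto_of_le_of_le' tendsto_const_nhds hbx ?_ ?_
  · exact eventually_of_mem self_mem_nhdsWithin fun y hy => (hall y hy).1
  · exact eventually_of_mem self_mem_nhdsWithin fun y hy => (hall y hy).2

lemma bd_lt_one {Ω : Set (Euc N)} (hΩ : IsOpen Ω) (hbd : Bornology.IsBounded Ω) {u : Euc N → ℝ} (hu : ContinuousOn u (closure Ω))
    (h1 : ∀ x ∈ Ω, u x < 1) (h0 : ∀ x ∈ frontier Ω, u x = 0) : ∃ δ > 0, ∀ x ∈ Ω, u x ≤ 1 - δ := by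
  by_cases hne : (closure Ω).Nonempty
  · obtain ⟨x0, hx0, hm⟩ := (hbd.isCompact_closure).exists_isMaxOn hne hu
    have : u x0 < 1 := by
      by_cases hxΩ : x0 ∈ Ω
      · exact h1 _ hxΩ
      · rw [h0 x0 (by rw [frontier, hΩ.interior_eq]; exact ⟨hx0, hxΩ⟩)]; exact one_pos
    exact ⟨1 - u x0, by linarith, fun x hx => by have : u x ≤ u x0 := hm (subset_closure hx); linarith⟩
  · exact ⟨1, one_pos, fun x hx => (hne ⟨x, subset_closure hx⟩).elim⟩

structure Iter (Ω : Set (Euc N)) (lam mu : ℝ) (u v : Euc N → ℝ) (δ : ℝ) (U V : ℕ → Euc N → ℝ) : Prop where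
  cu : ∀ n, ContDiffOn ℝ 2 (U n) Ω
  cv : ∀ n, ContDiffOn ℝ 2 (V n) Ω
  ru : ∀ n, ∀ x ∈ Ω, 0 ≤ U n x ∧ U n x ≤ u x
  rv : ∀ n, ∀ x ∈ Ω, 0 ≤ V n x ∧ V n x ≤ v x
  bu : ∀ x ∈ Ω, u x ≤ 1 - δ
  bv : ∀ x ∈ Ω, v x ≤ 1 - δ
  d0 : 0 < δ
  eu : ∀ n, ∀ x ∈ Ω, - lap (U (n+1)) x = lam / (1 - V n x)^2
  ev : ∀ n, ∀ x ∈ Ω, - lap (V (n+1)) x = mu / (1 - U n x)^2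
  mu' : ∀ n, ∀ x ∈ Ω, U n x < U (n+1) x
  mv' : ∀ n, ∀ x ∈ Ω, V n x < V (n+1) x
  lu : ∀ x ∈ Ω, Tendsto (fun n => U n x) atTop (𝓝 (u x))
  lv : ∀ x ∈ Ω, Tendsto (fun n => V n x) atTop (𝓝 (v x))

lemma exists_iter {Ω : Set (Euc N)} (hΩ : IsOpen Ω) (hbd : Bornology.IsBounded Ω) {lam mu : ℝ} (hlam : 0 < lam) (hmu : 0 < mu)
    {u v : Euc N → ℝ} (hmin : IsMinimalSolution Ω (fun _ => (1:ℝ)) (fun _ => (1:ℝ)) lam mu u v) :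
    ∃ δ U V, Iter Ω lam mu u v δ U V := by
  obtain ⟨hs, hm⟩ := hmin
  obtain ⟨δ1, hδ1, hu1⟩ := bd_lt_one hΩ hbd hs.cont_u (fun x hx => (hs.range_u x hx).2) hs.bdry_u
  obtain ⟨δ2, hδ2, hv1⟩ := bd_lt_one hΩ hbd hs.cont_v (fun x hx => (hs.range_v x hx).2) hs.bdry_v
  set δ := min δ1 δ2
  have hδ : 0 < δ := lt_min hδ1 hδ2
  have hu : ∀ x ∈ Ω, u x ≤ 1 - δ := fun x hx => (hu1 x hx).trans (by linarith [min_le_left δ1 δ2])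
  have hv : ∀ x ∈ Ω, v x ≤ 1 - δ := fun x hx => (hv1 x hx).trans (by linarith [min_le_right δ1 δ2])
  have half : ∀ (l : ℝ), 0 < l → ∀ u v : Euc N → ℝ, ContDiffOn ℝ 2 u Ω → (∀ x ∈ Ω, 0 ≤ u x ∧ u x < 1) → (∀ x ∈ Ω, v x ≤ 1 - δ) →
      (∀ x ∈ Ω, - lap u x = l / (1 - v x)^2) → ∀ v' : Euc N → ℝ, ContDiffOn ℝ 2 v' Ω → (∀ x ∈ Ω, 0 ≤ v' x ∧ v' x ≤ v x) →
      ∃ w : Euc N → ℝ, ContDiffOn ℝ 2 w Ω ∧ (∀ x ∈ Ω, - lap w x = l / (1 - v' x)^2) ∧ (∀ x ∈ Ω, 0 ≤ w x ∧ w x ≤ u x) ∧ ∀ x ∉ Ω, w x = 0 := by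
    intro l hl u v hu hur hv heq v' hv' hvr
    have hp : ∀ x ∈ Ω, 0 < 1 - v' x := fun x hx => by linarith [hv x hx, (hvr x hx).2]
    refine solve hΩ hbd hu (C := max 1 (l * (1 / δ^2))) (fun x hx => ⟨(hur x hx).1, le_max_of_le_left (hur x hx).2.le⟩)
      (contDiffOn_rhs l (hv'.of_le (by norm_num)) fun x hx => by linarith [hp x hx]) (fun x hx => ?_) fun x hx => ?_
    · have := hp x hx
      refine ⟨by positivity, le_max_of_le_right ?_⟩
      rw [div_eq_mul_one_div]
      exact mul_le_mul_of_nonneg_left (inv_sq_bd hδ ((hvr x hx).2.trans (hv x hx))) hl.le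
    · rw [heq x hx]
      have := hv x hx
      have h1 : 0 < 1 - v x := by linarith
      exact div_le_div_of_nonneg_left hl.le (by positivity) (pow_le_pow_left₀ h1.le (by linarith [(hvr x hx).2]) 2)
  let S := {p : (Euc N → ℝ) × (Euc N → ℝ) // (ContDiffOn ℝ 2 p.1 Ω ∧ (∀ x ∈ Ω, 0 ≤ p.1 x ∧ p.1 x ≤ u x) ∧ ∀ x ∉ Ω, p.1 x = 0) ∧
    (ContDiffOn ℝ 2 p.2 Ω ∧ (∀ x ∈ Ω, 0 ≤ p.2 x ∧ p.2 x ≤ v x) ∧ ∀ x ∉ Ω, p.2 x = 0)}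
  have heu : ∀ x ∈ Ω, - lap u x = lam / (1 - v x)^2 := fun x hx => by rw [hs.eq_u x hx, mul_one]
  have hev : ∀ x ∈ Ω, - lap v x = mu / (1 - u x)^2 := fun x hx => by rw [hs.eq_v x hx, mul_one]
  have step : ∀ p : S, ∃ q : S, (∀ x ∈ Ω, - lap q.1.1 x = lam / (1 - p.1.2 x)^2) ∧ (∀ x ∈ Ω, - lap q.1.2 x = mu / (1 - p.1.1 x)^2) := by
    rintro ⟨⟨a, b⟩, ⟨ha1, ha2, ha3⟩, ⟨hb1, hb2, hb3⟩⟩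
    obtain ⟨w, w1, w2, w3, w4⟩ := half lam hlam u v hs.smooth_u hs.range_u hv heu b hb1 hb2
    obtain ⟨z, z1, z2, z3, z4⟩ := half mu hmu v u hs.smooth_v hs.range_v hu hev a ha1 ha2
    exact ⟨⟨(w, z), ⟨w1, w3, w4⟩, ⟨z1, z3, z4⟩⟩, w2, z2⟩
  choose nxt hn1 hn2 using step
  let p0 : S := ⟨(fun _ => 0, fun _ => 0), ⟨contDiffOn_const, fun x hx => ⟨le_rfl, (hs.range_u x hx).1⟩, fun _ _ => rfl⟩,
    ⟨contDiffOn_const, fun x hx => ⟨le_rfl, (hs.range_v x hx).1⟩, fun _ _ => rfl⟩⟩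
  let P : ℕ → S := fun n => nxt^[n] p0
  have hPS : ∀ n, P (n+1) = nxt (P n) := fun n => Function.iterate_succ_apply' _ _ _
  let U : ℕ → Euc N → ℝ := fun n => (P n).1.1
  let V : ℕ → Euc N → ℝ := fun n => (P n).1.2
  have cu : ∀ n, ContDiffOn ℝ 2 (U n) Ω := fun n => (P n).2.1.1
  have cv : ∀ n, ContDiffOn ℝ 2 (V n) Ω := fun n => (P n).2.2.1
  have ru : ∀ n, ∀ x ∈ Ω, 0 ≤ U n x ∧ U n x ≤ u x := fun n => (P n).2.1.2.1
  have rv : ∀ n, ∀ x ∈ Ω, 0 ≤ V n x ∧ V n x ≤ v x := fun n => (P n).2.2.2.1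
  have eu : ∀ n, ∀ x ∈ Ω, - lap (U (n+1)) x = lam / (1 - V n x)^2 := fun n x hx => by
    simp only [U, hPS]; exact hn1 (P n) x hx
  have ev : ∀ n, ∀ x ∈ Ω, - lap (V (n+1)) x = mu / (1 - U n x)^2 := fun n x hx => by
    simp only [V, hPS]; exact hn2 (P n) x hx
  have hfr : ∀ x ∈ frontier Ω, x ∉ Ω := fun x hx h => by
    rw [frontier, hΩ.interior_eq] at hx; exact hx.2 h
  have zu : ∀ n, ∀ x ∈ frontier Ω, U n x = 0 := fun n x hx => (P n).2.1.2.2 x (hfr x hx)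
  have zv : ∀ n, ∀ x ∈ frontier Ω, V n x = 0 := fun n x hx => (P n).2.2.2.2 x (hfr x hx)
  have ccu : ∀ n, ContinuousOn (U n) (closure Ω) := fun n => cont_closure hΩ (cu n).continuousOn (ru n) (zu n) hs.cont_u hs.bdry_u
  have ccv : ∀ n, ContinuousOn (V n) (closure Ω) := fun n => cont_closure hΩ (cv n).continuousOn (rv n) (zv n) hs.cont_v hs.bdry_v
  have l0 : ∀ x : Euc N, lap (fun _ => (0:ℝ)) x = 0 := fun x => by
    simp [lap, secondDerivCoord]
  have cmp : ∀ a b : Euc N → ℝ, ContDiffOn ℝ 2 a Ω → ContDiffOn ℝ 2 b Ω → ContinuousOn a (closure Ω) → ContinuousOn b (closure Ω) →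
      (∀ x ∈ frontier Ω, a x = 0) → (∀ x ∈ frontier Ω, b x = 0) → (∀ x ∈ Ω, - lap a x < - lap b x) → ∀ x ∈ Ω, a x < b x := by
    intro a b ha hb ha' hb' ha0 hb0 hlt x hx
    have := SMP hΩ hbd (p := fun x => b x - a x) (hb.sub ha) (hb'.sub ha') (fun y hy => by
      rw [lap_sub (hb.contDiffAt (hΩ.mem_nhds hy)) (ha.contDiffAt (hΩ.mem_nhds hy))]
      linarith [hlt y hy]) (fun y hy => by rw [ha0 y hy, hb0 y hy]; simp) x hx
    linarith
  have mono : ∀ n, (∀ x ∈ Ω, U n x < U (n+1) x) ∧ (∀ x ∈ Ω, V n x < V (n+1) x) := by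
    intro n
    induction n with
    | zero =>
      constructor
      · refine cmp _ _ (cu 0) (cu 1) (ccu 0) (ccu 1) (zu 0) (zu 1) fun x hx => ?_
        rw [eu 0 x hx]
        change - lap (fun _ => (0:ℝ)) x < lam / (1 - 0)^2
        rw [l0]; simpa using hlam
      · refine cmp _ _ (cv 0) (cv 1) (ccv 0) (ccv 1) (zv 0) (zv 1) fun x hx => ?_
        rw [ev 0 x hx]
        change - lap (fun _ => (0:ℝ)) x < mu / (1 - 0)^2
        rw [l0]; simpa using hmu
    | succ n ih =>
      constructor
      · refine cmp _ _ (cu _) (cu _) (ccu _) (ccu _) (zu _) (zu _) fun x hx => ?_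
        rw [eu n x hx, eu (n+1) x hx]
        have h1 : 0 < 1 - V (n+1) x := by linarith [(rv (n+1) x hx).2, hv x hx]
        exact div_lt_div_of_pos_left hlam (by positivity) (pow_lt_pow_left₀ (by linarith [ih.2 x hx]) h1.le two_ne_zero)
      · refine cmp _ _ (cv _) (cv _) (ccv _) (ccv _) (zv _) (zv _) fun x hx => ?_
        rw [ev n x hx, ev (n+1) x hx]
        have h1 : 0 < 1 - U (n+1) x := by linarith [(ru (n+1) x hx).2, hu x hx]
        exact div_lt_div_of_pos_left hmu (by positivity) (pow_lt_pow_left₀ (by linarith [ih.1 x hx]) h1.le two_ne_zero)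
  have lim : ∀ (A : ℕ → Euc N → ℝ) (a : Euc N → ℝ), (∀ n, ∀ x ∈ Ω, A n x < A (n+1) x) → (∀ n, ∀ x ∈ Ω, A n x ≤ a x) →
      ∀ x ∈ Ω, Tendsto (fun n => A n x) atTop (𝓝 (⨆ n, A n x)) := by
    intro A a h1 h2 x hx
    exact tendsto_atTop_ciSup (monotone_nat_of_le_succ fun n => (h1 n x hx).le) ⟨a x, by rintro _ ⟨n, rfl⟩; exact h2 n x hx⟩
  have limU := lim U u (fun n => (mono n).1) fun n x hx => (ru n x hx).2
  have limV := lim V v (fun n => (mono n).2) fun n x hx => (rv n x hx).2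
  set u' : Euc N → ℝ := fun x => ⨆ n, U n x
  set v' : Euc N → ℝ := fun x => ⨆ n, V n x
  have ru' : ∀ x ∈ Ω, 0 ≤ u' x ∧ u' x ≤ u x := fun x hx => ⟨ge_of_tendsto' (limU x hx) fun n => (ru n x hx).1, le_of_tendsto' (limU x hx) fun n => (ru n x hx).2⟩
  have rv' : ∀ x ∈ Ω, 0 ≤ v' x ∧ v' x ≤ v x := fun x hx => ⟨ge_of_tendsto' (limV x hx) fun n => (rv n x hx).1, le_of_tendsto' (limV x hx) fun n => (rv n x hx).2⟩
  have A := half_sys hΩ (lam := fun _ => lam) (w := fun j => U (j+1)) (z := V) (δ := δ) (L := |lam|) (u := u') (v := v') hδ tendsto_const_nhds (fun _ => le_rfl)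
    (fun j => cu _) (fun j x hx => ⟨(ru _ x hx).1, (ru _ x hx).2.trans (hu x hx)⟩) (fun j x hx => ⟨(rv _ x hx).1, (rv _ x hx).2.trans (hv x hx)⟩)
    eu (fun x hx => (limU x hx).comp (tendsto_add_atTop_nat 1)) limV
  have B := half_sys hΩ (lam := fun _ => mu) (w := fun j => V (j+1)) (z := U) (δ := δ) (L := |mu|) (u := v') (v := u') hδ tendsto_const_nhds (fun _ => le_rfl)
    (fun j => cv _) (fun j x hx => ⟨(rv _ x hx).1, (rv _ x hx).2.trans (hv x hx)⟩) (fun j x hx => ⟨(ru _ x hx).1, (ru _ x hx).2.trans (hu x hx)⟩)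
    ev (fun x hx => (limV x hx).comp (tendsto_add_atTop_nat 1)) limU
  have A2 := A.2 B.1
  have B2 := B.2 A.1
  have zu' : ∀ x ∈ frontier Ω, u' x = 0 := fun x hx => by simp [u', zu _ x hx]
  have zv' : ∀ x ∈ frontier Ω, v' x = 0 := fun x hx => by simp [v', zv _ x hx]
  have hsol : IsClassicalSolution Ω (fun _ => (1:ℝ)) (fun _ => (1:ℝ)) lam mu u' v' :=
    { smooth_u := A2.1
      smooth_v := B2.1
      cont_u := cont_closure hΩ A2.1.continuousOn ru' zu' hs.cont_u hs.bdry_u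
      cont_v := cont_closure hΩ B2.1.continuousOn rv' zv' hs.cont_v hs.bdry_v
      range_u := fun x hx => ⟨(ru' x hx).1, (ru' x hx).2.trans_lt (hs.range_u x hx).2⟩
      range_v := fun x hx => ⟨(rv' x hx).1, (rv' x hx).2.trans_lt (hs.range_v x hx).2⟩
      bdry_u := zu'
      bdry_v := zv'
      eq_u := fun x hx => by rw [A2.2 x hx, mul_one]
      eq_v := fun x hx => by rw [B2.2 x hx, mul_one] }
  have hle := hm u' v' hsol
  refine ⟨δ, U, V, cu, cv, ru, rv, hu, hv, hδ, eu, ev, fun n => (mono n).1, fun n => (mono n).2, fun x hx => ?_, fun x hx => ?_⟩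
  · rw [le_antisymm (hle x hx).1 (ru' x hx).2]; exact limU x hx
  · rw [le_antisymm (hle x hx).2 (rv' x hx).2]; exact limV x hx

end


section
variable {N : ℕ}

lemma intSq {Ω : Set (Euc N)} (hΩ : IsOpen Ω) {φ q : Euc N → ℝ} (hφ : C1c Ω φ) (hq : ContinuousOn q Ω) :
    Integrable (fun x => φ x ^ 2 * q x) := by
  have := intMul hΩ hφ.cd.continuous hφ.cs hφ.sub (q := fun x => φ x * q x) (hφ.cd.continuous.continuousOn.mul hq)
  refine this.congr (Eventually.of_forall fun x => ?_)
  simp only; ring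

lemma intGrad {Ω : Set (Euc N)} {φ : Euc N → ℝ} (hφ : C1c Ω φ) :
    Integrable (fun x => ∑ i, (Dd i φ x)^2) := by
  refine integrable_finsetSum _ fun i _ => ?_
  have h : Continuous (fun x => (Dd i φ x)^2) := (hφ.contDd i).pow 2
  refine h.integrable_of_hasCompactSupport ?_
  exact (hφ.csDd i).comp_left (g := fun t : ℝ => t^2) (by simp)

lemma stab1 {Ω : Set (Euc N)} (hΩ : IsOpen Ω) {φ ξ : Euc N → ℝ} (hφ : C1c Ω φ) (hξ : ContDiffOn ℝ 2 ξ Ω)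
    (hpos : ∀ x ∈ Ω, 0 < ξ x) : ∫ x, φ x ^ 2 * (- lap ξ x / ξ x) ≤ ∫ x, ∑ i, (Dd i φ x)^2 := by
  have hξ1 : ContDiffOn ℝ 1 ξ Ω := hξ.of_le (by norm_num)
  have hp : C1c Ω (fun x => φ x ^ 2 * (ξ x)⁻¹) := by
    refine C1c.mk_of hΩ hφ.cs hφ.sub ((hφ.cd.contDiffOn.pow 2).mul (hξ1.inv fun x hx => (hpos x hx).ne')) fun x hx => ?_
    rw [image_eq_zero_of_notMem_tsupport hx]; simp
  have h1 := ibp hΩ hp hξ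
  have h2 : ∫ x, φ x ^ 2 * (- lap ξ x / ξ x) = ∫ x, ∑ i, Dd i (fun x => φ x ^ 2 * (ξ x)⁻¹) x * Dd i ξ x := by
    rw [← neg_eq_iff_eq_neg.2 h1, ← integral_neg]
    congr 1; ext x; rw [div_eq_mul_inv]; ring
  rw [h2]
  refine integral_mono ?_ (intGrad hφ) fun x => ?_
  · exact integrable_finsetSum _ fun i _ => intMul hΩ (hp.contDd i) (hp.csDd i) (tsupport_Dd.trans hp.sub) (contOn_Dd hΩ hξ1 i)
  · refine Finset.sum_le_sum fun i _ => ?_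
    by_cases hx : x ∈ Ω
    · have dφ : DifferentiableAt ℝ φ x := hφ.cd.differentiable (by norm_num) x
      have dξ : DifferentiableAt ℝ ξ x := (hξ1.contDiffAt (hΩ.mem_nhds hx)).differentiableAt (by norm_num)
      have px := hpos x hx
      have e1 : Dd i (fun y => φ y ^ 2) x = 2 * φ x * Dd i φ x :=
        Dd_comp (F := fun s => s^2) (by simpa using hasDerivAt_pow 2 (φ x)) dφ
      have e2 : Dd i (fun y => (ξ y)⁻¹) x = -(ξ x ^ 2)⁻¹ * Dd i ξ x :=
        Dd_comp (F := fun s => s⁻¹) (hasDerivAt_inv px.ne') dξ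
      rw [Dd_mul (f := fun y => φ y ^ 2) (g := fun y => (ξ y)⁻¹) (dφ.pow 2) (dξ.inv px.ne'), e1, e2]
      have : (φ x ^ 2 * (-(ξ x ^ 2)⁻¹ * Dd i ξ x) + (ξ x)⁻¹ * (2 * φ x * Dd i φ x)) * Dd i ξ x
        = (Dd i φ x)^2 - (Dd i φ x - φ x * (ξ x)⁻¹ * Dd i ξ x)^2 := by
        rw [← inv_pow]; ring
      rw [this]; nlinarith [sq_nonneg (Dd i φ x - φ x * (ξ x)⁻¹ * Dd i ξ x)]
    · rw [Dd_zero_of_notMem fun h => hx (hp.sub h)]; simpa using sq_nonneg (Dd i φ x)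

/-- convexity of `1/(1-t)^2` -/
lemma conv_ineq {s t : ℝ} (hst : s ≤ t) (ht : t < 1) : 2 * (1 / (1 - s)^3) * (t - s) ≤ 1 / (1 - t)^2 - 1 / (1 - s)^2 := by
  have h1 : 0 < 1 - t := by linarith
  have h2 : 0 < 1 - s := by linarith
  have e : 1 / (1 - t)^2 - 1 / (1 - s)^2 - 2 * (1 / (1 - s)^3) * (t - s)
      = ((t - s)^2 * (3 * (1 - t) + (t - s))) / ((1 - t)^2 * (1 - s)^3) := by
    field_simp; ring
  have : 0 ≤ ((t - s)^2 * (3 * (1 - t) + (t - s))) / ((1 - t)^2 * (1 - s)^3) := by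
    apply div_nonneg
    · apply mul_nonneg (sq_nonneg _); nlinarith
    · positivity
  linarith

lemma amgm_log {p q x y X Y : ℝ} (hp : 0 < p) (hq : 0 < q) (hx : 0 < x) (hy : 0 < y) (hX : 0 < X) (hY : 0 < Y) :
    √(p * q) * (2 + ((Real.log x + Real.log y) - (Real.log X + Real.log Y))) ≤ p * y / X + q * x / Y := by
  set T := (Real.log x + Real.log y) - (Real.log X + Real.log Y)
  have e : Real.exp T = x * y / (X * Y) := by
    simp only [T]; rw [Real.exp_sub, Real.exp_add, Real.exp_add, Real.exp_log hx, Real.exp_log hy, Real.exp_log hX, Real.exp_log hY]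
  have h1 : T / 2 + 1 ≤ Real.exp (T/2) := Real.add_one_le_exp _
  have h2 : Real.exp (T/2) ^ 2 = Real.exp T := by rw [← Real.exp_nat_mul]; congr 1; push_cast; ring
  have h3 : √(p*q) * Real.exp (T/2) * 2 ≤ p * y / X + q * x / Y := by
    have s2 : (√(p*q))^2 = p * q := Real.sq_sqrt (by positivity)
    have : (√(p*q) * Real.exp (T/2) * 2)^2 ≤ (p * y / X + q * x / Y)^2 := by
      have e3 : (√(p*q) * Real.exp (T/2) * 2)^2 = 4 * ((p * y / X) * (q * x / Y)) := by
        rw [mul_pow, mul_pow, s2, h2, e]; field_simp; ring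
      rw [e3]; nlinarith [sq_nonneg (p * y / X - q * x / Y)]
    exact le_of_sq_le_sq this (by positivity)
  have := mul_le_mul_of_nonneg_left h1 (Real.sqrt_nonneg (p*q))
  nlinarith

def cf (lam mu s t : ℝ) : ℝ := √((lam * (1 / (1 - t)^3)) * (mu * (1 / (1 - s)^3)))

lemma cf_contOn {Ω : Set (Euc N)} {lam mu : ℝ} {f g : Euc N → ℝ} (hf : ContinuousOn f Ω) (hg : ContinuousOn g Ω)
    (hf1 : ∀ x ∈ Ω, f x < 1) (hg1 : ∀ x ∈ Ω, g x < 1) : ContinuousOn (fun x => cf lam mu (f x) (g x)) Ω := by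
  have : ∀ f : Euc N → ℝ, ContinuousOn f Ω → (∀ x ∈ Ω, f x < 1) → ContinuousOn (fun x => 1 / (1 - f x)^3) Ω := fun f hf hf1 =>
    continuousOn_const.div ((continuousOn_const.sub hf).pow 3) fun x hx => by
      have : 0 < 1 - f x := by linarith [hf1 x hx]
      positivity
  exact ((continuousOn_const.mul (this g hg hg1)).mul (continuousOn_const.mul (this f hf hf1))).sqrt

lemma stabK {Ω : Set (Euc N)} (hΩ : IsOpen Ω) {lam mu δ : ℝ} (hlam : 0 < lam) (hmu : 0 < mu) {u v : Euc N → ℝ}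
    {U V : ℕ → Euc N → ℝ} (h : Iter Ω lam mu u v δ U V) {φ : Euc N → ℝ} (hφ : C1c Ω φ) (K : ℕ) :
    2 * ∫ x, φ x ^ 2 * cf lam mu (U K x) (V K x) ≤ ∫ x, ∑ i, (Dd i φ x)^2 := by
  have hd := h.d0
  have U1 : ∀ n, ∀ x ∈ Ω, U n x < 1 := fun n x hx => by linarith [(h.ru n x hx).2, h.bu x hx]
  have V1 : ∀ n, ∀ x ∈ Ω, V n x < 1 := fun n x hx => by linarith [(h.rv n x hx).2, h.bv x hx]
  have Um : ∀ n, K ≤ n → ∀ x ∈ Ω, U K x ≤ U n x := fun n hn x hx =>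
    monotone_nat_of_le_succ (f := fun n => U n x) (fun n => (h.mu' n x hx).le) hn
  have Vm : ∀ n, K ≤ n → ∀ x ∈ Ω, V K x ≤ V n x := fun n hn x hx =>
    monotone_nat_of_le_succ (f := fun n => V n x) (fun n => (h.mv' n x hx).le) hn
  set E := ∫ x, ∑ i, (Dd i φ x)^2
  let ξ : ℕ → Euc N → ℝ := fun n x => U (n+1) x - U n x
  let χ : ℕ → Euc N → ℝ := fun n x => V (n+1) x - V n x
  have ξc : ∀ n, ContDiffOn ℝ 2 (ξ n) Ω := fun n => (h.cu _).sub (h.cu _)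
  have χc : ∀ n, ContDiffOn ℝ 2 (χ n) Ω := fun n => (h.cv _).sub (h.cv _)
  have ξp : ∀ n, ∀ x ∈ Ω, 0 < ξ n x := fun n x hx => sub_pos.2 (h.mu' n x hx)
  have χp : ∀ n, ∀ x ∈ Ω, 0 < χ n x := fun n x hx => sub_pos.2 (h.mv' n x hx)
  have lξ : ∀ n, K ≤ n → ∀ x ∈ Ω, 2 * (lam * (1 / (1 - V K x)^3)) * χ n x ≤ - lap (ξ (n+1)) x := by
    intro n hn x hx
    have e : lap (ξ (n+1)) x = lap (U (n+1+1)) x - lap (U (n+1)) x :=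
      lap_sub ((h.cu _).contDiffAt (hΩ.mem_nhds hx)) ((h.cu _).contDiffAt (hΩ.mem_nhds hx))
    have e1 := h.eu n x hx
    have e2 := h.eu (n+1) x hx
    have c := conv_ineq (h.mv' n x hx).le (V1 _ x hx)
    have m : 1 / (1 - V K x)^3 ≤ 1 / (1 - V n x)^3 := by
      have : 0 < 1 - V n x := by linarith [V1 n x hx]
      exact one_div_le_one_div_of_le (by positivity) (pow_le_pow_left₀ this.le (by linarith [Vm n hn x hx]) 3)
    have c2 : 2 * (1 / (1 - V K x)^3) * χ n x ≤ 2 * (1 / (1 - V n x)^3) * χ n x := by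
      have := χp n x hx
      gcongr
    have c3 := mul_le_mul_of_nonneg_left (c2.trans c) hlam.le
    have e3 : lam / (1 - V (n+1) x)^2 - lam / (1 - V n x)^2 = lam * (1 / (1 - V (n+1) x)^2 - 1 / (1 - V n x)^2) := by ring
    linarith
  have lχ : ∀ n, K ≤ n → ∀ x ∈ Ω, 2 * (mu * (1 / (1 - U K x)^3)) * ξ n x ≤ - lap (χ (n+1)) x := by
    intro n hn x hx
    have e : lap (χ (n+1)) x = lap (V (n+1+1)) x - lap (V (n+1)) x :=
      lap_sub ((h.cv _).contDiffAt (hΩ.mem_nhds hx)) ((h.cv _).contDiffAt (hΩ.mem_nhds hx))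
    have e1 := h.ev n x hx
    have e2 := h.ev (n+1) x hx
    have c := conv_ineq (h.mu' n x hx).le (U1 _ x hx)
    have m : 1 / (1 - U K x)^3 ≤ 1 / (1 - U n x)^3 := by
      have : 0 < 1 - U n x := by linarith [U1 n x hx]
      exact one_div_le_one_div_of_le (by positivity) (pow_le_pow_left₀ this.le (by linarith [Um n hn x hx]) 3)
    have c2 : 2 * (1 / (1 - U K x)^3) * ξ n x ≤ 2 * (1 / (1 - U n x)^3) * ξ n x := by
      have := ξp n x hx
      gcongr
    have c3 := mul_le_mul_of_nonneg_left (c2.trans c) hmu.le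
    have e3 : mu / (1 - U (n+1) x)^2 - mu / (1 - U n x)^2 = mu * (1 / (1 - U (n+1) x)^2 - 1 / (1 - U n x)^2) := by ring
    linarith
  let c : Euc N → ℝ := fun x => cf lam mu (U K x) (V K x)
  let T : ℕ → Euc N → ℝ := fun n x => Real.log (ξ n x) + Real.log (χ n x)
  have cc : ContinuousOn c Ω := cf_contOn (h.cu K).continuousOn (h.cv K).continuousOn (U1 K) (V1 K)
  have Tc : ∀ n, ContinuousOn (T n) Ω := fun n =>
    ((ξc n).continuousOn.log fun x hx => (ξp n x hx).ne').add ((χc n).continuousOn.log fun x hx => (χp n x hx).ne')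
  have T0 : ∀ n, ∀ x ∈ Ω, T n x ≤ 0 := fun n x hx => by
    have a1 := Real.log_nonpos (ξp n x hx).le (by simp only [ξ]; linarith [U1 (n+1) x hx, (h.ru n x hx).1])
    have a2 := Real.log_nonpos (χp n x hx).le (by simp only [χ]; linarith [V1 (n+1) x hx, (h.rv n x hx).1])
    simp only [T]; linarith
  have ptw : ∀ n, K ≤ n → ∀ x ∈ Ω, 2 * (c x * (2 + (T n x - T (n+1) x))) ≤ - lap (ξ (n+1)) x / ξ (n+1) x + - lap (χ (n+1)) x / χ (n+1) x := by
    intro n hn x hx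
    have hu : 0 < 1 - U K x := by linarith [U1 K x hx]
    have hv : 0 < 1 - V K x := by linarith [V1 K x hx]
    have := amgm_log (p := lam * (1 / (1 - V K x)^3)) (q := mu * (1 / (1 - U K x)^3)) (by positivity) (by positivity)
      (ξp n x hx) (χp n x hx) (ξp (n+1) x hx) (χp (n+1) x hx)
    have b1 := div_le_div_of_nonneg_right (lξ n hn x hx) (ξp (n+1) x hx).le
    have b2 := div_le_div_of_nonneg_right (lχ n hn x hx) (χp (n+1) x hx).le
    simp only [c, cf, T]
    rw [mul_assoc, mul_div_assoc] at b1 b2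
    linarith
  set J := ∫ x, φ x ^ 2 * c x
  let L : ℕ → ℝ := fun n => ∫ x, φ x ^ 2 * (c x * T n x)
  have iJ := intSq hΩ hφ cc
  have iL : ∀ n, Integrable (fun x => φ x ^ 2 * (c x * T n x)) := fun n => intSq hΩ hφ (cc.mul (Tc n))
  have i1 : ∀ n, Integrable (fun x => φ x ^ 2 * (- lap (ξ n) x / ξ n x)) := fun n =>
    intSq hΩ hφ ((contOn_lap hΩ (ξc n)).neg.div (ξc n).continuousOn fun x hx => (ξp n x hx).ne')
  have i2 : ∀ n, Integrable (fun x => φ x ^ 2 * (- lap (χ n) x / χ n x)) := fun n =>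
    intSq hΩ hφ ((contOn_lap hΩ (χc n)).neg.div (χc n).continuousOn fun x hx => (χp n x hx).ne')
  have zr : ∀ x ∉ Ω, φ x = 0 := fun x hx => image_eq_zero_of_notMem_tsupport fun h => hx (hφ.sub h)
  have step : ∀ n, K ≤ n → 2 * J + L n - L (n+1) ≤ E := by
    intro n hn
    have A := stab1 hΩ hφ (ξc (n+1)) (ξp (n+1))
    have B := stab1 hΩ hφ (χc (n+1)) (χp (n+1))
    have i3 : Integrable (fun x => 4 * (φ x ^ 2 * c x) + 2 * (φ x ^ 2 * (c x * T n x))) := (iJ.const_mul 4).add ((iL n).const_mul 2)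
    have i4 : Integrable (fun x => 4 * (φ x ^ 2 * c x) + 2 * (φ x ^ 2 * (c x * T n x)) - 2 * (φ x ^ 2 * (c x * T (n+1) x))) := i3.sub ((iL (n+1)).const_mul 2)
    have m := integral_mono i4 ((i1 (n+1)).add (i2 (n+1))) (fun x => by
      by_cases hx : x ∈ Ω
      · have := mul_le_mul_of_nonneg_left (ptw n hn x hx) (sq_nonneg (φ x))
        simp only [Pi.add_apply]
        nlinarith
      · simp [zr x hx])
    rw [integral_add' (i1 (n+1)) (i2 (n+1)), integral_sub i3 ((iL (n+1)).const_mul 2), integral_add (iJ.const_mul 4) ((iL n).const_mul 2),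
      integral_const_mul, integral_const_mul, integral_const_mul] at m
    simp only [L, J]
    linarith
  have hL0 : ∀ n, L n ≤ 0 := fun n => integral_nonpos fun x => by
    by_cases hx : x ∈ Ω
    · have := mul_nonneg (sq_nonneg (φ x)) (Real.sqrt_nonneg ((lam * (1 / (1 - V K x)^3)) * (mu * (1 / (1 - U K x)^3))))
      simp only [Pi.zero_apply]
      rw [← mul_assoc]
      exact mul_nonpos_of_nonneg_of_nonpos this (T0 n x hx)
    · simp [zr x hx]
  have tel : ∀ m : ℕ, (m:ℝ) * (2 * J - E) ≤ L (K+m) - L K := by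
    intro m
    induction m with
    | zero => simp
    | succ m ih =>
      have := step (K+m) (by omega)
      push_cast
      rw [← add_assoc]
      linarith
  by_contra hcon
  push Not at hcon
  obtain ⟨m, hm⟩ := exists_nat_gt (-L K / (2 * J - E))
  have hp : 0 < 2 * J - E := by linarith
  rw [div_lt_iff₀ hp] at hm
  linarith [tel m, hL0 (K+m)]

lemma stab {Ω : Set (Euc N)} (hΩ : IsOpen Ω) {lam mu δ : ℝ} (hlam : 0 < lam) (hmu : 0 < mu) {u v : Euc N → ℝ}
    {U V : ℕ → Euc N → ℝ} (h : Iter Ω lam mu u v δ U V) {φ : Euc N → ℝ} (hφ : C1c Ω φ) :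
    2 * ∫ x, φ x ^ 2 * cf lam mu (u x) (v x) ≤ ∫ x, ∑ i, (Dd i φ x)^2 := by
  have hd := h.d0
  have zr : ∀ x ∉ Ω, φ x = 0 := fun x hx => image_eq_zero_of_notMem_tsupport fun h => hx (hφ.sub h)
  have U1 : ∀ n, ∀ x ∈ Ω, U n x < 1 := fun n x hx => by linarith [(h.ru n x hx).2, h.bu x hx]
  have V1 : ∀ n, ∀ x ∈ Ω, V n x < 1 := fun n x hx => by linarith [(h.rv n x hx).2, h.bv x hx]
  have bd : ∀ s t, s ≤ 1 - δ → t ≤ 1 - δ → cf lam mu s t ≤ cf lam mu (1-δ) (1-δ) := by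
    intro s t hs ht
    unfold cf
    have : ∀ s, s ≤ 1 - δ → 0 ≤ 1 / (1-s)^3 ∧ 1 / (1-s)^3 ≤ 1 / (1-(1-δ))^3 := fun s hs => by
      have : 0 < 1 - s := by linarith
      exact ⟨by positivity, one_div_le_one_div_of_le (by rw [sub_sub_cancel]; positivity) (pow_le_pow_left₀ (by linarith) (by linarith) 3)⟩
    have a := this s hs
    have b := this t ht
    apply Real.sqrt_le_sqrt
    exact mul_le_mul (mul_le_mul_of_nonneg_left b.2 hlam.le) (mul_le_mul_of_nonneg_left a.2 hmu.le) (mul_nonneg hmu.le a.1)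
      (mul_nonneg hlam.le (b.1.trans b.2))
  have lim : Tendsto (fun K => 2 * ∫ x, φ x ^ 2 * cf lam mu (U K x) (V K x)) atTop (𝓝 (2 * ∫ x, φ x ^ 2 * cf lam mu (u x) (v x))) := by
    refine Tendsto.const_mul _ ?_
    refine tendsto_integral_of_dominated_convergence (fun x => φ x ^ 2 * cf lam mu (1-δ) (1-δ)) (fun K => ?_) ?_ (fun K => ?_) ?_
    · exact (intSq hΩ hφ (cf_contOn (h.cu K).continuousOn (h.cv K).continuousOn (U1 K) (V1 K))).aestronglyMeasurable
    · exact intSq hΩ hφ continuousOn_const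
    · refine Eventually.of_forall fun x => ?_
      by_cases hx : x ∈ Ω
      · have : 0 ≤ cf lam mu (U K x) (V K x) := Real.sqrt_nonneg _
        rw [Real.norm_of_nonneg (mul_nonneg (sq_nonneg _) this)]
        exact mul_le_mul_of_nonneg_left (bd _ _ ((h.ru K x hx).2.trans (h.bu x hx)) ((h.rv K x hx).2.trans (h.bv x hx))) (sq_nonneg _)
      · simp [zr x hx]
    · refine Eventually.of_forall fun x => ?_
      by_cases hx : x ∈ Ω
      · refine Tendsto.const_mul _ ?_
        have hu : 1 - u x ≠ 0 := by linarith [h.bu x hx]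
        have hv : 1 - v x ≠ 0 := by linarith [h.bv x hx]
        refine Tendsto.sqrt ?_
        exact (Tendsto.const_mul _ (tendsto_const_nhds.div ((tendsto_const_nhds.sub (h.lv x hx)).pow 3) (pow_ne_zero _ hv))).mul
          (Tendsto.const_mul _ (tendsto_const_nhds.div ((tendsto_const_nhds.sub (h.lu x hx)).pow 3) (pow_ne_zero _ hu)))
      · simp [zr x hx]
  exact le_of_tendsto' lim fun K => stabK hΩ hlam hmu h hφ K

end


section
variable {N : ℕ}

structure Glue (F F' : ℝ → ℝ) : Prop where
  hd : ∀ s < 1, HasDerivAt F (F' s) s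
  hc : ContinuousOn F' (Iio 1)
  z : F 0 = 0
  z' : F' 0 = 0

lemma Glue.hasDeriv {F F' : ℝ → ℝ} (h : Glue F F') {s : ℝ} (hs : s < 1) :
    HasDerivAt (fun s => F (max s 0)) (F' (max s 0)) s := by
  rcases lt_trichotomy s 0 with h0 | h0 | h0
  · rw [max_eq_right h0.le, h.z']
    refine (hasDerivAt_const s (0:ℝ)).congr_of_eventuallyEq ?_
    filter_upwards [Iio_mem_nhds h0] with t ht
    rw [max_eq_right (le_of_lt ht), h.z]
  · subst h0
    rw [max_self, h.z']
    have h1 : HasDerivWithinAt (fun s => F (max s 0)) 0 (Iic 0) 0 :=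
      (hasDerivWithinAt_const 0 _ (0:ℝ)).congr (fun t ht => by rw [max_eq_right ht, h.z]) (by rw [max_self, h.z])
    have h2 : HasDerivWithinAt (fun s => F (max s 0)) 0 (Ici 0) 0 := by
      have := (h.hd 0 hs).hasDerivWithinAt (s := Ici 0)
      rw [h.z'] at this
      exact this.congr (fun t ht => by rw [max_eq_left ht]) (by rw [max_self])
    have := h1.union h2
    rwa [Iic_union_Ici, hasDerivWithinAt_univ] at this
  · rw [max_eq_left h0.le]
    refine (h.hd s hs).congr_of_eventuallyEq ?_
    filter_upwards [Ioi_mem_nhds h0] with t ht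
    rw [max_eq_left (le_of_lt ht)]

lemma Glue.contDiffOn {F F' : ℝ → ℝ} (h : Glue F F') : ContDiffOn ℝ 1 (fun s => F (max s 0)) (Iio 1) := by
  rw [show (1 : WithTop ℕ∞) = 0 + 1 by norm_num, contDiffOn_succ_iff_deriv_of_isOpen isOpen_Iio]
  refine ⟨fun s hs => (h.hasDeriv hs).differentiableAt.differentiableWithinAt, by simp, ?_⟩
  rw [contDiffOn_zero]
  refine ContinuousOn.congr (f := fun s => F' (max s 0)) ?_ fun s hs => (h.hasDeriv hs).deriv
  exact h.hc.comp (by fun_prop) fun s hs => max_lt (show s < 1 from hs) one_pos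

def cut (Ω : Set (Euc N)) (F : ℝ → ℝ) (u : Euc N → ℝ) (ε : ℝ) : Euc N → ℝ := Ω.indicator fun x => F (max (u x - ε) 0)

structure Dat (Ω : Set (Euc N)) (lam mu δ : ℝ) (u v : Euc N → ℝ) : Prop where
  op : IsOpen Ω
  bd : Bornology.IsBounded Ω
  lp : 0 < lam
  mp : 0 < mu
  d0 : 0 < δ
  cu : ContDiffOn ℝ 2 u Ω
  cv : ContDiffOn ℝ 2 v Ω
  ccu : ContinuousOn u (closure Ω)
  ccv : ContinuousOn v (closure Ω)
  zu : ∀ x ∈ frontier Ω, u x = 0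
  zv : ∀ x ∈ frontier Ω, v x = 0
  ru : ∀ x ∈ Ω, 0 ≤ u x ∧ u x ≤ 1 - δ
  rv : ∀ x ∈ Ω, 0 ≤ v x ∧ v x ≤ 1 - δ
  eu : ∀ x ∈ Ω, - lap u x = lam / (1 - v x)^2
  ev : ∀ x ∈ Ω, - lap v x = mu / (1 - u x)^2
  st : ∀ φ, C1c Ω φ → 2 * ∫ x, φ x ^ 2 * cf lam mu (u x) (v x) ≤ ∫ x, ∑ i, (Dd i φ x)^2

lemma cf_comm (lam mu s t : ℝ) : cf lam mu s t = cf mu lam t s := by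
  unfold cf; rw [mul_comm]

lemma Dat.symm {Ω : Set (Euc N)} {lam mu δ : ℝ} {u v : Euc N → ℝ} (h : Dat Ω lam mu δ u v) : Dat Ω mu lam δ v u :=
  ⟨h.op, h.bd, h.mp, h.lp, h.d0, h.cv, h.cu, h.ccv, h.ccu, h.zv, h.zu, h.rv, h.ru, h.ev, h.eu, fun φ hφ => by
    simp only [cf_comm mu lam]; exact h.st φ hφ⟩

variable {Ω : Set (Euc N)} {lam mu δ : ℝ} {u v : Euc N → ℝ}

lemma Dat.u1 (h : Dat Ω lam mu δ u v) : ∀ x ∈ Ω, u x < 1 := fun x hx => by linarith [h.d0, (h.ru x hx).2]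

lemma cut_C1c (h : Dat Ω lam mu δ u v) {F F' : ℝ → ℝ} (hF : Glue F F') {ε : ℝ} (hε : 0 < ε) : C1c Ω (cut Ω F u ε) := by
  have hcl : IsClosed (closure Ω ∩ u ⁻¹' Ici ε) := h.ccu.preimage_isClosed_of_isClosed isClosed_closure isClosed_Ici
  have hC : IsCompact (closure Ω ∩ u ⁻¹' Ici ε) := h.bd.isCompact_closure.of_isClosed_subset hcl inter_subset_left
  refine C1c.mk_of h.op hC ?_ ?_ ?_
  · rintro x ⟨hx, hux⟩
    by_contra hn
    have : x ∈ frontier Ω := by rw [frontier, h.op.interior_eq]; exact ⟨hx, hn⟩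
    rw [mem_preimage, h.zu x this, mem_Ici] at hux
    linarith
  · have : ContDiffOn ℝ 1 (fun x => (fun s => F (max s 0)) (u x - ε)) Ω :=
      hF.contDiffOn.comp ((h.cu.of_le (by norm_num)).sub contDiffOn_const) fun x hx => by
        have := h.u1 x hx
        change u x - ε < 1
        linarith
    exact this.congr fun x hx => indicator_of_mem hx _
  · intro x hx
    by_cases hxΩ : x ∈ Ω
    · rw [cut, indicator_of_mem hxΩ]
      have : u x < ε := by
        by_contra hn
        exact hx ⟨subset_closure hxΩ, not_lt.1 hn⟩
      rw [max_eq_right (by linarith), hF.z]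
    · exact indicator_of_notMem hxΩ _

lemma Dd_cut (h : Dat Ω lam mu δ u v) {F F' : ℝ → ℝ} (hF : Glue F F') {ε : ℝ} (hε : 0 < ε) {x : Euc N} (hx : x ∈ Ω) (i : Fin N) :
    Dd i (cut Ω F u ε) x = F' (max (u x - ε) 0) * Dd i u x := by
  have e : cut Ω F u ε =ᶠ[𝓝 x] fun x => (fun s => F (max (s - ε) 0)) (u x) :=
    eventually_of_mem (h.op.mem_nhds hx) fun y hy => indicator_of_mem hy _
  rw [Dd_congr e]
  refine Dd_comp (F := fun s => F (max (s - ε) 0)) ?_ ((h.cu.contDiffAt (h.op.mem_nhds hx)).differentiableAt (by norm_num))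
  have := h.u1 x hx
  have := (hF.hasDeriv (s := u x - ε) (by linarith)).comp_sub_const (u x) ε
  exact this

lemma dinv (k : ℕ) {s : ℝ} (hs : s < 1) : HasDerivAt (fun s : ℝ => 1 / (1 - s)^k) (k / (1 - s)^(k+1)) s := by
  have h1 : 1 - s ≠ 0 := by linarith
  have h : HasDerivAt (fun s : ℝ => 1 - s) (-1) s := by simpa using (hasDerivAt_id s).const_sub 1
  have := (h.fun_pow k).fun_inv (pow_ne_zero k h1)
  simp only [one_div]
  refine this.congr_deriv ?_
  rcases k with _ | k
  · simp
  · simp only [Nat.add_sub_cancel]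
    field_simp
    ring

def GG (s : ℝ) : ℝ := s^2 * (1 / (1 - s)^4)
def GG' (s : ℝ) : ℝ := (2 * s + 2 * s^2) / (1 - s)^5
def psi (s : ℝ) : ℝ := 16 * ((1 / (1-s)^9 - 1) / 9 - (1 / (1-s)^8 - 1) / 4 + (1 / (1-s)^7 - 1) / 7)
def psi' (s : ℝ) : ℝ := 16 * s^2 / (1 - s)^10

lemma contOn_quot {f : ℝ → ℝ} (hf : Continuous f) (k : ℕ) : ContinuousOn (fun s => f s / (1 - s)^k) (Iio 1) :=
  hf.continuousOn.div (by fun_prop) fun s hs => pow_ne_zero _ (by have : s < 1 := hs; linarith)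

lemma glue_G : Glue GG GG' := by
  refine ⟨fun s hs => ?_, contOn_quot (by fun_prop) 5, by simp [GG], by simp [GG']⟩
  have h1 : 1 - s ≠ 0 := by linarith
  have := (hasDerivAt_pow 2 s).fun_mul (dinv 4 hs)
  refine this.congr_deriv ?_
  unfold GG'; push_cast; field_simp; ring

lemma glue_psi : Glue psi psi' := by
  refine ⟨fun s hs => ?_, contOn_quot (by fun_prop) 10, by simp [psi], by simp [psi']⟩
  have h1 : 1 - s ≠ 0 := by linarith
  have := (((((dinv 9 hs).sub_const 1).div_const 9).fun_sub (((dinv 8 hs).sub_const 1).div_const 4)).fun_add (((dinv 7 hs).sub_const 1).div_const 7)).const_mul 16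
  refine this.congr_deriv ?_
  unfold psi'; push_cast; field_simp; ring

lemma psi_bd {s : ℝ} (h0 : 0 ≤ s) (h1 : s < 1) : 0 ≤ psi s ∧ psi s ≤ 16 / 9 * (1 / (1-s)^9) := by
  constructor
  · have mono : MonotoneOn psi (Ico 0 1) := by
      refine monotoneOn_of_hasDerivWithinAt_nonneg (f' := psi') (convex_Ico 0 1) (fun x hx => (glue_psi.hd x hx.2).continuousAt.continuousWithinAt) (fun x hx => ?_) fun x hx => ?_
      · rw [interior_Ico] at hx ⊢; exact (glue_psi.hd x hx.2).hasDerivWithinAt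
      · rw [interior_Ico] at hx
        have : 0 < 1 - x := by linarith [hx.2]
        unfold psi'; positivity
    have := mono ⟨le_rfl, one_pos⟩ ⟨h0, h1⟩ h0
    rwa [glue_psi.z] at this
  · have hp : 0 < 1 - s := by linarith
    set a := 1 / (1 - s)
    have ha : 1 ≤ a := by rw [le_div_iff₀ hp]; linarith
    have e : ∀ k : ℕ, 1 / (1-s)^k = a^k := fun k => by simp [a]
    unfold psi
    rw [e, e, e]
    have : a^7 ≤ a^8 := pow_le_pow_right₀ ha (by norm_num)
    have : 1 ≤ a^7 := one_le_pow₀ ha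
    linarith

lemma GG_psi {s : ℝ} (h0 : 0 ≤ s) (h1 : s < 1) : GG' s ^ 2 ≤ psi' s := by
  have hp : 0 < 1 - s := by linarith
  unfold GG' psi'
  rw [div_pow, ← pow_mul]
  gcongr
  have : (2 * s + 2 * s^2)^2 = (2 * (1 + s))^2 * s^2 := by ring
  rw [this]
  exact mul_le_mul_of_nonneg_right (by nlinarith) (sq_nonneg s)

lemma GG_bd {s δ : ℝ} (h0 : 0 ≤ s) (hδ : 0 < δ) (h1 : s ≤ 1 - δ) : 0 ≤ GG s ∧ GG s ≤ 1 / δ^4 := by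
  have hp : 0 < 1 - s := by linarith
  have : 1 / (1-s)^4 ≤ 1/δ^4 := one_div_le_one_div_of_le (by positivity) (pow_le_pow_left₀ hδ.le (by linarith) 4)
  have h2 : 0 ≤ 1 / (1-s)^4 := by positivity
  have : s^2 ≤ 1 := by nlinarith
  unfold GG
  exact ⟨by positivity, by nlinarith⟩

lemma intOn_bd (hΩ : IsOpen Ω) (hbd : Bornology.IsBounded Ω) {f : Euc N → ℝ} (hf : ContinuousOn f Ω) {C : ℝ} (hC : ∀ x ∈ Ω, |f x| ≤ C) :
    IntegrableOn f Ω :=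
  IntegrableOn.of_bound hbd.measure_lt_top (hf.aestronglyMeasurable hΩ.measurableSet) C
    ((ae_restrict_iff' hΩ.measurableSet).2 (Eventually.of_forall hC))

lemma intOn_F (h : Dat Ω lam mu δ u v) {F : ℝ × ℝ → ℝ} (hF : ContinuousOn F (Icc 0 (1-δ) ×ˢ Icc 0 (1-δ))) :
    IntegrableOn (fun x => F (u x, v x)) Ω := by
  obtain ⟨C, hC⟩ := (isCompact_Icc.prod isCompact_Icc).exists_bound_of_continuousOn hF
  exact intOn_bd h.op h.bd (hF.comp (h.cu.continuousOn.prodMk h.cv.continuousOn) fun x hx => ⟨h.ru x hx, h.rv x hx⟩)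
    (C := C) fun x hx => hC (u x, v x) ⟨h.ru x hx, h.rv x hx⟩

lemma half_energy (h : Dat Ω lam mu δ u v) :
    2 * ∫ x in Ω, GG (u x) ^ 2 * cf lam mu (u x) (v x) ≤ ∫ x in Ω, 16 / 9 * (1 / (1 - u x)^9) * (lam / (1 - v x)^2) := by
  have hd := h.d0
  have v1 := h.symm.u1
  have u1 := h.u1
  have lp := h.lp
  have ccf : ContinuousOn (fun x => cf lam mu (u x) (v x)) Ω := cf_contOn h.cu.continuousOn h.cv.continuousOn u1 v1
  have icf : IntegrableOn (fun x => cf lam mu (u x) (v x)) Ω := by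
    refine intOn_F h (F := fun p => cf lam mu p.1 p.2) ?_
    unfold cf
    refine ContinuousOn.sqrt ?_
    refine ContinuousOn.mul (continuousOn_const.mul (continuousOn_const.div (by fun_prop) ?_)) (continuousOn_const.mul (continuousOn_const.div (by fun_prop) ?_))
    · rintro ⟨s, t⟩ ⟨hs, ht⟩; exact pow_ne_zero _ (by have := ht.2; simp only at this ⊢; linarith)
    · rintro ⟨s, t⟩ ⟨hs, ht⟩; exact pow_ne_zero _ (by have := hs.2; simp only at this ⊢; linarith)
  have irhs : IntegrableOn (fun x => 16 / 9 * (1 / (1 - u x)^9) * (lam / (1 - v x)^2)) Ω := by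
    refine intOn_F h (F := fun p => 16 / 9 * (1 / (1 - p.1)^9) * (lam / (1 - p.2)^2)) ?_
    refine ContinuousOn.mul (continuousOn_const.mul (continuousOn_const.div (by fun_prop) ?_)) (continuousOn_const.div (by fun_prop) ?_)
    · rintro ⟨s, t⟩ ⟨hs, ht⟩; exact pow_ne_zero _ (by have := hs.2; simp only at this ⊢; linarith)
    · rintro ⟨s, t⟩ ⟨hs, ht⟩; exact pow_ne_zero _ (by have := ht.2; simp only at this ⊢; linarith)
  have mx : ∀ ε > 0, ∀ x ∈ Ω, 0 ≤ max (u x - ε) 0 ∧ max (u x - ε) 0 ≤ u x ∧ max (u x - ε) 0 ≤ 1 - δ := fun ε hε x hx => by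
    have := h.ru x hx
    exact ⟨le_max_right _ _, max_le (by linarith) this.1, max_le (by linarith) (by linarith)⟩
  have key : ∀ ε > 0, 2 * ∫ x in Ω, GG (max (u x - ε) 0) ^ 2 * cf lam mu (u x) (v x) ≤ ∫ x in Ω, 16 / 9 * (1 / (1 - u x)^9) * (lam / (1 - v x)^2) := by
    intro ε hε
    have hφ := cut_C1c h glue_G hε
    have hψ := cut_C1c h glue_psi hε
    have s1 := h.st _ hφ
    have e1 : ∫ x, cut Ω GG u ε x ^ 2 * cf lam mu (u x) (v x) = ∫ x in Ω, GG (max (u x - ε) 0) ^ 2 * cf lam mu (u x) (v x) := by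
      rw [← setIntegral_eq_integral_of_forall_compl_eq_zero (s := Ω)]
      · refine setIntegral_congr_fun h.op.measurableSet fun x hx => ?_
        simp only [cut, indicator_of_mem hx]
      · intro x hx; simp [cut, indicator_of_notMem hx]
    rw [e1] at s1
    refine s1.trans ?_
    have s2 : ∫ x, ∑ i, (Dd i (cut Ω GG u ε) x)^2 ≤ ∫ x, ∑ i, Dd i (cut Ω psi u ε) x * Dd i u x := by
      refine integral_mono (intGrad hφ) (integrable_finsetSum _ fun i _ => intMul h.op (hψ.contDd i) (hψ.csDd i) (tsupport_Dd.trans hψ.sub) (contOn_Dd h.op (h.cu.of_le (by norm_num)) i)) fun x => ?_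
      refine Finset.sum_le_sum fun i _ => ?_
      by_cases hx : x ∈ Ω
      · rw [Dd_cut h glue_G hε hx, Dd_cut h glue_psi hε hx]
        have m := mx ε hε x hx
        have := GG_psi m.1 (by linarith)
        nlinarith [mul_le_mul_of_nonneg_right this (sq_nonneg (Dd i u x))]
      · rw [Dd_zero_of_notMem fun h => hx (hφ.sub h), Dd_zero_of_notMem fun h => hx (hψ.sub h)]; simp
    have s3 := ibp h.op hψ h.cu
    rw [← neg_eq_iff_eq_neg.2 s3, ← integral_neg] at s2
    refine s2.trans ?_
    rw [← setIntegral_eq_integral_of_forall_compl_eq_zero (s := Ω) (fun x hx => by simp [cut, indicator_of_notMem hx])]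
    refine setIntegral_mono_on ?_ irhs h.op.measurableSet fun x hx => ?_
    · exact (intMul h.op hψ.cd.continuous hψ.cs hψ.sub (contOn_lap h.op h.cu)).neg.integrableOn
    · have m := mx ε hε x hx
      have e : -(cut Ω psi u ε x * lap u x) = cut Ω psi u ε x * (lam / (1 - v x)^2) := by rw [← h.eu x hx]; ring
      rw [e]
      simp only [cut, indicator_of_mem hx]
      have b := (psi_bd m.1 (by linarith)).2
      have pu : 0 < 1 - u x := by linarith [u1 x hx]
      have b2 : 1 / (1 - max (u x - ε) 0)^9 ≤ 1 / (1 - u x)^9 := one_div_le_one_div_of_le (by positivity) (pow_le_pow_left₀ pu.le (by linarith) 9)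
      refine mul_le_mul_of_nonneg_right (b.trans (by linarith)) ?_
      positivity
  have lim : Tendsto (fun n : ℕ => 2 * ∫ x in Ω, GG (max (u x - 1 / ((n:ℝ)+1)) 0) ^ 2 * cf lam mu (u x) (v x)) atTop
      (𝓝 (2 * ∫ x in Ω, GG (u x) ^ 2 * cf lam mu (u x) (v x))) := by
    have cG : ∀ ε > 0, ContinuousOn (fun x => GG (max (u x - ε) 0)) Ω := fun ε hε => by
      have : ContinuousOn GG (Iio 1) := fun s hs => (glue_G.hd s hs).continuousAt.continuousWithinAt
      refine this.comp ((h.cu.continuousOn.sub continuousOn_const).sup continuousOn_const) fun x hx => ?_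
      have := mx ε hε x hx
      exact lt_of_le_of_lt this.2.1 (u1 x hx)
    refine Tendsto.const_mul _ ?_
    refine tendsto_integral_of_dominated_convergence (fun x => (1/δ^4)^2 * cf lam mu (u x) (v x)) (fun n => ?_) (icf.const_mul _) (fun n => ?_) ?_
    · exact (((cG _ (by positivity)).pow 2).mul ccf).aestronglyMeasurable h.op.measurableSet
    · refine (ae_restrict_iff' h.op.measurableSet).2 (Eventually.of_forall fun x hx => ?_)
      have m := mx (1 / ((n:ℝ)+1)) (by positivity) x hx
      have b := GG_bd m.1 hd m.2.2
      have : 0 ≤ cf lam mu (u x) (v x) := Real.sqrt_nonneg _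
      rw [Real.norm_of_nonneg (mul_nonneg (sq_nonneg _) this)]
      exact mul_le_mul_of_nonneg_right (pow_le_pow_left₀ b.1 b.2 2) this
    · refine (ae_restrict_iff' h.op.measurableSet).2 (Eventually.of_forall fun x hx => ?_)
      refine Tendsto.mul_const _ (Tendsto.pow ?_ 2)
      refine (glue_G.hd (u x) (u1 x hx)).continuousAt.tendsto.comp ?_
      have : Tendsto (fun n : ℕ => max (u x - 1 / ((n:ℝ)+1)) 0) atTop (𝓝 (max (u x - 0) 0)) :=
        (tendsto_const_nhds.sub tendsto_one_div_add_atTop_nhds_zero_nat).max tendsto_const_nhds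
      rwa [sub_zero, max_eq_left (h.ru x hx).1] at this
  exact le_of_tendsto' lim fun n => key _ (by positivity)

end


section
variable {N : ℕ}

lemma young16 {x y : ℝ} (hx : 0 < x) (hy : 0 ≤ y) : 16 * (y * x^15) ≤ 15 * x^16 + y^16 := by
  have hz : 0 ≤ y / x := by positivity
  have := one_add_mul_le_pow (a := y / x - 1) (by linarith) 16
  have h2 := mul_le_mul_of_nonneg_right this (pow_pos hx 16).le
  have e1 : (1 + (y / x - 1))^16 * x^16 = y^16 := by
    rw [← mul_pow]; congr 1; field_simp; ring
  have e2 : (1 + ((16:ℕ):ℝ) * (y / x - 1)) * x^16 = 16 * (y * x^15) - 15 * x^16 := by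
    push_cast; field_simp; ring
  rw [e1, e2] at h2
  linarith

lemma low_ord {A : ℝ} : 8 * A^14 ≤ A^16 / 18 + 8 * 144^7 := by
  have h0 : 0 ≤ A^2 := sq_nonneg A
  have e14 : A^14 = (A^2)^7 := by ring
  have e16 : A^16 = (A^2)^7 * A^2 := by ring
  rw [e14, e16]
  have h7 : 0 ≤ (A^2)^7 := by positivity
  rcases le_total 144 (A^2) with h | h
  · have := mul_le_mul_of_nonneg_left h h7
    have : (0:ℝ) ≤ 8 * 144^7 := by positivity
    linarith
  · have := pow_le_pow_left₀ h0 h 7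
    have : 0 ≤ (A^2)^7 * A^2 := by positivity
    linarith

lemma ptw_energy {κ : ℝ} (hκ : 1 ≤ κ) : ∃ C, 0 ≤ C ∧ ∀ r A B : ℝ, 0 < r → 1 ≤ A → 1 ≤ B → r^16 ≤ κ → 1 ≤ κ * r^16 →
    A^3*B^3*(A^16+B^16) ≤ κ * (9 * ((2 * (A^3*B^3*(A^16 - 4*A^14)) - 16/9 * (r * (A^18*B^4))) +
      r^16 * (2 * (A^3*B^3*(B^16 - 4*B^14)) - 16/9 * (r⁻¹ * (A^4*B^18))) + C)) := by
  set Q : ℝ := 8 * 144^7 * (1 + κ) with hQ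
  have hQ0 : 0 ≤ Q := by positivity
  refine ⟨(18*Q)^3*(18*Q*κ)^3*Q, by positivity, fun r A B hr hA hB h1 h2 => ?_⟩
  set ρ := r^16 with hρ
  have hρ0 : 0 < ρ := by positivity
  have A0 : 0 < A := by linarith
  have B0 : 0 < B := by linarith
  set m := A^3*B^3 with hm
  have m0 : 0 < m := by positivity
  have y1 := young16 A0 (y := r*B) (by positivity)
  have y2 := young16 (x := r*B) (y := A) (by positivity) A0.le
  rw [mul_pow r B 16, ← hρ] at y1 y2
  have e1 : r * (A^18*B^4) = m * (r * B * A^15) := by rw [hm]; ring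
  have e2 : ρ * (r⁻¹ * (A^4*B^18)) = m * (A * (r*B)^15) := by rw [hm, hρ]; field_simp
  have y3 : r * (A^18*B^4) + ρ * (r⁻¹ * (A^4*B^18)) ≤ m * (A^16 + ρ*B^16) := by
    rw [e1, e2, ← mul_add]
    exact mul_le_mul_of_nonneg_left (by linarith) m0.le
  have l1 := mul_le_mul_of_nonneg_left (low_ord (A := A)) m0.le
  have l2 := mul_le_mul_of_nonneg_left (low_ord (A := B)) (mul_pos hρ0 m0).le
  have l3 : m * (8 * 144^7) + ρ * m * (8*144^7) ≤ m * Q := by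
    have : m * (8 * 144^7) + ρ * m * (8*144^7) = m * (8*144^7*(1+ρ)) := by ring
    rw [this, hQ]; gcongr
  have l4 : m * Q ≤ m * (A^16 + ρ*B^16) / 18 + (18*Q)^3*(18*Q*κ)^3*Q := by
    rcases le_total Q ((A^16 + ρ*B^16)/18) with h | h
    · have := mul_le_mul_of_nonneg_left h m0.le
      have : 0 ≤ (18*Q)^3*(18*Q*κ)^3*Q := by positivity
      linarith
    · have b0 : 0 ≤ ρ * B^16 := by positivity
      have a0 : 0 ≤ A^16 := by positivity
      have a1 : A ≤ 18*Q := by linarith [le_self_pow₀ hA (show 16 ≠ 0 by norm_num)]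
      have b1 : B ≤ 18*Q*κ := by
        have t1 : B ≤ B^16 := le_self_pow₀ hB (by norm_num)
        have t2 : B^16 ≤ κ * ρ * B^16 := by nlinarith [pow_pos B0 16]
        have t3 : ρ * B^16 * κ ≤ 18*Q*κ := mul_le_mul_of_nonneg_right (by linarith) (by linarith)
        linarith
      have : m * Q ≤ (18*Q)^3*(18*Q*κ)^3*Q := by rw [hm]; gcongr
      have : 0 ≤ m * (A^16 + ρ*B^16) / 18 := by positivity
      linarith
  have fin : m * (A^16 + ρ*B^16) ≤ 9 * ((2 * (m*(A^16 - 4*A^14)) - 16/9 * (r * (A^18*B^4))) +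
      ρ * (2 * (m*(B^16 - 4*B^14)) - 16/9 * (r⁻¹ * (A^4*B^18))) + (18*Q)^3*(18*Q*κ)^3*Q) := by
    linarith
  refine le_trans ?_ (mul_le_mul_of_nonneg_left fin (by linarith))
  have : m * (A^16+B^16) ≤ m * (κ * A^16 + κ * ρ * B^16) := by
    refine mul_le_mul_of_nonneg_left ?_ m0.le
    nlinarith [pow_pos B0 16, pow_pos A0 16]
  linarith

def AA (t : ℝ) : ℝ := √(1 / (1 - t))

lemma AA_sq {t : ℝ} (h : t < 1) : AA t ^ 2 = 1 / (1 - t) := 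
  Real.sq_sqrt (one_div_nonneg.2 (by linarith))

lemma AA_one {t : ℝ} (h0 : 0 ≤ t) (h : t < 1) : 1 ≤ AA t := by
  rw [AA, Real.one_le_sqrt, le_div_iff₀ (by linarith)]; linarith

lemma AA_pow {t : ℝ} (h : t < 1) (k : ℕ) : 1 / (1 - t)^k = AA t ^ (2*k) := by
  rw [pow_mul, AA_sq h, div_pow, one_pow]

lemma AA_cf {lam mu s t : ℝ} (hl : 0 < lam) (hm : 0 < mu) (hs0 : 0 ≤ s) (ht0 : 0 ≤ t) (hs : s < 1) (ht : t < 1) :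
    cf lam mu s t = √lam * √mu * (AA s ^ 3 * AA t ^ 3) := by
  have a := AA_one hs0 hs
  have b := AA_one ht0 ht
  have e : lam * AA t ^ (2*3) * (mu * AA s ^ (2*3)) = (√lam * √mu * (AA s ^ 3 * AA t ^ 3))^2 := by
    rw [mul_pow, mul_pow, Real.sq_sqrt hl.le, Real.sq_sqrt hm.le]; ring
  rw [cf, AA_pow hs, AA_pow ht, e, Real.sqrt_sq (by positivity)]

lemma AA_GG {t : ℝ} (h0 : 0 ≤ t) (h : t < 1) : AA t ^ 16 - 4 * AA t ^ 14 ≤ GG t ^ 2 := by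
  have hp : 0 < 1 - t := by linarith
  have b := one_add_mul_le_pow (a := t - 1) (by linarith) 4
  push_cast at b
  have e1 : AA t ^ 14 = AA t ^ 16 * (1 - t) := by
    rw [show (16:ℕ) = 2 * 8 by norm_num, show (14:ℕ) = 2 * 7 by norm_num, ← AA_pow h, ← AA_pow h]; field_simp
  have e2 : GG t ^ 2 = AA t ^ 16 * t ^ 4 := by
    rw [GG, AA_pow h]; ring
  rw [e1, e2]
  have : 0 ≤ AA t ^ 16 := by rw [show (16:ℕ) = 2 * 8 by norm_num, ← AA_pow h]; positivity
  have e3 : 1 + (t - 1) = t := by ring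
  rw [e3] at b
  nlinarith [mul_le_mul_of_nonneg_left b this]

lemma AA_cont : ContinuousOn AA (Iio 1) :=
  (continuousOn_const.div (by fun_prop) fun s hs => by have : s < 1 := hs; linarith).sqrt

variable {Ω : Set (Euc N)} {lam mu δ : ℝ} {u v : Euc N → ℝ}

lemma intA (h : Dat Ω lam mu δ u v) {F : ℝ × ℝ → ℝ} (hF : Continuous F) :
    IntegrableOn (fun x => F (AA (u x), AA (v x))) Ω := by
  have hd := h.d0
  refine intOn_F h (F := fun p => F (AA p.1, AA p.2)) (hF.comp_continuousOn ?_)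
  refine (AA_cont.comp continuousOn_fst ?_).prodMk (AA_cont.comp continuousOn_snd ?_)
  · rintro ⟨s, t⟩ ⟨hs, ht⟩; have := hs.2; simp only [mem_Iio] at this ⊢; linarith
  · rintro ⟨s, t⟩ ⟨hs, ht⟩; have := ht.2; simp only [mem_Iio] at this ⊢; linarith

lemma half_energy' (h : Dat Ω lam mu δ u v) :
    0 ≤ ∫ x in Ω, (16/9 * (√lam / √mu * (AA (u x)^18 * AA (v x)^4)) - 2 * (AA (u x)^3 * AA (v x)^3 * (AA (u x)^16 - 4 * AA (u x)^14))) := by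
  have lp := h.lp
  have mp := h.mp
  have l0 := Real.sqrt_pos.2 lp
  have m0 := Real.sqrt_pos.2 mp
  have E := half_energy h
  have u1 := h.u1
  have v1 := h.symm.u1
  have e1 : ∫ x in Ω, 16 / 9 * (1 / (1 - u x)^9) * (lam / (1 - v x)^2) = √lam * √mu * ∫ x in Ω, 16/9 * (√lam / √mu * (AA (u x)^18 * AA (v x)^4)) := by
    rw [← integral_const_mul]
    refine setIntegral_congr_fun h.op.measurableSet fun x hx => ?_
    rw [div_eq_mul_one_div lam, AA_pow (u1 x hx), AA_pow (v1 x hx)]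
    have : lam = √lam * √lam := (Real.mul_self_sqrt lp.le).symm
    nth_rw 1 [this]
    field_simp
  have e2 : √lam * √mu * ∫ x in Ω, AA (u x)^3 * AA (v x)^3 * (AA (u x)^16 - 4 * AA (u x)^14) ≤ ∫ x in Ω, GG (u x) ^ 2 * cf lam mu (u x) (v x) := by
    rw [← integral_const_mul]
    refine setIntegral_mono_on ?_ ?_ h.op.measurableSet fun x hx => ?_
    · exact intA h (F := fun p => √lam * √mu * (p.1^3 * p.2^3 * (p.1^16 - 4 * p.1^14))) (by fun_prop)
    · refine IntegrableOn.congr_fun (intA h (F := fun p => (p.1^4 * (p.1^2 - 1)^2)^2 * (√lam * √mu * (p.1^3 * p.2^3))) (by fun_prop)) (fun x hx => ?_) h.op.measurableSet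
      simp only
      rw [AA_cf lp mp (h.ru x hx).1 (h.rv x hx).1 (u1 x hx) (v1 x hx)]
      congr 2
      have := u1 x hx
      have hp : 1 - u x ≠ 0 := by linarith
      rw [GG, show (4:ℕ) = 2 * 2 by norm_num, ← AA_pow this, AA_sq this]
      field_simp; ring
    · rw [AA_cf lp mp (h.ru x hx).1 (h.rv x hx).1 (u1 x hx) (v1 x hx)]
      have g := AA_GG (h.ru x hx).1 (u1 x hx)
      have a := AA_one (h.ru x hx).1 (u1 x hx)
      have b := AA_one (h.rv x hx).1 (v1 x hx)
      have : 0 ≤ √lam * √mu * (AA (u x) ^ 3 * AA (v x) ^ 3) := by positivity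
      nlinarith [mul_le_mul_of_nonneg_left g this]
  rw [integral_sub (intA h (F := fun p => 16/9 * (√lam / √mu * (p.1^18 * p.2^4))) (by fun_prop))
    (intA h (F := fun p => 2 * (p.1^3 * p.2^3 * (p.1^16 - 4 * p.1^14))) (by fun_prop)), integral_const_mul 2]
  rw [e1] at E
  have : √lam * √mu * (2 * ∫ x in Ω, AA (u x)^3 * AA (v x)^3 * (AA (u x)^16 - 4 * AA (u x)^14)) ≤ √lam * √mu * ∫ x in Ω, 16/9 * (√lam / √mu * (AA (u x)^18 * AA (v x)^4)) := by
    linarith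
  have := le_of_mul_le_mul_left this (by positivity)
  linarith

def DD (u v : Euc N → ℝ) (x : Euc N) : ℝ := AA (u x)^3 * AA (v x)^3 * (AA (u x)^16 + AA (v x)^16)

lemma energy (Ω : Set (Euc N)) {l0 L : ℝ} (hl0 : 0 < l0) (hL : l0 ≤ L) : ∃ C, ∀ lam mu δ u v, Dat Ω lam mu δ u v →
    l0 ≤ lam → lam ≤ L → l0 ≤ mu → mu ≤ L → ∫ x in Ω, DD u v x ≤ C := by
  have hκ : 1 ≤ (L / l0)^8 := one_le_pow₀ (by rw [le_div_iff₀ hl0]; linarith)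
  obtain ⟨C, hC0, hC⟩ := ptw_energy hκ
  refine ⟨(L/l0)^8 * (9 * (volume.real Ω * C)), fun lam mu δ u v h h1 h2 h3 h4 => ?_⟩
  set κ := (L/l0)^8
  have lp := h.lp
  have mp := h.mp
  have L0 : 0 < L := by linarith
  set r := √lam / √mu with hr
  have r0 : 0 < r := div_pos (Real.sqrt_pos.2 lp) (Real.sqrt_pos.2 mp)
  have r16 : r^16 = (lam/mu)^8 := by
    rw [hr, show (16:ℕ) = 2 * 8 by norm_num, pow_mul, div_pow, Real.sq_sqrt lp.le, Real.sq_sqrt mp.le]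
  have k1 : r^16 ≤ κ := by rw [r16]; exact pow_le_pow_left₀ (by positivity) (by gcongr) 8
  have k2 : 1 ≤ κ * r^16 := by
    rw [r16, ← mul_pow]
    refine one_le_pow₀ ?_
    rw [div_mul_div_comm, le_div_iff₀ (by positivity)]
    nlinarith
  have E1 := half_energy' h
  have E2 := half_energy' h.symm
  have rinv : √mu / √lam = r⁻¹ := by rw [hr, inv_div]
  rw [rinv] at E2
  rw [← hr] at E1
  have iD : IntegrableOn (fun x => DD u v x) Ω := intA h (F := fun p => p.1^3*p.2^3*(p.1^16+p.2^16)) (by fun_prop)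
  have i1 : IntegrableOn (fun x => 16/9 * (r * (AA (u x)^18 * AA (v x)^4)) - 2 * (AA (u x)^3 * AA (v x)^3 * (AA (u x)^16 - 4 * AA (u x)^14))) Ω :=
    intA h (F := fun p => 16/9 * (r * (p.1^18 * p.2^4)) - 2 * (p.1^3 * p.2^3 * (p.1^16 - 4 * p.1^14))) (by fun_prop)
  have i2 : IntegrableOn (fun x => 16/9 * (r⁻¹ * (AA (v x)^18 * AA (u x)^4)) - 2 * (AA (v x)^3 * AA (u x)^3 * (AA (v x)^16 - 4 * AA (v x)^14))) Ω :=
    intA h.symm (F := fun p => 16/9 * (r⁻¹ * (p.1^18 * p.2^4)) - 2 * (p.1^3 * p.2^3 * (p.1^16 - 4 * p.1^14))) (by fun_prop)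
  set f1 : Euc N → ℝ := fun x => 16/9 * (r * (AA (u x)^18 * AA (v x)^4)) - 2 * (AA (u x)^3 * AA (v x)^3 * (AA (u x)^16 - 4 * AA (u x)^14)) with hf1
  set f2 : Euc N → ℝ := fun x => 16/9 * (r⁻¹ * (AA (v x)^18 * AA (u x)^4)) - 2 * (AA (v x)^3 * AA (u x)^3 * (AA (v x)^16 - 4 * AA (v x)^14)) with hf2
  have ic : IntegrableOn (fun _ : Euc N => C) Ω := integrableOn_const h.bd.measure_lt_top.ne
  have i3 : IntegrableOn (fun x => C - f1 x) Ω := ic.sub i1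
  have i4 : IntegrableOn (fun x => C - f1 x - r^16 * f2 x) Ω := i3.sub (i2.const_mul _)
  have i5 : IntegrableOn (fun x => κ * (9 * (C - f1 x - r^16 * f2 x))) Ω := (i4.const_mul 9).const_mul κ
  have M := setIntegral_mono_on iD i5 h.op.measurableSet (fun x hx => by
    have := hC r (AA (u x)) (AA (v x)) r0 (AA_one (h.ru x hx).1 (h.u1 x hx)) (AA_one (h.rv x hx).1 (h.symm.u1 x hx)) k1 k2
    refine this.trans (le_of_eq ?_)
    simp only [hf1, hf2]
    ring)
  refine M.trans ?_
  rw [integral_const_mul, integral_const_mul, integral_sub i3 (i2.const_mul _), integral_sub ic i1, integral_const_mul, setIntegral_const, smul_eq_mul]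
  have : 0 ≤ r^16 * ∫ x in Ω, f2 x := by positivity
  refine mul_le_mul_of_nonneg_left ?_ (by linarith)
  linarith

end


section
variable {N : ℕ}

def Ph (s : ℝ) : ℝ := - Real.log (1 - s) - s - s^2/2
def Ph' (s : ℝ) : ℝ := s^2 / (1 - s)^1
def Ph'' (s : ℝ) : ℝ := (2 * s - s^2) / (1 - s)^2

lemma glue_Ph : Glue Ph Ph' := by
  refine ⟨fun s hs => ?_, contOn_quot (by fun_prop) 1, by simp [Ph], by simp [Ph']⟩
  have h1 : 1 - s ≠ 0 := by linarith
  have h : HasDerivAt (fun s : ℝ => 1 - s) (-1) s := by simpa using (hasDerivAt_id s).const_sub 1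
  have := ((h.log h1).fun_neg.fun_sub (hasDerivAt_id' s)).fun_sub ((hasDerivAt_pow 2 s).div_const 2)
  refine this.congr_deriv ?_
  unfold Ph'; push_cast; field_simp; ring

lemma glue_Ph' : Glue Ph' Ph'' := by
  refine ⟨fun s hs => ?_, contOn_quot (by fun_prop) 2, by simp [Ph'], by simp [Ph'']⟩
  have h1 : 1 - s ≠ 0 := by linarith
  have e : Ph' = fun s => s^2 * (1 / (1-s)^1) := by ext s; unfold Ph'; ring
  rw [e]
  have := (hasDerivAt_pow 2 s).fun_mul (dinv 1 hs)
  refine this.congr_deriv ?_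
  unfold Ph''; push_cast; field_simp; ring

lemma contDiffOn_two {F F' F'' : ℝ → ℝ} (h : Glue F F') (h' : Glue F' F'') : ContDiffOn ℝ 2 (fun s => F (max s 0)) (Iio 1) := by
  rw [show (2 : WithTop ℕ∞) = 1 + 1 by norm_num, contDiffOn_succ_iff_deriv_of_isOpen isOpen_Iio]
  refine ⟨fun s hs => (h.hasDeriv hs).differentiableAt.differentiableWithinAt, by simp, ?_⟩
  exact h'.contDiffOn.congr fun s hs => (h.hasDeriv hs).deriv

variable {Ω : Set (Euc N)} {lam mu δ : ℝ} {u v : Euc N → ℝ}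

lemma cut_C2on (h : Dat Ω lam mu δ u v) {ε : ℝ} (hε : 0 < ε) : ContDiffOn ℝ 2 (fun x => Ph (max (u x - ε) 0)) Ω :=
  (contDiffOn_two glue_Ph glue_Ph').comp (h.cu.sub contDiffOn_const) fun x hx => by
        have := h.u1 x hx
        change u x - ε < 1
        linarith

lemma cut_C2 (h : Dat Ω lam mu δ u v) {ε : ℝ} (hε : 0 < ε) : ContDiff ℝ 2 (cut Ω Ph u ε) := by
  have hc := cut_C1c h glue_Ph hε
  rw [contDiff_iff_contDiffAt]
  intro x
  by_cases hx : x ∈ Ω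
  · refine ((cut_C2on h hε).contDiffAt (h.op.mem_nhds hx)).congr_of_eventuallyEq ?_
    exact eventually_of_mem (h.op.mem_nhds hx) fun y hy => indicator_of_mem hy _
  · have : x ∉ tsupport (cut Ω Ph u ε) := fun h => hx (hc.sub h)
    refine (contDiffAt_const (c := (0:ℝ))).congr_of_eventuallyEq ?_
    exact notMem_tsupport_iff_eventuallyEq.1 this

lemma lap_cut_off (h : Dat Ω lam mu δ u v) {ε : ℝ} (hε : 0 < ε) {x : Euc N} (hx : x ∉ Ω) : lap (cut Ω Ph u ε) x = 0 := by
  have hc := cut_C1c h glue_Ph hε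
  have : x ∉ tsupport (cut Ω Ph u ε) := fun h => hx (hc.sub h)
  rw [lap_congr (g := fun _ => (0:ℝ)) contDiffAt_const (notMem_tsupport_iff_eventuallyEq.1 this)]
  simp [lap, secondDerivCoord]

lemma mx_bd (h : Dat Ω lam mu δ u v) {ε : ℝ} (hε : 0 < ε) {x : Euc N} (hx : x ∈ Ω) : 0 ≤ max (u x - ε) 0 ∧ max (u x - ε) 0 ≤ u x := by
  have := h.ru x hx
  exact ⟨le_max_right _ _, max_le (by linarith) this.1⟩

lemma lap_cut (h : Dat Ω lam mu δ u v) {ε : ℝ} (hε : 0 < ε) {x : Euc N} (hx : x ∈ Ω) :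
    - lap (cut Ω Ph u ε) x ≤ lam * (AA (u x)^2 * AA (v x)^4) := by
  have hn := h.op.mem_nhds hx
  have c2 := (cut_C2on h hε).contDiffAt hn
  have u1 := h.u1 x hx
  have lp := h.lp
  have e : cut Ω Ph u ε =ᶠ[𝓝 x] fun x => Ph (max (u x - ε) 0) := eventually_of_mem hn fun y hy => indicator_of_mem hy _
  rw [lap_congr c2 e]
  have d1 : ∀ s < 1, HasDerivAt (fun s => Ph (max (s - ε) 0)) (Ph' (max (s - ε) 0)) s := fun s hs =>
    (glue_Ph.hasDeriv (s := s - ε) (by linarith)).comp_sub_const s ε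
  have d2 : ∀ s < 1, HasDerivAt (fun s => Ph' (max (s - ε) 0)) (Ph'' (max (s - ε) 0)) s := fun s hs =>
    (glue_Ph'.hasDeriv (s := s - ε) (by linarith)).comp_sub_const s ε
  rw [lap_comp (F := fun s => Ph (max (s - ε) 0)) (F' := fun s => Ph' (max (s - ε) 0)) (h.cu.contDiffAt hn) c2
    (eventually_of_mem (Iio_mem_nhds u1) fun s hs => d1 s hs) (d2 _ u1)]
  obtain ⟨m0, m1⟩ := mx_bd h hε hx
  set t := max (u x - ε) 0
  have ht : 0 < 1 - t := by linarith
  have p2 : 0 ≤ Ph'' t := by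
    unfold Ph''
    have : 0 ≤ 2 * t - t^2 := by nlinarith
    positivity
  have p1 : Ph' t ≤ AA (u x)^2 := by
    rw [AA_sq u1, Ph', pow_one]
    have : t^2 ≤ 1 := by nlinarith
    have hu : 0 < 1 - u x := by linarith
    gcongr
  have s0 : 0 ≤ ∑ i, (Dd i u x)^2 := Finset.sum_nonneg fun i _ => sq_nonneg _
  have e1 := h.eu x hx
  have e2 : lam / (1 - v x)^2 = lam * AA (v x)^4 := by
    rw [div_eq_mul_one_div, AA_pow (h.symm.u1 x hx)]
  rw [e2] at e1
  have : 0 ≤ lam * AA (v x)^4 := by positivity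
  nlinarith [mul_nonneg p2 s0, mul_le_mul_of_nonneg_right p1 this]

lemma Ph_le (h : Dat Ω lam mu δ u v) {ε : ℝ} (hε : 0 < ε) {x : Euc N} (hx : x ∈ Ω) : Ph (max (u x - ε) 0) ≤ DD u v x := by
  obtain ⟨m0, m1⟩ := mx_bd h hε hx
  set t := max (u x - ε) 0
  have u1 := h.u1 x hx
  have hu : 0 < 1 - u x := by linarith
  have ht : 0 < 1 - t := by linarith
  have l := Real.log_le_sub_one_of_pos (x := 1 / (1 - t)) (by positivity)
  rw [one_div, Real.log_inv, ← one_div] at l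
  have l2 : 1 / (1 - t) ≤ 1 / (1 - u x) := by gcongr
  rw [← AA_sq u1] at l2
  have a := AA_one (h.ru x hx).1 u1
  have b := AA_one (h.rv x hx).1 (h.symm.u1 x hx)
  have d : AA (u x)^2 ≤ DD u v x := by
    unfold DD
    have h1 : AA (u x)^2 ≤ AA (u x)^3 := pow_le_pow_right₀ a (by norm_num)
    have h2 : 1 ≤ AA (v x)^3 := one_le_pow₀ b
    have h3 : 1 ≤ AA (u x)^16 := one_le_pow₀ a
    have h4 : 0 ≤ AA (v x)^16 := by positivity
    calc AA (u x)^2 ≤ AA (u x)^3 * 1 * 1 := by linarith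
      _ ≤ _ := by gcongr; linarith
  unfold Ph
  nlinarith [sq_nonneg t]

lemma ptw_D {A B w : ℝ} (hA : 1 ≤ A) (hB : 1 ≤ B) (hw : 0 < w) : A^2*B^4 ≤ (A^3*B^3*(A^16+B^16)) / w^8 + w^3 := by
  have A0 : 0 < A := by linarith
  have B0 : 0 < B := by linarith
  rcases le_total (A^2*B^4) (w^3) with h | h
  · have : 0 ≤ (A^3*B^3*(A^16+B^16)) / w^8 := by positivity
    linarith
  · have key : (A^2*B^4)^11 ≤ (A^3*B^3*(A^16+B^16))^3 := by
      have h1 : A^13*B^35 ≤ (A^16+B^16)^3 := by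
        rcases le_total A B with hab | hab
        · calc A^13*B^35 ≤ B^13*B^35 := by gcongr
            _ = (B^16)^3 := by ring
            _ ≤ _ := by gcongr; linarith [pow_pos A0 16]
        · calc A^13*B^35 ≤ A^13*A^35 := by gcongr
            _ = (A^16)^3 := by ring
            _ ≤ _ := by gcongr; linarith [pow_pos B0 16]
      calc (A^2*B^4)^11 = A^9*B^9*(A^13*B^35) := by ring
        _ ≤ A^9*B^9*(A^16+B^16)^3 := by gcongr
        _ = _ := by ring
    have k2 : (A^2*B^4*w^8)^3 ≤ (A^3*B^3*(A^16+B^16))^3 := by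
      calc (A^2*B^4*w^8)^3 = (A^2*B^4)^3*(w^3)^8 := by ring
        _ ≤ (A^2*B^4)^3*(A^2*B^4)^8 := by gcongr
        _ = (A^2*B^4)^11 := by ring
        _ ≤ _ := key
    have k3 := le_of_pow_le_pow_left₀ (by norm_num) (by positivity) k2
    rw [← le_div_iff₀ (by positivity)] at k3
    linarith [pow_pos hw 3]

lemma linf (hN : N ≤ 7) (Ω : Set (Euc N)) {l0 L : ℝ} (hl0 : 0 < l0) (hL : l0 ≤ L) : ∃ η > 0, ∀ lam mu δ u v, Dat Ω lam mu δ u v →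
    l0 ≤ lam → lam ≤ L → l0 ≤ mu → mu ≤ L → ∀ x ∈ Ω, u x ≤ 1 - η := by
  obtain ⟨C, hC⟩ := energy Ω hl0 hL
  obtain ⟨K, k, hk⟩ := exists_ker (N := N)
  obtain ⟨CK, CK0, hCK⟩ := hk.bddK
  obtain ⟨Ck, Ck0, hCk⟩ := hk.bddk
  set I := ∫ z, K z
  have I0 : 0 < I := hk.Ki
  set M := Ck * C + L * (CK * C + I) * 20
  refine ⟨Real.exp (-(M + 2)), Real.exp_pos _, fun lam mu δ u v h h1 h2 h3 h4 x hx => ?_⟩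
  have lp := h.lp
  have mp := h.mp
  have hD := hC lam mu δ u v h h1 h2 h3 h4
  let H : Euc N → ℝ := Ω.indicator (DD u v)
  have DA : ∀ y ∈ Ω, 1 ≤ AA (u y) ∧ 1 ≤ AA (v y) := fun y hy => ⟨AA_one (h.ru y hy).1 (h.u1 y hy), AA_one (h.rv y hy).1 (h.symm.u1 y hy)⟩
  have D0 : ∀ y ∈ Ω, 0 ≤ DD u v y := fun y hy => by
    obtain ⟨a, b⟩ := DA y hy
    unfold DD; positivity
  have H0 : ∀ y, 0 ≤ H y := fun y => indicator_nonneg D0 y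
  have iD : IntegrableOn (DD u v) Ω := intA h (F := fun p => p.1^3*p.2^3*(p.1^16+p.2^16)) (by fun_prop)
  have iH : Integrable H := (integrable_indicator_iff h.op.measurableSet).2 iD
  have HI : ∫ y, H y ≤ C := by rw [integral_indicator h.op.measurableSet]; exact hD
  have C0 : 0 ≤ C := (integral_nonneg H0).trans HI
  have key : ∀ ε > 0, Ph (max (u x - ε) 0) ≤ M := by
    intro ε hε
    set φ := cut Ω Ph u ε
    have c1 := cut_C1c h glue_Ph hε
    have c2 := cut_C2 h hε
    have hm := mean_id hk c2 x (r := 1)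
    have ex : cut Ω Ph u ε x = Ph (max (u x - ε) 0) := indicator_of_mem hx _
    rw [ex] at hm
    rw [hm]
    have iHx : Integrable (fun z => H (x + z)) := iH.comp_add_left x
    have t1 : ∫ z, k z * cut Ω Ph u ε (x + (1:ℝ) • z) ≤ Ck * C := by
      have m1 : ∫ z, k z * cut Ω Ph u ε (x + (1:ℝ) • z) ≤ ∫ z, Ck * H (x + z) := by
        refine integral_mono_of_nonneg (Eventually.of_forall fun z => ?_) (iHx.const_mul _) (Eventually.of_forall fun z => ?_)
        · refine mul_nonneg (hk.k0 z) ?_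
          refine indicator_nonneg (fun y hy => ?_) _
          obtain ⟨m0, m1⟩ := mx_bd h hε hy
          have u1 := h.u1 y hy
          have ht : 0 < 1 - max (u y - ε) 0 := by linarith
          have mono : MonotoneOn Ph (Ico 0 1) := by
            refine monotoneOn_of_hasDerivWithinAt_nonneg (f' := Ph') (convex_Ico 0 1) (fun x hx => (glue_Ph.hd x hx.2).continuousAt.continuousWithinAt) (fun x hx => ?_) fun x hx => ?_
            · rw [interior_Ico] at hx ⊢; exact (glue_Ph.hd x hx.2).hasDerivWithinAt
            · rw [interior_Ico] at hx
              have : 0 < 1 - x := by linarith [hx.2]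
              unfold Ph'; positivity
          have := mono ⟨le_rfl, one_pos⟩ ⟨m0, by linarith⟩ m0
          rwa [glue_Ph.z] at this
        · simp only [one_smul]
          by_cases hz : x + z ∈ Ω
          · have e1 : cut Ω Ph u ε (x + z) = Ph (max (u (x+z) - ε) 0) := indicator_of_mem hz _
            have e2 : H (x + z) = DD u v (x+z) := indicator_of_mem hz _
            rw [e1, e2]
            refine (mul_le_mul_of_nonneg_left (Ph_le h hε hz) (hk.k0 z)).trans ?_
            exact mul_le_mul_of_nonneg_right (hCk z) (D0 _ hz)
          · have e1 : cut Ω Ph u ε (x + z) = 0 := indicator_of_notMem hz _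
            rw [e1, mul_zero]
            exact mul_nonneg Ck0 (H0 _)
      rw [integral_const_mul, integral_add_left_eq_self (fun z => H z)] at m1
      exact m1.trans (mul_le_mul_of_nonneg_left HI Ck0)
    have hlc := lap_cs c2 c1.cs
    have hBM : BM (fun y => - lap (cut Ω Ph u ε) y) := BM.of_cc hlc.1.neg hlc.2.neg
    have inner : ∀ s ∈ Ioo (0:ℝ) 1, s * ∫ z, K z * (- lap (cut Ω Ph u ε) (x + s • z)) ≤ L * (CK * C + I) * s ^ (-19/20 : ℝ) := by
      intro s hs
      have s0 := hs.1
      set w : ℝ := s ^ (-13/20 : ℝ)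
      have w0 : 0 < w := Real.rpow_pos_of_pos s0 _
      have iHs : Integrable (fun z => H (x + s • z)) := (iHx.comp_smul s0.ne')
      have ik : Integrable (fun z => lam * w^3 * K z) := hk.intK.const_mul _
      have ih : Integrable (fun z => CK * lam / w^8 * H (x + s • z)) := iHs.const_mul _
      have m1 : ∫ z, K z * (- lap (cut Ω Ph u ε) (x + s • z)) ≤ ∫ z, (CK * lam / w^8 * H (x + s • z) + lam * w^3 * K z) := by
        refine integral_mono ?_ (ih.add ik) fun z => ?_
        · have := hlc.1
          refine Continuous.integrable_of_hasCompactSupport (by have := hk.contK; fun_prop) hk.csK.mul_right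
        · simp only
          have K0 := hk.K0 z
          by_cases hz : x + s • z ∈ Ω
          · obtain ⟨a, b⟩ := DA _ hz
            have e2 : H (x + s • z) = DD u v (x + s • z) := indicator_of_mem hz _
            rw [e2]
            have p := ptw_D a b w0
            have q := mul_le_mul_of_nonneg_left (lap_cut h hε hz) K0
            have q2 : K z * (lam * (AA (u (x + s • z))^2 * AA (v (x + s • z))^4)) ≤ K z * (lam * (DD u v (x + s • z) / w^8 + w^3)) := by
              unfold DD; gcongr
            have q3 : K z * (lam * (DD u v (x + s • z) / w^8)) ≤ CK * (lam * (DD u v (x + s • z) / w^8)) := by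
              refine mul_le_mul_of_nonneg_right (hCK z) ?_
              have := D0 _ hz
              positivity
            have q4 : CK * (lam * (DD u v (x + s • z) / w^8)) = CK * lam / w^8 * DD u v (x + s • z) := by ring
            linarith
          · rw [lap_cut_off h hε hz]
            have := H0 (x + s • z)
            simp only [neg_zero, mul_zero]
            positivity
      have e1 : ∫ z, H (x + s • z) = (s^N)⁻¹ * ∫ y, H y := by
        have := Measure.integral_comp_smul (volume : Measure (Euc N)) (fun z => H (x + z)) s
        rw [this, integral_add_left_eq_self (fun z => H z), finrank_euclideanSpace_fin, smul_eq_mul, abs_of_pos (by positivity)]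
      rw [integral_add ih ik, integral_const_mul, integral_const_mul, e1] at m1
      have w8 : w^8 = s ^ (-26/5 : ℝ) := by
        rw [← Real.rpow_natCast, ← Real.rpow_mul s0.le]; norm_num
      have w3 : w^3 = s ^ (-39/20 : ℝ) := by
        rw [← Real.rpow_natCast, ← Real.rpow_mul s0.le]; norm_num
      have r1 : s * ((s^N)⁻¹ / w^8) ≤ s ^ (-19/20 : ℝ) := by
        have e : s * ((s^N)⁻¹ / w^8) = s ^ ((1:ℝ) - N + 26/5) := by
          rw [w8, Real.rpow_add s0, Real.rpow_sub s0, Real.rpow_one, Real.rpow_natCast, neg_div, Real.rpow_neg s0.le]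
          field_simp
        rw [e]
        refine Real.rpow_le_rpow_of_exponent_ge s0 hs.2.le ?_
        have : (N:ℝ) ≤ 7 := by exact_mod_cast hN
        linarith
      have r2 : s * w^3 = s ^ (-19/20 : ℝ) := by
        rw [w3]; nth_rw 1 [← Real.rpow_one s]
        rw [← Real.rpow_add s0]; norm_num
      have sp : 0 ≤ s ^ (-19/20 : ℝ) := (Real.rpow_pos_of_pos s0 _).le
      have HJ : 0 ≤ ∫ y, H y := integral_nonneg H0
      have L0 : 0 ≤ L := by linarith
      calc s * ∫ z, K z * (- lap (cut Ω Ph u ε) (x + s • z)) ≤ s * (CK * lam / w^8 * ((s^N)⁻¹ * ∫ y, H y) + lam * w^3 * I) :=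
            mul_le_mul_of_nonneg_left m1 s0.le
        _ = lam * (CK * (∫ y, H y) * (s * ((s^N)⁻¹ / w^8)) + I * (s * w^3)) := by ring
        _ ≤ L * (CK * C * s ^ (-19/20 : ℝ) + I * s ^ (-19/20 : ℝ)) := by rw [r2]; gcongr
        _ = _ := by ring
    have t2 : ∫ s in (0:ℝ)..1, s * ∫ z, K z * (- lap (cut Ω Ph u ε) (x + s • z)) ≤ L * (CK * C + I) * 20 := by
      have i1 := Rop_ii hk.contK hk.csK hBM x 0 1
      have i2 : IntervalIntegrable (fun s : ℝ => L * (CK * C + I) * s ^ (-19/20 : ℝ)) volume 0 1 :=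
        (intervalIntegral.intervalIntegrable_rpow' (by norm_num)).const_mul _
      have := intervalIntegral.integral_mono_on_of_le_Ioo zero_le_one i1 i2 inner
      refine this.trans (le_of_eq ?_)
      rw [intervalIntegral.integral_const_mul, integral_rpow (Or.inl (by norm_num))]
      norm_num
    linarith
  have hfin : Ph (u x) ≤ M := by
    have lim : Tendsto (fun n : ℕ => Ph (max (u x - 1 / ((n:ℝ)+1)) 0)) atTop (𝓝 (Ph (u x))) := by
      refine (glue_Ph.hd (u x) (h.u1 x hx)).continuousAt.tendsto.comp ?_
      have : Tendsto (fun n : ℕ => max (u x - 1 / ((n:ℝ)+1)) 0) atTop (𝓝 (max (u x - 0) 0)) :=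
        (tendsto_const_nhds.sub tendsto_one_div_add_atTop_nhds_zero_nat).max tendsto_const_nhds
      rwa [sub_zero, max_eq_left (h.ru x hx).1] at this
    exact le_of_tendsto' lim fun n => key _ (by positivity)
  have u1 := h.u1 x hx
  have u0 := (h.ru x hx).1
  unfold Ph at hfin
  have : -(M+2) ≤ Real.log (1 - u x) := by nlinarith
  rw [Real.le_log_iff_exp_le (by linarith)] at this
  linarith

end


section
variable {N : ℕ}

lemma mkDat {Ω : Set (Euc N)} (hΩ : IsOpen Ω) (hbd : Bornology.IsBounded Ω) {lam mu : ℝ} (hlam : 0 < lam) (hmu : 0 < mu)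
    {u v : Euc N → ℝ} (hmin : IsMinimalSolution Ω (fun _ => (1:ℝ)) (fun _ => (1:ℝ)) lam mu u v) :
    ∃ δ, Dat Ω lam mu δ u v := by
  obtain ⟨δ, U, V, h⟩ := exists_iter hΩ hbd hlam hmu hmin
  have hs := hmin.1
  exact ⟨δ, hΩ, hbd, hlam, hmu, h.d0, hs.smooth_u, hs.smooth_v, hs.cont_u, hs.cont_v, hs.bdry_u, hs.bdry_v,
    fun x hx => ⟨(hs.range_u x hx).1, h.bu x hx⟩, fun x hx => ⟨(hs.range_v x hx).1, h.bv x hx⟩,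
    fun x hx => by rw [hs.eq_u x hx, mul_one], fun x hx => by rw [hs.eq_v x hx, mul_one],
    fun φ hφ => stab hΩ hlam hmu h hφ⟩

lemma comp_dat {Ω : Set (Euc N)} {lam mu δ lam' mu' δ' : ℝ} {u v u' v' : Euc N → ℝ} {L η : ℝ} (hη : 0 < η)
    (h : Dat Ω lam mu δ u v) (h' : Dat Ω lam' mu' δ' u' v') (hL : lam' ≤ L) (hv : ∀ x ∈ Ω, v' x ≤ 1 - η) :
    ∀ x ∈ Ω, u' x ≤ (L / η^2 + 1) / lam * u x := by
  have lp := h.lp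
  have lp' := h'.lp
  have L0 : 0 ≤ L := by linarith
  set c := (L / η^2 + 1) / lam
  have := SMP h.op h.bd (p := fun x => c * u x - u' x) ((contDiffOn_const.mul h.cu).sub h'.cu)
    ((continuousOn_const.mul h.ccu).sub h'.ccu) (fun x hx => ?_) (fun x hx => by simp [h.zu x hx, h'.zu x hx])
  · intro x hx; have := this x hx; linarith
  have d1 := h.cu.contDiffAt (h.op.mem_nhds hx)
  have d2 := h'.cu.contDiffAt (h.op.mem_nhds hx)
  rw [lap_sub (contDiffAt_const.mul d1) d2, lap_const_mul c d1]
  have e1 := h.eu x hx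
  have e2 := h'.eu x hx
  have v1 := h.symm.u1 x hx
  have v0 := (h.rv x hx).1
  have b1 : lam ≤ lam / (1 - v x)^2 := by
    rw [le_div_iff₀ (by have : 0 < 1 - v x := by linarith
                        positivity)]
    have : (1 - v x)^2 ≤ 1 := by nlinarith
    nlinarith
  have b2 : lam' / (1 - v' x)^2 ≤ L / η^2 := by
    rw [div_eq_mul_one_div, div_eq_mul_one_div L]
    have := inv_sq_bd hη (hv x hx)
    gcongr
  have c0 : 0 < c := by positivity
  have b3 : c * lam ≤ c * (lam / (1 - v x)^2) := by gcongr
  have b4 : c * lam = L / η^2 + 1 := by simp only [c]; field_simp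
  rw [← e1] at b3
  linarith

lemma half_fin {Ω : Set (Euc N)} {u v : ℕ → Euc N → ℝ} {lam mu δ : ℕ → ℝ} {uS : Euc N → ℝ} {η L : ℝ} (hη : 0 < η)
    (hne : Ω.Nonempty) (hd : ∀ n, Dat Ω (lam n) (mu n) (δ n) (u n) (v n)) (hL : ∀ n, lam n ≤ L)
    (hu : ∀ n, ∀ x ∈ Ω, u n x ≤ 1 - η) (hv : ∀ n, ∀ x ∈ Ω, v n x ≤ 1 - η)
    (hc : ContDiffOn ℝ 1 uS Ω) (hl : ∀ x, Tendsto (fun n => u n x) atTop (𝓝 (uS x))) :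
    ContinuousOn uS (closure Ω) ∧ (∀ x ∈ Ω, 0 ≤ uS x ∧ uS x < 1) ∧ (∀ x ∈ frontier Ω, uS x = 0) ∧ sSup (uS '' Ω) < 1 := by
  have z : ∀ x ∈ frontier Ω, uS x = 0 := fun x hx => tendsto_nhds_unique (hl x) (by simp [(hd _).zu x hx])
  have p : ∀ x ∈ Ω, 0 ≤ uS x := fun x hx => ge_of_tendsto' (hl x) fun n => ((hd n).ru x hx).1
  have q : ∀ x ∈ Ω, uS x ≤ 1 - η := fun x hx => le_of_tendsto' (hl x) fun n => hu n x hx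
  refine ⟨?_, fun x hx => ⟨p x hx, by linarith [q x hx]⟩, z, ?_⟩
  · refine cont_closure (hd 0).op hc.continuousOn (b := fun x => (L / η^2 + 1) / lam 0 * u 0 x) (fun x hx => ⟨p x hx, ?_⟩) z
      (continuousOn_const.mul (hd 0).ccu) fun x hx => by simp [(hd 0).zu x hx]
    exact le_of_tendsto' (hl x) fun n => comp_dat hη (hd 0) (hd n) (hL n) (hv n) x hx
  · refine lt_of_le_of_lt (csSup_le (hne.image _) (a := 1 - η) ?_) (by linarith)
    rintro _ ⟨x, hx, rfl⟩
    exact q x hx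

lemma main_fin {Ω : Set (Euc N)} {u v : ℕ → Euc N → ℝ} {lam mu δ : ℕ → ℝ} {uS vS : Euc N → ℝ} {lamS muS η L : ℝ} (hη : 0 < η)
    (hne : Ω.Nonempty) (hd : ∀ n, Dat Ω (lam n) (mu n) (δ n) (u n) (v n)) (hL : ∀ n, lam n ≤ L) (hL' : ∀ n, mu n ≤ L)
    (hu : ∀ n, ∀ x ∈ Ω, u n x ≤ 1 - η) (hv : ∀ n, ∀ x ∈ Ω, v n x ≤ 1 - η)
    (h1 : Tendsto lam atTop (𝓝 lamS)) (h2 : Tendsto mu atTop (𝓝 muS))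
    (hl : ∀ x, Tendsto (fun n => u n x) atTop (𝓝 (uS x))) (hl' : ∀ x, Tendsto (fun n => v n x) atTop (𝓝 (vS x))) :
    IsClassicalSolution Ω (fun _ => (1:ℝ)) (fun _ => (1:ℝ)) lamS muS uS vS ∧
    sSup (uS '' Ω) < 1 ∧ sSup (vS '' Ω) < 1 := by
  have A := half_sys (hd 0).op hη h1 (L := L) (fun j => by rw [abs_of_pos (hd j).lp]; exact hL j) (fun j => (hd j).cu)
    (fun j x hx => ⟨((hd j).ru x hx).1, hu j x hx⟩) (fun j x hx => ⟨((hd j).rv x hx).1, hv j x hx⟩) (fun j => (hd j).eu)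
    (fun x _ => hl x) (fun x _ => hl' x)
  have B := half_sys (hd 0).op hη h2 (L := L) (fun j => by rw [abs_of_pos (hd j).mp]; exact hL' j) (fun j => (hd j).cv)
    (fun j x hx => ⟨((hd j).rv x hx).1, hv j x hx⟩) (fun j x hx => ⟨((hd j).ru x hx).1, hu j x hx⟩) (fun j => (hd j).ev)
    (fun x _ => hl' x) (fun x _ => hl x)
  obtain ⟨a1, a2⟩ := A.2 B.1
  obtain ⟨b1, b2⟩ := B.2 A.1
  obtain ⟨c1, c2, c3, c4⟩ := half_fin hη hne hd hL hu hv A.1 hl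
  obtain ⟨d1, d2, d3, d4⟩ := half_fin hη hne (fun n => (hd n).symm) hL' hv hu B.1 hl'
  exact ⟨⟨a1, b1, c1, d1, c2, d2, c3, d3, fun x hx => by rw [a2 x hx, mul_one], fun x hx => by rw [b2 x hx, mul_one]⟩, c4, d4⟩

end

/-- **Theorem 6 (regularity of the extremal solution).** For `f ≡ g ≡ 1` and `N ≤ 7`, the
extremal solution `(u*,v*)`, obtained as the pointwise limit of minimal solutions along a
sequence of parameters below the critical curve converging to a point `(λ*,μ*)` on the
critical curve, is a smooth (classical) solution; in particular `sup_Ω u* < 1` and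
`sup_Ω v* < 1`. -/
theorem statement5 {N : ℕ} (hN : N ≤ 7) (Ω : Set (Euc N)) (hΩ : IsBddDomain Ω)
    (lam mu : ℕ → ℝ) (u v : ℕ → Euc N → ℝ)
    (hmin : ∀ n, IsMinimalSolution Ω (fun _ => (1:ℝ)) (fun _ => (1:ℝ))
      (lam n) (mu n) (u n) (v n))
    (hin : ∀ n, (lam n, mu n) ∈ LambdaSet Ω (fun _ => (1:ℝ)) (fun _ => (1:ℝ)))
    (lamS muS : ℝ) (hlamS : 0 < lamS) (hmuS : 0 < muS)
    (hcrit : (lamS, muS) ∈ frontier (LambdaSet Ω (fun _ => (1:ℝ)) (fun _ => (1:ℝ))))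
    (hconv : Tendsto (fun n => (lam n, mu n)) atTop (nhds (lamS, muS)))
    (uS vS : Euc N → ℝ)
    (hulim : ∀ x, Tendsto (fun n => u n x) atTop (nhds (uS x)))
    (hvlim : ∀ x, Tendsto (fun n => v n x) atTop (nhds (vS x))) :
    IsClassicalSolution Ω (fun _ => (1:ℝ)) (fun _ => (1:ℝ)) lamS muS uS vS ∧
    sSup (uS '' Ω) < 1 ∧ sSup (vS '' Ω) < 1 := by
  obtain ⟨hop, hbd, hne⟩ := hΩ
  have h1 : Tendsto lam atTop (𝓝 lamS) := hconv.fst_nhds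
  have h2 : Tendsto mu atTop (𝓝 muS) := hconv.snd_nhds
  have hm : 0 < min lamS muS := lt_min hlamS hmuS
  have hM1 := le_max_left lamS muS
  have hM2 := le_max_right lamS muS
  have hm1 := min_le_left lamS muS
  have hm2 := min_le_right lamS muS
  have e : ∀ᶠ n in atTop, (min lamS muS / 2 ≤ lam n ∧ lam n ≤ 2 * max lamS muS) ∧
      (min lamS muS / 2 ≤ mu n ∧ mu n ≤ 2 * max lamS muS) :=
    ((h1.eventually_const_le (by linarith)).and (h1.eventually_le_const (by linarith))).and
      ((h2.eventually_const_le (by linarith)).and (h2.eventually_le_const (by linarith)))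
  obtain ⟨n0, hn0⟩ := eventually_atTop.1 e
  obtain ⟨η, hη, hl⟩ := linf hN Ω (l0 := min lamS muS / 2) (L := 2 * max lamS muS) (by linarith) (by linarith)
  choose δ hδ using fun n => mkDat hop hbd (hin n).1 (hin n).2.1 (hmin n)
  have hb := fun n => hn0 (n + n0) (by omega)
  have s := tendsto_add_atTop_nat n0
  exact main_fin (u := fun n => u (n + n0)) (v := fun n => v (n + n0)) (lam := fun n => lam (n + n0))
    (mu := fun n => mu (n + n0)) (δ := fun n => δ (n + n0)) hη hne (fun n => hδ (n + n0))
    (fun n => (hb n).1.2) (fun n => (hb n).2.2)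
    (fun n => hl _ _ _ _ _ (hδ (n + n0)) (hb n).1.1 (hb n).1.2 (hb n).2.1 (hb n).2.2)
    (fun n => hl _ _ _ _ _ (hδ (n + n0)).symm (hb n).2.1 (hb n).2.2 (hb n).1.1 (hb n).1.2)
    (h1.comp s) (h2.comp s) (fun x => (hulim x).comp s) (fun x => (hvlim x).comp s)
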